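/- arXiv:1712.03180 — 3 statements merged into one kernel-verified Lean document; each statement's English description precedes it below -/
import Mathlib

section
/- (Nerve Theorem) Let 𝒦 = {K_i}_{i∈I} be a cover of a polyhedron K by subcomplexes and ℒ = {L_i}_{i∈I} a cover of a polyhedron L by subcomplexes, indexed by the same set I. Let p: K → L be a surjective simplicial map such that p(K_i) ⊆ L_i for each i ∈ I. If 𝒦 and ℒ are isomorphic AE(n)-covers, then p is a weak n-homotopy equivalence. -/
open Set Metric unitInterval
open scoped ENNReal Classical

noncomputable section

/-! ### Basic extension-theoretic notions -/

/-- A topological space has covering dimension `< n` (order of refinements at most `n`):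
every open cover admits an open refinement in which every point belongs to
at most `n` members. -/
def CovDimLT (X : Type*) [TopologicalSpace X] (n : ℕ) : Prop :=
  ∀ U : Set (Set X), (∀ u ∈ U, IsOpen u) → ⋃₀ U = univ →
    ∃ R : Set (Set X), (∀ r ∈ R, IsOpen r) ∧ ⋃₀ R = univ ∧
      (∀ r ∈ R, ∃ u ∈ U, r ⊆ u) ∧
      ∀ x : X, {r ∈ R | x ∈ r}.Finite ∧ {r ∈ R | x ∈ r}.ncard ≤ n

/-- Lebesgue covering dimension at most `n`. -/
def CovDimLE (X : Type*) [TopologicalSpace X] (n : ℕ) : Prop :=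
  CovDimLT X (n + 1)

/-- `X` is an absolute extensor in dimension `n` (an `AE(n)`): every continuous map into `X`
from a closed subset of an at most `n`-dimensional metric space `Y` extends continuously
over all of `Y`. -/
def IsAE.{u, v} (n : ℕ) (X : Type v) [TopologicalSpace X] : Prop :=
  ∀ (Y : Type u) [MetricSpace Y], CovDimLE Y n →
    ∀ A : Set Y, IsClosed A → ∀ f : C(A, X),
      ∃ g : C(Y, X), ∀ a : A, g ↑a = f a

/-- `X` is an absolute neighborhood extensor in dimension `n` (an `ANE(n)`): every continuous
map into `X` from a closed subset `A` of an at most `n`-dimensional metric space extends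
continuously over some open neighborhood of `A`. -/
def IsANE.{u, v} (n : ℕ) (X : Type v) [TopologicalSpace X] : Prop :=
  ∀ (Y : Type u) [MetricSpace Y], CovDimLE Y n →
    ∀ A : Set Y, IsClosed A → ∀ f : C(A, X),
      ∃ (U : Set Y) (_ : IsOpen U) (hAU : A ⊆ U) (g : C(U, X)),
        ∀ (a : Y) (ha : a ∈ A), g ⟨a, hAU ha⟩ = f ⟨a, ha⟩

/-- `X` is an `ANE(∞)`: an absolute neighborhood extensor for the class of all metric
spaces (no dimension restriction). -/
def IsANEInf.{u, v} (X : Type v) [TopologicalSpace X] : Prop :=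
  ∀ (Y : Type u) [MetricSpace Y],
    ∀ A : Set Y, IsClosed A → ∀ f : C(A, X),
      ∃ (U : Set Y) (_ : IsOpen U) (hAU : A ⊆ U) (g : C(U, X)),
        ∀ (a : Y) (ha : a ∈ A), g ⟨a, hAU ha⟩ = f ⟨a, ha⟩

/-! ### Covers -/

/-- An (indexed) family is a cover when its union is everything. -/
def IsCover {ι X : Type*} (F : ι → Set X) : Prop :=
  (⋃ i, F i) = univ

/-- A cover is an `AE(n)`-cover if the intersection of every (nonempty) subfamily is either
empty or an absolute extensor in dimension `n`. -/
def IsAECover.{u, v, w} (n : ℕ) {ι : Type v} {X : Type w} [TopologicalSpace X]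
    (F : ι → Set X) : Prop :=
  IsCover F ∧ ∀ A : Set ι, A.Nonempty →
    (⋂ i ∈ A, F i) = ∅ ∨ IsAE.{u} n (⋂ i ∈ A, F i)

/-- Two covers with the same indexing set are isomorphic if corresponding subfamilies
have nonempty intersections simultaneously. -/
def CoversIsomorphic {ι X Y : Type*} (F : ι → Set X) (G : ι → Set Y) : Prop :=
  ∀ J : Set ι, (⋂ i ∈ J, F i).Nonempty ↔ (⋂ i ∈ J, G i).Nonempty

/-- A cover is locally finite-dimensional if its nerve is a locally finite-dimensional
simplicial complex: every vertex belongs to simplices of bounded dimension only. -/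
def LocallyFinDimCover {ι X : Type*} (F : ι → Set X) : Prop :=
  ∀ i : ι, ∃ N : ℕ, ∀ A : Finset ι, i ∈ A → (⋂ j ∈ A, F j).Nonempty → A.card ≤ N

/-- Two maps are `F`-close when each pair of corresponding values lies in a common
element of `F`. -/
def CoverClose {ι X Y : Type*} (F : ι → Set Y) (f g : X → Y) : Prop :=
  ∀ x : X, ∃ i : ι, f x ∈ F i ∧ g x ∈ F i

/-- Two maps are `F`-homotopic when they are joined by a homotopy each of whose paths
lies in a single element of `F`. -/
def CoverHomotopic {ι X Y : Type*} [TopologicalSpace X] [TopologicalSpace Y]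
    (F : ι → Set Y) (f g : C(X, Y)) : Prop :=
  ∃ H : f.Homotopy g, ∀ x : X, ∃ i : ι, ∀ t : unitInterval, H (t, x) ∈ F i

/-- The mesh of a cover: the supremum of the diameters of its elements. -/
def coverMesh {ι X : Type*} [PseudoEMetricSpace X] (F : ι → Set X) : ℝ≥0∞ :=
  ⨆ i, EMetric.diam (F i)

/-! ### Homotopy-theoretic notions -/

/-- The function induced by a continuous map on homotopy groups (of index type `N`). -/
def HomotopyGroup.inducedMap {X Y : Type*} [TopologicalSpace X] [TopologicalSpace Y]
    (f : C(X, Y)) (N : Type*) (x : X) :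
    HomotopyGroup N X x → HomotopyGroup N Y (f x) :=
  Quotient.map
    (fun g => ⟨f.comp g.1, fun y hy => by
      simp only [ContinuousMap.comp_apply]
      rw [g.2 y hy]⟩)
    (fun g h H => H.elim fun H => ⟨H.compContinuousMap f⟩)

/-- A continuous map is a weak `n`-homotopy equivalence if it induces isomorphisms on
homotopy groups in all dimensions `< n`, regardless of the choice of basepoint. -/
def IsWeakNHomotopyEquiv {X Y : Type*} [TopologicalSpace X] [TopologicalSpace Y]
    (n : ℕ) (f : C(X, Y)) : Prop :=
  ∀ k < n, ∀ x : X, Function.Bijective (HomotopyGroup.inducedMap f (Fin k) x)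

/-- `X` has vanishing homotopy groups in all dimensions `< n`, for every basepoint. -/
def VanishingHomotopyBelow (n : ℕ) (X : Type*) [TopologicalSpace X] : Prop :=
  ∀ k < n, ∀ x : X, Subsingleton (HomotopyGroup (Fin k) X x)

/-- `f` is null-homotopic inside the subset `U`: there is a homotopy, with values in `U`,
from `f` to a constant map. -/
def NullHomotopicIn {S X : Type*} [TopologicalSpace S] [TopologicalSpace X]
    (f : C(S, X)) (U : Set X) : Prop :=
  ∃ (H : C(S × unitInterval, X)) (c : X),
    (∀ s : S, H (s, 0) = f s) ∧ (∀ s : S, H (s, 1) = c) ∧ ∀ z, H z ∈ U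

/-- `X` is locally `k`-connected: every neighborhood `U` of a point contains a
neighborhood `V` of the point such that every map of the `k`-sphere into `V` is
null-homotopic in `U`. -/
def LocallyKConnected (k : ℕ) (X : Type*) [TopologicalSpace X] : Prop :=
  ∀ (x : X) (U : Set X), IsOpen U → x ∈ U →
    ∃ V : Set X, IsOpen V ∧ x ∈ V ∧
      ∀ f : C(Metric.sphere (0 : EuclideanSpace ℝ (Fin (k + 1))) 1, X),
        (∀ s, f s ∈ V) → NullHomotopicIn f U

/-- `A` is a deformation retract of `B` (both subsets of an ambient space `X`). -/
def IsDeformationRetractOf {X : Type*} [TopologicalSpace X] (A B : Set X) : Prop :=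
  A ⊆ B ∧ ∃ H : C(B × unitInterval, X),
    (∀ b : B, H (b, 0) = ↑b) ∧ (∀ b : B, H (b, 1) ∈ A) ∧
    (∀ (b : B) (t : unitInterval), H (b, t) ∈ B) ∧
    ∀ b : B, (b : X) ∈ A → H (b, 1) = ↑b

/-! ### Simplicial complexes and their metric realizations -/

/-- An abstract simplicial complex on a vertex type `V`. -/
structure SComplex (V : Type*) where
  faces : Set (Finset V)
  nonempty_of_mem : ∀ s ∈ faces, s.Nonempty
  down_closed : ∀ s ∈ faces, ∀ t : Finset V, t ⊆ s → t.Nonempty → t ∈ faces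

namespace SComplex

variable {V W : Type*}

/-- The geometric realization with scale `κ` of a simplicial complex, i.e. the polyhedron,
as a subset of `ℓ¹(V)`: nonnegative functions supported on a simplex whose coordinates sum
to `κ` (each vertex `v` is the point `κ·e_v`).  It carries the metric topology induced from
the `ℓ¹`-norm. -/
def space (K : SComplex V) (κ : ℝ) : Set (lp (fun _ : V => ℝ) 1) :=
  {x | (∀ v, 0 ≤ x v) ∧ (∃ s ∈ K.faces, ∀ v, x v ≠ 0 → v ∈ s) ∧
    HasSum (fun v => x v) κ}

/-- The closed geometric simplex of the realization spanned by a face `s`. -/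
def cell (K : SComplex V) (κ : ℝ) (s : Finset V) : Set (K.space κ) :=
  {x | ∀ v, (x : lp (fun _ : V => ℝ) 1) v ≠ 0 → v ∈ s}

/-- The simplices of the barycentric subdivision `βK` are the nonempty finite chains
of faces of `K`. -/
def IsChainOfFaces (K : SComplex V) (c : Finset (Finset V)) : Prop :=
  c.Nonempty ∧ (∀ s ∈ c, s ∈ K.faces) ∧ ∀ s₁ ∈ c, ∀ s₂ ∈ c, s₁ ⊆ s₂ ∨ s₂ ⊆ s₁

/-- The closed geometric simplex of the barycentric subdivision `βK` spanned by the chain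
`c`, viewed inside the realization of `K`: the convex hull of the barycenters of the
faces in `c`. -/
def chainCell (K : SComplex V) (κ : ℝ) (c : Finset (Finset V)) : Set (K.space κ) :=
  {y | ∃ t : Finset V → ℝ, (∀ s, 0 ≤ t s) ∧ (∀ s, t s ≠ 0 → s ∈ c) ∧
      (∑ s ∈ c, t s) = κ ∧
      ∀ w, (y : lp (fun _ : V => ℝ) 1) w =
        ∑ s ∈ c, (if w ∈ s then t s / (s.card : ℝ) else 0)}

/-- A set of faces forms a subcomplex of `K`. -/
def IsSubcomplex (K : SComplex V) (F : Set (Finset V)) : Prop :=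
  F ⊆ K.faces ∧ ∀ s ∈ F, ∀ t : Finset V, t ⊆ s → t.Nonempty → t ∈ F

/-- The point set of the subcomplex with faces `F`, inside the realization of `K`. -/
def subSpace (K : SComplex V) (κ : ℝ) (F : Set (Finset V)) : Set (K.space κ) :=
  {x | ∃ s ∈ F, ∀ v, (x : lp (fun _ : V => ℝ) 1) v ≠ 0 → v ∈ s}

/-- The barycentric star of a subcomplex `F` in `K`: the union of the simplices of the
barycentric subdivision `βK` that intersect the subcomplex. -/
def bst (K : SComplex V) (κ : ℝ) (F : Set (Finset V)) : Set (K.space κ) :=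
  ⋃ c ∈ {c | K.IsChainOfFaces c ∧ (K.chainCell κ c ∩ K.subSpace κ F).Nonempty},
    K.chainCell κ c

/-- The open star of a subcomplex `F` in `K`: the complement of the union of all
simplices of `K` that do not intersect the subcomplex. -/
def ost (K : SComplex V) (κ : ℝ) (F : Set (Finset V)) : Set (K.space κ) :=
  (⋃ s ∈ {s | s ∈ K.faces ∧ K.cell κ s ∩ K.subSpace κ F = ∅}, K.cell κ s)ᶜ

/-- The open star of a subcomplex `F` taken in the barycentric subdivision `βK`:
the complement of the union of all simplices of `βK` that do not intersect the
subcomplex. -/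
def ostBsd (K : SComplex V) (κ : ℝ) (F : Set (Finset V)) : Set (K.space κ) :=
  (⋃ c ∈ {c | K.IsChainOfFaces c ∧ K.chainCell κ c ∩ K.subSpace κ F = ∅},
    K.chainCell κ c)ᶜ

/-- Barycentric star of a vertex. -/
def bstVertex (K : SComplex V) (κ : ℝ) (v : V) : Set (K.space κ) :=
  K.bst κ {({v} : Finset V)}

/-- Open star of a vertex. -/
def ostVertex (K : SComplex V) (κ : ℝ) (v : V) : Set (K.space κ) :=
  K.ost κ {({v} : Finset V)}

/-- A simplicial complex is locally finite-dimensional if the simplices containing any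
given vertex have bounded dimension. -/
def LocallyFiniteDimensional (K : SComplex V) : Prop :=
  ∀ v : V, {v} ∈ K.faces → ∃ N : ℕ, ∀ s ∈ K.faces, v ∈ s → s.card ≤ N

/-- `p` is a simplicial map of the realizations (scales `κ`, `lam`): it is induced by a
vertex map `φ` carrying faces onto faces, extended affinely on each simplex. -/
def IsSimplicialMap (K : SComplex V) (L : SComplex W) (κ lam : ℝ)
    (p : K.space κ → L.space lam) : Prop :=
  ∃ φ : V → W,
    (∀ s ∈ K.faces, ∃ t ∈ L.faces,
      (∀ v ∈ s, φ v ∈ t) ∧ ∀ w ∈ t, ∃ v ∈ s, φ v = w) ∧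
    ∀ (x : K.space κ) (w : W),
      (p x : lp (fun _ : W => ℝ) 1) w =
        (lam / κ) * ∑' v : V, (if φ v = w then (x : lp (fun _ : V => ℝ) 1) v else 0)

/-- `p` is quasi-simplicial: it is simplicial as a map into the barycentric subdivision
`βL`, i.e. induced by a vertex map `φ` from vertices of `K` to faces of `L` (the vertices
of `βL`) carrying each face of `K` into a chain, extended affinely; the formula is the
composition of the simplicial extension with the canonical identification `|βL| = |L|`
sending the vertex `s` of `βL` to the barycenter of `s`. -/
def IsQuasiSimplicialMap (K : SComplex V) (L : SComplex W) (κ lam : ℝ)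
    (p : K.space κ → L.space lam) : Prop :=
  ∃ φ : V → Finset W,
    (∀ v : V, ({v} : Finset V) ∈ K.faces → φ v ∈ L.faces) ∧
    (∀ s ∈ K.faces, ∀ v₁ ∈ s, ∀ v₂ ∈ s, φ v₁ ⊆ φ v₂ ∨ φ v₂ ⊆ φ v₁) ∧
    ∀ (x : K.space κ) (w : W),
      (p x : lp (fun _ : W => ℝ) 1) w =
        (lam / κ) *
          ∑' v : V, (if w ∈ φ v then (x : lp (fun _ : V => ℝ) 1) v / ((φ v).card : ℝ)
            else 0)

/-- A quasi-simplicial map is `n`-regular if the preimage of every (closed) simplex of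
the barycentric subdivision `βL` has vanishing homotopy groups in dimensions `< n`,
regardless of basepoint. -/
def IsNRegularMap (n : ℕ) (K : SComplex V) (L : SComplex W) (κ lam : ℝ)
    (p : K.space κ → L.space lam) : Prop :=
  IsQuasiSimplicialMap K L κ lam p ∧
    ∀ c : Finset (Finset W), L.IsChainOfFaces c →
      VanishingHomotopyBelow n (p ⁻¹' (L.chainCell lam c))

end SComplex

/-! ### Inverse limits -/

/-- The long projection of an inverse limit (realized as the subspace of the product
consisting of all threads) onto its `i`-th coordinate space. -/
def invLimProj {Z : ℕ → Type*} [∀ i, TopologicalSpace (Z i)]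
    (p : ∀ i, C(Z (i + 1), Z i)) (i : ℕ) :
    C({x : ∀ j, Z j // ∀ j, p j (x (j + 1)) = x j}, Z i) :=
  ⟨fun x => x.1 i, (continuous_apply i).comp continuous_subtype_val⟩

/-- The short projections of an inverse sequence: `shortProj p i m : Z (i + m) → Z i`. -/
def shortProj {Z : ℕ → Type*} [∀ i, TopologicalSpace (Z i)]
    (p : ∀ i, C(Z (i + 1), Z i)) (i : ℕ) : ∀ m : ℕ, C(Z (i + m), Z i)
  | 0 => ContinuousMap.id _
  | m + 1 => (shortProj p i m).comp (p (i + m))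

end

universe u

/-! ### Proof -/

namespace NerveProof

/-- open star of the lattice point `v` in the Kuhn triangulation, scaled by `N` -/
def kstar (m : ℕ) (N : ℝ) (v : Fin m → ℤ) : Set (ULift.{u} (Fin m → I)) :=
  {x | (∀ i, |N * (x.down i : ℝ) - v i| < 1) ∧
    ∀ i j, (N * (x.down i : ℝ) - v i) - (N * (x.down j : ℝ) - v j) < 1}

lemma kstar_open (m : ℕ) (N : ℝ) (v : Fin m → ℤ) : IsOpen (kstar.{u} m N v) := by
  have hc : ∀ i : Fin m, Continuous fun x : ULift.{u} (Fin m → I) => (x.down i : ℝ) := fun i =>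
    continuous_subtype_val.comp ((continuous_apply i).comp continuous_uliftDown)
  have : kstar.{u} m N v = (⋂ i, {x | |N * (x.down i : ℝ) - v i| < 1}) ∩
      ⋂ i, ⋂ j, {x | (N * (x.down i : ℝ) - v i) - (N * (x.down j : ℝ) - v j) < 1} := by
    ext x; simp [kstar]
  rw [this]
  refine IsOpen.inter (isOpen_iInter_of_finite fun i => ?_)
    (isOpen_iInter_of_finite fun i => isOpen_iInter_of_finite fun j => ?_)
  · exact isOpen_lt (((continuous_const.mul (hc i)).sub continuous_const).abs) continuous_const
  · exact isOpen_lt (((continuous_const.mul (hc i)).sub continuous_const).sub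
      ((continuous_const.mul (hc j)).sub continuous_const)) continuous_const

lemma kstar_cmp {m : ℕ} {N : ℝ} {v w : Fin m → ℤ} {x : ULift.{u} (Fin m → I)}
    (hv : x ∈ kstar m N v) (hw : x ∈ kstar m N w) (i : Fin m) (hi : v i < w i) :
    ∀ j, v j ≤ w j ∧ w j ≤ v j + 1 := by
  intro j
  constructor
  · by_contra! h
    have h1 : (v i : ℝ) + 1 ≤ w i := by exact_mod_cast hi
    have h2 : (w j : ℝ) + 1 ≤ v j := by exact_mod_cast h
    have := hv.2 i j
    have := hw.2 j i
    linarith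
  · by_contra! h
    have h' : v j + 2 ≤ w j := by omega
    have h2 : (v j : ℝ) + 2 ≤ w j := by exact_mod_cast h'
    have h3 := abs_lt.1 (hv.1 j)
    have h4 := abs_lt.1 (hw.1 j)
    linarith [h3.1, h3.2, h4.1, h4.2]

lemma kstar_sum_le {m : ℕ} {N : ℝ} {v w : Fin m → ℤ} {x : ULift.{u} (Fin m → I)}
    (hv : x ∈ kstar m N v) (hw : x ∈ kstar m N w) : ∑ i, w i ≤ ∑ i, v i + m := by
  have : ∀ j, w j ≤ v j + 1 := by
    intro j
    rcases lt_or_ge (v j) (w j) with h | h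
    · exact (kstar_cmp hv hw j h j).2
    · omega
  calc ∑ i, w i ≤ ∑ i, (v i + 1) := Finset.sum_le_sum fun i _ => this i
    _ = _ := by simp [Finset.sum_add_distrib]

lemma kstar_inj {m : ℕ} {N : ℝ} {v w : Fin m → ℤ} {x : ULift.{u} (Fin m → I)}
    (hv : x ∈ kstar m N v) (hw : x ∈ kstar m N w) (h : ∑ i, v i = ∑ i, w i) : v = w := by
  by_contra hne
  obtain ⟨i, hi⟩ := Function.ne_iff.1 hne
  rcases lt_or_gt_of_ne hi with hi | hi
  · exact absurd h (ne_of_lt (Finset.sum_lt_sum (fun j _ => (kstar_cmp hv hw i hi j).1)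
      ⟨i, Finset.mem_univ _, hi⟩))
  · exact absurd h.symm (ne_of_lt (Finset.sum_lt_sum (fun j _ => (kstar_cmp hw hv i hi j).1)
      ⟨i, Finset.mem_univ _, hi⟩))

lemma kstar_count (m : ℕ) (N : ℝ) (x : ULift.{u} (Fin m → I)) :
    {v | x ∈ kstar m N v}.Finite ∧ {v | x ∈ kstar m N v}.ncard ≤ m + 1 := by
  rcases Set.eq_empty_or_nonempty {v | x ∈ kstar m N v} with h | hne
  · simp [h]
  set S := {v | x ∈ kstar m N v} with hS
  have hinj : Set.InjOn (fun v : Fin m → ℤ => ∑ i, v i) S := fun v hv w hw h => kstar_inj hv hw h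
  have hb : BddBelow ((fun v : Fin m → ℤ => ∑ i, v i) '' S) := by
    obtain ⟨v, hv⟩ := hne
    refine ⟨∑ i, v i - m, ?_⟩
    rintro _ ⟨w, hw, rfl⟩
    have := kstar_sum_le hw hv
    simp only; omega
  obtain ⟨v, hv, hmin⟩ : sInf ((fun v : Fin m → ℤ => ∑ i, v i) '' S) ∈ _ :=
    Int.csInf_mem (hne.image _) hb
  have hsub : (fun v : Fin m → ℤ => ∑ i, v i) '' S ⊆ Set.Icc (∑ i, v i) (∑ i, v i + m) := by
    rintro _ ⟨w, hw, rfl⟩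
    refine ⟨?_, kstar_sum_le hv hw⟩
    have := csInf_le hb ⟨w, hw, rfl⟩
    rw [← hmin] at this
    exact this
  have hfin := (Set.finite_Icc (∑ i, v i) (∑ i, v i + (m : ℤ))).subset hsub
  refine ⟨hfin.of_finite_image hinj, ?_⟩
  rw [← hinj.ncard_image]
  refine (Set.ncard_le_ncard hsub (Set.finite_Icc _ _)).trans ?_
  rw [Set.ncard_eq_toFinset_card']
  simp
  omega

lemma covDim_cube {m n : ℕ} (hmn : m ≤ n) : CovDimLE (ULift.{u} (Fin m → I)) n := by
  intro U hU hcov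
  have hcpt : CompactSpace (ULift.{u} (Fin m → I)) := Homeomorph.ulift.symm.compactSpace
  obtain ⟨δ, hδ, hleb⟩ := lebesgue_number_lemma_of_metric_sUnion (isCompact_univ) hU
    (by rw [hcov])
  obtain ⟨N, hN⟩ := exists_nat_gt (2 / δ)
  have hNpos : (0 : ℝ) < N := lt_of_le_of_lt (by positivity) hN
  have hN2 : 2 < N * δ := by
    rwa [div_lt_iff₀ hδ] at hN
  refine ⟨{r | (∃ v, r = kstar m N v) ∧ r.Nonempty}, ?_, ?_, ?_, ?_⟩
  · rintro r ⟨⟨v, rfl⟩, -⟩; exact kstar_open _ _ _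
  · rw [eq_univ_iff_forall]
    intro x
    have hx : x ∈ kstar m N (fun i => ⌊(N : ℝ) * (x.down i : ℝ)⌋) := by
      have h0 : ∀ i, 0 ≤ (N : ℝ) * (x.down i : ℝ) - ⌊(N : ℝ) * (x.down i : ℝ)⌋ := fun i => by
        linarith [Int.floor_le ((N : ℝ) * (x.down i : ℝ))]
      have h1 : ∀ i, (N : ℝ) * (x.down i : ℝ) - ⌊(N : ℝ) * (x.down i : ℝ)⌋ < 1 := fun i => by
        linarith [Int.lt_floor_add_one ((N : ℝ) * (x.down i : ℝ))]
      refine ⟨fun i => ?_, fun i j => ?_⟩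
      · rw [abs_lt]; exact ⟨by linarith [h0 i], h1 i⟩
      · linarith [h0 j, h1 i]
    exact ⟨_, ⟨⟨_, rfl⟩, ⟨x, hx⟩⟩, hx⟩
  · rintro r ⟨⟨v, rfl⟩, ⟨x, hx⟩⟩
    obtain ⟨t, ht, hsub⟩ := hleb x (mem_univ _)
    refine ⟨t, ht, fun y hy => hsub ?_⟩
    rw [Metric.mem_ball]
    change dist y.down x.down < δ
    rw [dist_pi_lt_iff hδ]
    intro i
    rw [Subtype.dist_eq, Real.dist_eq]
    have h1 := abs_lt.1 (hx.1 i)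
    have h2 := abs_lt.1 (hy.1 i)
    rw [abs_lt]
    constructor
    · by_contra! h
      nlinarith [mul_le_mul_of_nonneg_left h hNpos.le, h1.1, h1.2, h2.1, h2.2]
    · by_contra! h
      nlinarith [mul_le_mul_of_nonneg_left h hNpos.le, h1.1, h1.2, h2.1, h2.2]
  · intro x
    obtain ⟨hf, hc⟩ := kstar_count m N x
    have hsub : {r ∈ {r | (∃ v, r = kstar m (N : ℝ) v) ∧ r.Nonempty} | x ∈ r} ⊆
        kstar m N '' {v | x ∈ kstar m N v} := by
      rintro r ⟨⟨⟨v, rfl⟩, -⟩, hx⟩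
      exact ⟨v, hx, rfl⟩
    refine ⟨(hf.image _).subset hsub, ?_⟩
    refine (Set.ncard_le_ncard hsub (hf.image _)).trans ((Set.ncard_image_le hf).trans ?_)
    omega

/-- extension into one `AE(n)` set, on a space homeomorphic to a cube -/
lemma ext_one {X Y : Type*} [TopologicalSpace X] [TopologicalSpace Y] {m n : ℕ} (hmn : m ≤ n)
    (e : Y ≃ₜ (Fin m → I)) {D : Set X} (hD : IsAE.{u} n D) {A : Set Y} (hA : IsClosed A)
    {g : Y → X} (hg : ContinuousOn g A) (hgD : MapsTo g A D) :
    ∃ G : Y → X, Continuous G ∧ (∀ y, G y ∈ D) ∧ EqOn G g A := by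
  let e' : ULift.{u} (Fin m → I) ≃ₜ Y := Homeomorph.ulift.trans e.symm
  let g' : C((e' ⁻¹' A : Set _), D) := ⟨fun a => ⟨g (e' a.1), hgD a.2⟩, by
    refine Continuous.subtype_mk ?_ _
    exact hg.comp_continuous (e'.continuous.comp continuous_subtype_val) (fun a => a.2)⟩
  obtain ⟨G, hG⟩ := hD (ULift.{u} (Fin m → I)) (covDim_cube hmn) (e' ⁻¹' A)
    (hA.preimage e'.continuous) g'
  refine ⟨fun y => G (e'.symm y), continuous_subtype_val.comp (G.continuous.comp e'.symm.continuous),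
    fun y => (G _).2, fun y hy => ?_⟩
  have := hG ⟨e'.symm y, by simpa using hy⟩
  simp only [this]
  simp [g']

/-- selection extension -/
lemma ext_sel {ι X Y : Type*} [TopologicalSpace X] [TopologicalSpace Y] {m n : ℕ} (hmn : m ≤ n)
    (e : Y ≃ₜ (Fin m → I)) (F : ι → Set X) (J : Y → Set ι)
    (hJ : ∀ T : Set ι, IsClosed {y | T ⊆ J y})
    (hAE : ∀ y, IsAE.{u} n (⋂ i ∈ J y, F i)) (S : Finset (Set ι)) :
    ∀ (A : Set Y) (_ : IsClosed A) (g : Y → X) (_ : ContinuousOn g A)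
      (_ : ∀ a ∈ A, ∀ i ∈ J a, g a ∈ F i) (_ : ∀ y, y ∉ A → J y ∈ S),
    ∃ G : Y → X, Continuous G ∧ EqOn G g A ∧ ∀ y, ∀ i ∈ J y, G y ∈ F i := by
  induction S using Finset.strongInduction with
  | H S ih =>
  intro A hA g hg hsel hS
  rcases S.eq_empty_or_nonempty with rfl | hne
  · have hAu : A = univ := by
      rw [eq_univ_iff_forall]; intro y; by_contra h; simpa using hS y h
    subst hAu
    exact ⟨g, continuousOn_univ.1 hg, fun _ _ => rfl, fun y => hsel y (mem_univ _)⟩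
  obtain ⟨T, hT⟩ := S.exists_maximal hne
  by_cases hex : ∃ y, J y = T
  · obtain ⟨y₀, rfl⟩ := hex
    have hZ := hJ (J y₀)
    set Z := {y | J y₀ ⊆ J y} with hZdef
    obtain ⟨G₁, hG₁, hG₁D, hG₁e⟩ := ext_one hmn e (hAE y₀) (hA.inter hZ)
      (hg.mono inter_subset_left) (by
        intro a ha
        simp only [mem_iInter]
        exact fun i hi => hsel a ha.1 i (ha.2 hi))
    let g₂ : Y → X := fun y => if y ∈ A then g y else G₁ y
    have e1 : EqOn g₂ g A := fun y hy => by simp [g₂, hy]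
    have e2 : EqOn g₂ G₁ Z := fun y hy => by
      by_cases h : y ∈ A
      · simp only [g₂, h, if_true]; exact (hG₁e ⟨h, hy⟩).symm
      · simp [g₂, h]
    obtain ⟨G, hG, hGe, hGs⟩ := ih (S.erase (J y₀)) (Finset.erase_ssubset hT.1) (A ∪ Z)
      (hA.union hZ) g₂ ((hg.congr e1).union_of_isClosed (hG₁.continuousOn.congr e2) hA hZ) (by
        rintro a ha i hi
        by_cases haA : a ∈ A
        · rw [e1 haA]; exact hsel a haA i hi
        · have haZ : a ∈ Z := ha.resolve_left haA
          rw [e2 haZ]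
          have := hG₁D a
          simp only [mem_iInter] at this
          exact this i (hT.2 (hS a haA) haZ hi))
      (by
        intro y hy
        rw [mem_union, not_or] at hy
        refine Finset.mem_erase.2 ⟨fun h => hy.2 ?_, hS y hy.1⟩
        exact h.ge)
    exact ⟨G, hG, fun a ha => (hGe (Or.inl ha)).trans (e1 ha), hGs⟩
  · refine ih (S.erase T) (Finset.erase_ssubset hT.1) A hA g hg hsel fun y hy => ?_
    exact Finset.mem_erase.2 ⟨fun h => hex ⟨y, h⟩, hS y hy⟩

section poly

variable {V : Type*}

lemma coord_cont (v : V) : Continuous fun x : lp (fun _ : V => ℝ) 1 => x v :=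
  (lp.lipschitzWith_one_eval 1 v).continuous

/-- the indices of members of the family containing `x` -/
def idx {ι : Type*} (K : SComplex V) (κ : ℝ) (KF : ι → Set (Finset V)) (x : K.space κ) : Set ι :=
  {i | x ∈ K.subSpace κ (KF i)}

lemma subSpace_closed (K : SComplex V) (κ : ℝ) (F : Set (Finset V)) :
    IsClosed (K.subSpace κ F) := by
  rw [← isOpen_compl_iff, isOpen_iff_mem_nhds]
  intro x hx
  obtain ⟨-, ⟨s, hs, hsx⟩, -⟩ := x.2
  let t : Finset V := s.filter fun v => (x : lp (fun _ : V => ℝ) 1) v ≠ 0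
  have ho : IsOpen (⋂ v ∈ t, {y : K.space κ | (y : lp (fun _ : V => ℝ) 1) v ≠ 0}) :=
    isOpen_biInter_finset fun v _ =>
      isOpen_ne_fun ((coord_cont v).comp continuous_subtype_val) continuous_const
  refine Filter.mem_of_superset (ho.mem_nhds ?_) ?_
  · simp [t]
  · rintro y hy ⟨s', hs', hy'⟩
    refine hx ⟨s', hs', fun v hv => hy' v ?_⟩
    simp only [mem_iInter] at hy
    exact hy v (by simp [t, hsx v hv, hv])

lemma idx_closed {ι Z : Type*} [TopologicalSpace Z] (K : SComplex V) (κ : ℝ)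
    (KF : ι → Set (Finset V)) {g : Z → K.space κ} {B : Set Z} (hB : IsClosed B)
    (hg : ContinuousOn g B) (T : Set ι) : IsClosed {y | y ∈ B ∧ T ⊆ idx K κ KF (g y)} := by
  have : {y | y ∈ B ∧ T ⊆ idx K κ KF (g y)} =
      B ∩ g ⁻¹' (⋂ i ∈ T, K.subSpace κ (KF i)) := by
    ext y
    simp only [mem_ofPred_eq, mem_inter_iff, mem_preimage, mem_iInter]
    rfl
  rw [this]
  exact hg.preimage_isClosed_of_isClosed hB
    (isClosed_iInter fun i => isClosed_iInter fun _ => subSpace_closed _ _ _)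

lemma idx_finite {ι Z : Type*} (K : SComplex V) (κ : ℝ) (KF : ι → Set (Finset V))
    (g : Z → K.space κ) (F : Finset V)
    (hF : ∀ z v, (g z : lp (fun _ : V => ℝ) 1) v ≠ 0 → v ∈ F) :
    (range fun z => idx K κ KF (g z)).Finite := by
  let Ψ : Finset V → Set ι := fun t => {i | ∃ s ∈ KF i, ∀ v ∈ t, v ∈ s}
  refine ((F.powerset.finite_toSet).image Ψ).subset ?_
  rintro _ ⟨z, rfl⟩
  refine ⟨F.filter fun v => (g z : lp (fun _ : V => ℝ) 1) v ≠ 0,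
    Finset.mem_coe.2 (Finset.mem_powerset.2 (Finset.filter_subset _ _)), ?_⟩
  ext i
  simp only [Ψ, idx, SComplex.subSpace, mem_ofPred_eq, Finset.mem_filter]
  refine exists_congr fun s => and_congr_right fun _ => forall_congr' fun v => ?_
  exact ⟨fun h hv => h ⟨hF z v hv, hv⟩, fun h hv => h hv.2⟩

lemma finitize (K : SComplex V) {κ : ℝ} (hκ : 0 < κ) {Z : Type*} [TopologicalSpace Z]
    [CompactSpace Z] (f : C(Z, K.space κ)) (B : Finset V) :
    ∃ (F : Finset V) (H : C(I × Z, K.space κ)), B ⊆ F ∧ (∀ z, H (0, z) = f z) ∧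
      (∀ z v, (H (1, z) : lp (fun _ : V => ℝ) 1) v ≠ 0 → v ∈ F) ∧
      ∀ z, (∀ v, (f z : lp (fun _ : V => ℝ) 1) v ≠ 0 → v ∈ B) → ∀ t, H (t, z) = f z := by
  have hfc : ∀ v, Continuous fun z => (f z : lp (fun _ : V => ℝ) 1) v := fun v =>
    (coord_cont v).comp (continuous_subtype_val.comp f.continuous)
  have hnn : ∀ z v, 0 ≤ (f z : lp (fun _ : V => ℝ) 1) v := fun z => (f z).2.1
  -- choose F
  obtain ⟨F, hBF, hF⟩ : ∃ F : Finset V, B ⊆ F ∧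
      ∀ z, 0 < ∑ v ∈ F, (f z : lp (fun _ : V => ℝ) 1) v := by
    have hop : ∀ F : Finset V, IsOpen {z | 0 < ∑ v ∈ F, (f z : lp (fun _ : V => ℝ) 1) v} :=
      fun F => isOpen_lt continuous_const (continuous_finsetSum _ fun v _ => hfc v)
    obtain ⟨t, ht⟩ := isCompact_univ.elim_finite_subcover _ hop (by
      intro z _
      obtain ⟨s, hs⟩ := ((f z).2.2.2.eventually (lt_mem_nhds hκ)).exists
      exact mem_iUnion.2 ⟨s, hs⟩)
    refine ⟨B ∪ t.biUnion id, Finset.subset_union_left, fun z => ?_⟩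
    obtain ⟨s, hs⟩ := mem_iUnion.1 (ht (mem_univ z))
    obtain ⟨hst, hs⟩ := mem_iUnion.1 hs
    refine lt_of_lt_of_le hs (Finset.sum_le_sum_of_subset_of_nonneg ?_ fun v _ _ => hnn z v)
    exact (Finset.subset_biUnion_of_mem id hst).trans Finset.subset_union_right
  let sg : Z → ℝ := fun z => ∑ v ∈ F, (f z : lp (fun _ : V => ℝ) 1) v
  have hsg : Continuous sg := continuous_finsetSum _ fun v _ => hfc v
  let h : I × Z → lp (fun _ : V => ℝ) 1 := fun q =>
    (1 - (q.1 : ℝ)) • (f q.2 : lp (fun _ : V => ℝ) 1) +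
      ∑ v ∈ F, lp.single 1 v ((q.1 : ℝ) * (κ / sg q.2) * (f q.2 : lp (fun _ : V => ℝ) 1) v)
  have hh : ∀ q w, h q w = (1 - (q.1 : ℝ)) * (f q.2 : lp (fun _ : V => ℝ) 1) w +
      if w ∈ F then (q.1 : ℝ) * (κ / sg q.2) * (f q.2 : lp (fun _ : V => ℝ) 1) w else 0 := by
    intro q w
    simp only [h, lp.coeFn_add, lp.coeFn_smul, lp.coeFn_sum, Pi.add_apply, Pi.smul_apply,
      smul_eq_mul, Finset.sum_apply, lp.single_apply]
    congr 1
    simp [Pi.single_apply, Finset.sum_ite_eq]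
  have hcont : Continuous h := by
    refine Continuous.add (Continuous.smul
      (continuous_const.sub (continuous_subtype_val.comp continuous_fst))
      (continuous_subtype_val.comp (f.continuous.comp continuous_snd)))
      (continuous_finsetSum _ fun v _ => ?_)
    refine (lp.isometry_single (E := fun _ : V => ℝ) (p := 1) v).continuous.comp ?_
    refine Continuous.mul (Continuous.mul (by fun_prop) ?_) ((hfc v).comp continuous_snd)
    exact continuous_const.div (hsg.comp continuous_snd) fun q => (hF q.2).ne'
  have hmem : ∀ q, h q ∈ K.space κ := by
    intro q
    refine ⟨fun v => ?_, ?_, ?_⟩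
    · rw [hh]
      have h1 := q.1.2.1
      have h2 := q.1.2.2
      have h3 := hnn q.2 v
      have h4 : 0 < κ / sg q.2 := div_pos hκ (hF q.2)
      have h5 : 0 ≤ 1 - (q.1 : ℝ) := by linarith
      split_ifs <;> positivity
    · obtain ⟨-, ⟨s, hs, hsx⟩, -⟩ := (f q.2).2
      refine ⟨s, hs, fun v hv => hsx v fun h0 => hv ?_⟩
      rw [hh, h0]; simp
    · have h1 : HasSum (fun v => (1 - (q.1 : ℝ)) * (f q.2 : lp (fun _ : V => ℝ) 1) v)
        ((1 - (q.1 : ℝ)) * κ) := (f q.2).2.2.2.mul_left _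
      have h2 : HasSum (fun w => if w ∈ F then (q.1 : ℝ) * (κ / sg q.2) *
          (f q.2 : lp (fun _ : V => ℝ) 1) w else 0) (∑ w ∈ F, (q.1 : ℝ) * (κ / sg q.2) *
          (f q.2 : lp (fun _ : V => ℝ) 1) w) := by
        have := hasSum_sum_of_ne_finset_zero (L := SummationFilter.unconditional V) (s := F) (f := fun w => if w ∈ F then
          (q.1 : ℝ) * (κ / sg q.2) * (f q.2 : lp (fun _ : V => ℝ) 1) w else 0)
          (fun b hb => by simp [hb])
        convert! this using 1
        exact Finset.sum_congr rfl fun w hw => by simp [hw]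
      have h3 := h1.add h2
      simp only [← hh] at h3
      convert! h3 using 1
      rw [← Finset.mul_sum]
      change κ = _ + _ * _ * sg q.2
      have : sg q.2 ≠ 0 := (hF q.2).ne'
      field_simp
      ring
  refine ⟨F, ⟨fun q => ⟨h q, hmem q⟩, hcont.subtype_mk _⟩, hBF, fun z => ?_, fun z v hv => ?_,
    fun z hz t => ?_⟩
  · apply Subtype.ext
    apply lp.ext
    funext w
    simp [hh]
  · by_contra hvF
    apply hv
    simp [hh, hvF]
  · have hsgz : sg z = κ := by
      have := hasSum_sum_of_ne_finset_zero (L := SummationFilter.unconditional V) (s := F) (f := fun v => (f z : lp (fun _ : V => ℝ) 1) v)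
        (fun b hb => by by_contra h0; exact hb (hBF (hz b h0)))
      exact this.unique (f z).2.2.2
    apply Subtype.ext
    apply lp.ext
    funext w
    simp only [ContinuousMap.coe_mk, hh, hsgz, div_self hκ.ne']
    split_ifs with hw
    · ring
    · have : (f z : lp (fun _ : V => ℝ) 1) w = 0 := by
        by_contra h0; exact hw (hBF (hz w h0))
      rw [this]; ring

lemma supp_finset (K : SComplex V) {κ : ℝ} (x : K.space κ) :
    ∃ B : Finset V, ∀ v, (x : lp (fun _ : V => ℝ) 1) v ≠ 0 → v ∈ B := by
  obtain ⟨-, ⟨s, hs, hsx⟩, -⟩ := x.2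
  exact ⟨s, hsx⟩

lemma supp_map {W : Type*} {K : SComplex V} {L : SComplex W} {κ lam : ℝ}
    {p : K.space κ → L.space lam} (hp : SComplex.IsSimplicialMap K L κ lam p) (F : Finset V) :
    ∃ F' : Finset W, ∀ x : K.space κ, (∀ v, (x : lp (fun _ : V => ℝ) 1) v ≠ 0 → v ∈ F) →
      ∀ w, (p x : lp (fun _ : W => ℝ) 1) w ≠ 0 → w ∈ F' := by
  obtain ⟨φ, -, hφ⟩ := hp
  refine ⟨F.image φ, fun x hx w hw => ?_⟩
  by_contra hwF
  apply hw
  rw [hφ]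
  have : ∀ v, (if φ v = w then (x : lp (fun _ : V => ℝ) 1) v else 0) = 0 := by
    intro v
    split_ifs with h
    · by_contra h0
      exact hwF (Finset.mem_image.2 ⟨v, hx v h0, h⟩)
    · rfl
  simp [this]

end poly

/-- reparametrization of the interval -/
noncomputable def rI (t a : I) : I := projIcc 0 1 zero_le_one ((1 + (t : ℝ)) * a - t / 2)

lemma rI_cont : Continuous fun q : I × I => rI q.1 q.2 :=
  continuous_projIcc.comp (by fun_prop)

lemma rI_zero_left (a : I) : rI 0 a = a := by
  simp [rI, projIcc_val]

lemma rI_zero (t : I) : rI t 0 = 0 := by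
  have := t.2.1
  unfold rI
  rw [projIcc_of_le_left]
  · rfl
  · simp only [Icc.coe_zero, mul_zero]; linarith

lemma rI_one (t : I) : rI t 1 = 1 := by
  have := t.2.1
  unfold rI
  rw [projIcc_of_right_le]
  · rfl
  · simp only [Icc.coe_one, mul_one]; linarith

lemma rI_out {a : I} (h : ¬ (1 / 4 ≤ (a : ℝ) ∧ (a : ℝ) ≤ 3 / 4)) : rI 1 a = 0 ∨ rI 1 a = 1 := by
  by_cases h1 : 1 / 4 ≤ (a : ℝ)
  · right
    have h2 : 3 / 4 < (a : ℝ) := by by_contra! h2; exact h ⟨h1, h2⟩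
    unfold rI
    rw [projIcc_of_right_le]
    · rfl
    · simp only [Icc.coe_one]; linarith
  · left
    unfold rI
    rw [projIcc_of_le_left]
    · rfl
    · simp only [Icc.coe_one]; linarith

/-- reparametrization of the cube -/
noncomputable def rQ {k : ℕ} (t : I) (y : Fin k → I) : Fin k → I := fun i => rI t (y i)

lemma rQ_cont {k : ℕ} : Continuous fun q : I × (Fin k → I) => rQ q.1 q.2 :=
  continuous_pi fun i => rI_cont.comp
    (continuous_fst.prodMk ((continuous_apply i).comp continuous_snd))

lemma rQ_bd {k : ℕ} (t : I) {y : Fin k → I} (hy : y ∈ Cube.boundary (Fin k)) :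
    rQ t y ∈ Cube.boundary (Fin k) := by
  obtain ⟨i, h | h⟩ := hy
  · exact ⟨i, Or.inl (by simp [rQ, h, rI_zero])⟩
  · exact ⟨i, Or.inr (by simp [rQ, h, rI_one])⟩

/-- the central cube -/
def cQ (k : ℕ) : Set (Fin k → I) := {y | ∀ i, 1 / 4 ≤ (y i : ℝ) ∧ (y i : ℝ) ≤ 3 / 4}

lemma cQ_closed (k : ℕ) : IsClosed (cQ k) := by
  have : cQ k = ⋂ i, ({y | 1 / 4 ≤ (y i : ℝ)} ∩ {y | (y i : ℝ) ≤ 3 / 4}) := by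
    ext y; simp [cQ]
  rw [this]
  exact isClosed_iInter fun i => (isClosed_le (by fun_prop) (by fun_prop)).inter
    (isClosed_le (by fun_prop) (by fun_prop))

lemma cQ_out {k : ℕ} {y : Fin k → I} (h : y ∉ cQ k) : rQ 1 y ∈ Cube.boundary (Fin k) := by
  have : ∃ i, ¬ (1 / 4 ≤ (y i : ℝ) ∧ (y i : ℝ) ≤ 3 / 4) := by
    by_contra! h'; exact h h'
  obtain ⟨i, hi⟩ := this
  exact ⟨i, rI_out hi⟩

lemma bd_out {k : ℕ} {y : Fin k → I} (h : y ∈ Cube.boundary (Fin k)) : y ∉ cQ k := by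
  intro hc
  obtain ⟨i, h | h⟩ := h
  · have := (hc i).1; rw [h] at this; norm_num at this
  · have := (hc i).2; rw [h] at this; norm_num at this

lemma bd_closed (k : ℕ) : IsClosed (Cube.boundary (Fin k)) := by
  have : Cube.boundary (Fin k) = ⋃ i, ({y | y i = 0} ∪ {y | y i = 1}) := by
    ext y; simp [Cube.boundary]
  rw [this]
  exact isClosed_iUnion_of_finite fun i => (isClosed_eq (by fun_prop) (by fun_prop)).union
    (isClosed_eq (by fun_prop) (by fun_prop))

/-- boundary of the prism -/
def Bd (k : ℕ) : Set (I × (Fin k → I)) := {q | (q.1 = 0 ∨ q.1 = 1) ∨ q.2 ∈ Cube.boundary (Fin k)}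

lemma Bd_closed (k : ℕ) : IsClosed (Bd k) := by
  have : Bd k = ({q | q.1 = 0} ∪ {q | q.1 = 1}) ∪ Prod.snd ⁻¹' Cube.boundary (Fin k) := by
    ext y; simp [Bd]
  rw [this]
  exact ((isClosed_eq (by fun_prop) (by fun_prop)).union
    (isClosed_eq (by fun_prop) (by fun_prop))).union ((bd_closed k).preimage continuous_snd)

/-- a homeomorphism between the prism and the cube -/
def prismHomeo (k : ℕ) : (I × (Fin k → I)) ≃ₜ (Fin (k + 1) → I) where
  toFun q := Fin.cons q.1 q.2
  invFun y := (y 0, Fin.tail y)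
  left_inv q := by simp
  right_inv y := by simp
  continuous_toFun := continuous_pi fun i => by
    refine Fin.cases ?_ (fun j => ?_) i
    · simpa using continuous_fst
    · simp only [Fin.cons_succ]; fun_prop
  continuous_invFun := by unfold Fin.tail; fun_prop

/-- two maps glued over the halves of the prism -/
noncomputable def gl {k : ℕ} {X : Type*} (a b : (Fin k → I) → X) (q : I × (Fin k → I)) : X :=
  if (q.1 : ℝ) ≤ 1 / 2 then a q.2 else b q.2

lemma gl_zero {k : ℕ} {X : Type*} (a b : (Fin k → I) → X) (y) : gl a b (0, y) = a y := by
  simp [gl]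

lemma gl_one {k : ℕ} {X : Type*} (a b : (Fin k → I) → X) (y) : gl a b (1, y) = b y := by
  have : ¬ ((1 : ℝ) ≤ 1 / 2) := by norm_num
  simp only [gl, Icc.coe_one, this, if_false]

lemma gl_eq {k : ℕ} {X : Type*} {a b : (Fin k → I) → X} {y} (h : a y = b y) (t : I) :
    gl a b (t, y) = b y := by
  simp only [gl]; split_ifs <;> simp [h]

lemma gl_or {k : ℕ} {X : Type*} (a b : (Fin k → I) → X) (q) :
    gl a b q = a q.2 ∨ gl a b q = b q.2 := by
  simp only [gl]; split_ifs <;> simp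

lemma gl_cont {k : ℕ} {X : Type*} [TopologicalSpace X] {a b : (Fin k → I) → X}
    (ha : Continuous a) (hb : Continuous b) (hab : ∀ y ∈ Cube.boundary (Fin k), a y = b y) :
    ContinuousOn (gl a b) (Bd k) := by
  have h1 : IsClosed (Bd k ∩ {q | (q.1 : ℝ) ≤ 1 / 2}) :=
    (Bd_closed k).inter (isClosed_le (by fun_prop) (by fun_prop))
  have h2 : IsClosed (Bd k ∩ {q | 1 / 2 ≤ (q.1 : ℝ)}) :=
    (Bd_closed k).inter (isClosed_le (by fun_prop) (by fun_prop))
  have e1 : EqOn (gl a b) (fun q => a q.2) (Bd k ∩ {q | (q.1 : ℝ) ≤ 1 / 2}) := by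
    intro q hq
    have : (q.1 : ℝ) ≤ 1 / 2 := hq.2
    simp only [gl, this, if_true]
  have e2 : EqOn (gl a b) (fun q => b q.2) (Bd k ∩ {q | 1 / 2 ≤ (q.1 : ℝ)}) := by
    rintro ⟨t, y⟩ ⟨hq, ht⟩
    have ht : 1 / 2 ≤ (t : ℝ) := ht
    by_cases h : (t : ℝ) ≤ 1 / 2
    · rcases hq with (h0 | h0) | h0
      · simp only at h0; rw [h0] at ht; norm_num at ht
      · simp only at h0; rw [h0] at h; norm_num at h
      · exact gl_eq (hab y h0) t
    · simp only [gl, h, if_false]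
  refine ((((ha.comp continuous_snd).continuousOn.congr e1).union_of_isClosed
    ((hb.comp continuous_snd).continuousOn.congr e2) h1 h2)).mono ?_
  intro q hq
  rcases le_total (q.1 : ℝ) (1 / 2) with h | h
  · exact Or.inl ⟨hq, h⟩
  · exact Or.inr ⟨hq, h⟩

lemma mkRel {k : ℕ} {X : Type*} [TopologicalSpace X] {x : X} {a b : GenLoop (Fin k) X x}
    (G : I × (Fin k → I) → X) (hG : Continuous G) (h0 : ∀ y, G (0, y) = a y)
    (h1 : ∀ y, G (1, y) = b y) (hb : ∀ t, ∀ y ∈ Cube.boundary (Fin k), G (t, y) = x) :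
    GenLoop.Homotopic a b :=
  ⟨{ toFun := G, continuous_toFun := hG, map_zero_left := h0, map_one_left := h1,
     prop' := fun t y hy => (hb t y hy).trans (a.2 y hy).symm }⟩

/-- the loop shrunk to the central cube -/
noncomputable def shr {k : ℕ} {X : Type*} [TopologicalSpace X] {x : X} (a : GenLoop (Fin k) X x) :
    GenLoop (Fin k) X x :=
  ⟨⟨fun y => a.1 (rQ 1 y), a.1.continuous.comp
    (rQ_cont.comp (continuous_const.prodMk continuous_id))⟩, fun _ hy => a.2 _ (rQ_bd 1 hy)⟩

lemma shr_hom {k : ℕ} {X : Type*} [TopologicalSpace X] {x : X} (a : GenLoop (Fin k) X x) :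
    GenLoop.Homotopic a (shr a) := by
  refine mkRel (fun q => a.1 (rQ q.1 q.2)) (a.1.continuous.comp rQ_cont) (fun y => ?_)
    (fun y => rfl) (fun t y hy => a.2 _ (rQ_bd t hy))
  have : rQ 0 y = y := funext fun i => rI_zero_left _
  simp only [this]; rfl

/-- pushforward of a loop -/
def push {k : ℕ} {X Y : Type*} [TopologicalSpace X] [TopologicalSpace Y] (p : C(X, Y)) {x : X}
    (a : GenLoop (Fin k) X x) : GenLoop (Fin k) Y (p x) :=
  ⟨p.comp a.1, fun y hy => by
    simp only [ContinuousMap.comp_apply]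
    rw [a.2 y hy]⟩

lemma push_hom {k : ℕ} {X Y : Type*} [TopologicalSpace X] [TopologicalSpace Y] (p : C(X, Y))
    {x : X} {a b : GenLoop (Fin k) X x} (h : GenLoop.Homotopic a b) :
    GenLoop.Homotopic (push p a) (push p b) :=
  h.elim fun H => ⟨H.compContinuousMap p⟩

lemma finGen {V : Type*} (K : SComplex V) {κ : ℝ} (hκ : 0 < κ) {k : ℕ} {x : K.space κ}
    (a : GenLoop (Fin k) (K.space κ) x) : ∃ (F : Finset V) (b : GenLoop (Fin k) (K.space κ) x),
      GenLoop.Homotopic a b ∧ ∀ y v, (b.1 y : lp (fun _ : V => ℝ) 1) v ≠ 0 → v ∈ F := by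
  obtain ⟨B, hB⟩ := supp_finset K x
  obtain ⟨F, H, -, h0, h1, hc⟩ := finitize K hκ a.1 B
  have hb : ∀ t, ∀ y ∈ Cube.boundary (Fin k), H (t, y) = x := fun t y hy => by
    have hay : a.1 y = x := a.2 y hy
    rw [hc y (by rw [hay]; exact hB), hay]
  exact ⟨F, ⟨⟨fun y => H (1, y), by fun_prop⟩, hb 1⟩,
    mkRel H H.continuous h0 (fun y => rfl) hb, h1⟩

section main

variable {V W ι : Type*} {n : ℕ} {K : SComplex V} {L : SComplex W}
    {κ lam : ℝ} {KF : ι → Set (Finset V)} {LF : ι → Set (Finset W)}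
    {p : C((K.space κ), (L.space lam))}

lemma ae_of_mem {X : Type*} [TopologicalSpace X] {F : ι → Set X} (h : IsAECover.{u} n F)
    {J : Set ι} (hJ : J.Nonempty) {x : X} (hx : ∀ i ∈ J, x ∈ F i) :
    IsAE.{u} n (⋂ i ∈ J, F i) := by
  refine (h.2 J hJ).resolve_left fun h0 => ?_
  have : x ∈ ⋂ i ∈ J, F i := by simpa using hx
  rw [h0] at this
  exact this

lemma idx_nonempty (h : IsAECover.{u} n (fun i => K.subSpace κ (KF i))) (x : K.space κ) :
    (idx K κ KF x).Nonempty := by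
  have : x ∈ ⋃ i, K.subSpace κ (KF i) := by rw [h.1]; trivial
  exact mem_iUnion.1 this

lemma collar
    (hmaps : ∀ i, p '' (K.subSpace κ (KF i)) ⊆ L.subSpace lam (LF i))
    (hKcov : IsAECover.{u} n (fun i => K.subSpace κ (KF i)))
    (hLcov : IsAECover.{u} n (fun i => L.subSpace lam (LF i)))
    (hiso : CoversIsomorphic (fun i => K.subSpace κ (KF i))
      (fun i => L.subSpace lam (LF i)))
    {Y : Type*} [TopologicalSpace Y] {m : ℕ} (hmn : m ≤ n) (e : Y ≃ₜ (Fin m → I))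
    {f : Y → L.space lam} (hf : Continuous f) (hfF : (range fun y => idx L lam LF (f y)).Finite)
    {B : Set Y} (hB : IsClosed B) {g : Y → K.space κ} (hg : ContinuousOn g B)
    (hgF : (range fun y => idx K κ KF (g y)).Finite)
    (hgf : ∀ b ∈ B, p (g b) = f b)
    {r : Y → Y} (hr : Continuous r) {C : Set Y} (hC : IsClosed C) (hCB : ∀ y, y ∉ C → r y ∈ B)
    {A : Set Y} (hA : IsClosed A) (hAC : ∀ a ∈ A, a ∉ C) :
    ∃ (G : Y → K.space κ) (J : Y → Set ι), Continuous G ∧ (range J).Finite ∧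
      (∀ T : Set ι, IsClosed {y | T ⊆ J y}) ∧ (∀ a ∈ A, G a = g (r a)) ∧
      (∀ y, (J y).Nonempty) ∧ (∀ y, ∀ i ∈ J y, G y ∈ K.subSpace κ (KF i)) ∧
      ∀ y, ∀ i ∈ J y, f (r y) ∈ L.subSpace lam (LF i) := by
  let J : Y → Set ι := fun y => if y ∈ C then idx L lam LF (f (r y)) else idx K κ KF (g (r y))
  have hJC : ∀ y ∈ C, J y = idx L lam LF (f (r y)) := fun y hy => by simp [J, hy]
  have hJn : ∀ y, y ∉ C → J y = idx K κ KF (g (r y)) := fun y hy => by simp [J, hy]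
  have hsub : ∀ y, r y ∈ B → idx K κ KF (g (r y)) ⊆ idx L lam LF (f (r y)) := by
    intro y hy i hi
    rw [← hgf _ hy]
    exact hmaps i ⟨_, hi, rfl⟩
  have hne : ∀ y, (J y).Nonempty := by
    intro y
    by_cases hy : y ∈ C
    · rw [hJC y hy]; exact idx_nonempty hLcov _
    · rw [hJn y hy]; exact idx_nonempty hKcov _
  have hfin : (range J).Finite := by
    refine (hfF.union hgF).subset ?_
    rintro _ ⟨y, rfl⟩
    by_cases hy : y ∈ C
    · rw [hJC y hy]; exact Or.inl ⟨r y, rfl⟩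
    · rw [hJn y hy]; exact Or.inr ⟨r y, rfl⟩
  have hcl : ∀ T : Set ι, IsClosed {y | T ⊆ J y} := by
    intro T
    have : {y | T ⊆ J y} = {y | y ∈ C ∧ T ⊆ idx L lam LF (f (r y))} ∪
        {y | y ∈ r ⁻¹' B ∧ T ⊆ idx K κ KF (g (r y))} := by
      ext y
      constructor
      · intro (h : T ⊆ J y)
        by_cases hy : y ∈ C
        · rw [hJC y hy] at h; exact Or.inl ⟨hy, h⟩
        · rw [hJn y hy] at h; exact Or.inr ⟨hCB y hy, h⟩
      · rintro (⟨hy, h⟩ | ⟨hy, h⟩)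
        · change T ⊆ J y; rwa [hJC y hy]
        · change T ⊆ J y
          by_cases hyC : y ∈ C
          · rw [hJC y hyC]; exact h.trans (hsub y hy)
          · rwa [hJn y hyC]
    rw [this]
    exact (idx_closed L lam LF hC (hf.comp hr).continuousOn T).union
      (idx_closed K κ KF (hB.preimage hr) (hg.comp hr.continuousOn fun y hy => hy) T)
  have hAE : ∀ y, IsAE.{u} n (⋂ i ∈ J y, K.subSpace κ (KF i)) := by
    intro y
    have : (⋂ i ∈ J y, K.subSpace κ (KF i)).Nonempty := by
      by_cases hy : y ∈ C
      · rw [hJC y hy]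
        refine (hiso _).2 ⟨f (r y), ?_⟩
        simp only [mem_iInter]
        exact fun i hi => hi
      · rw [hJn y hy]
        refine ⟨g (r y), ?_⟩
        simp only [mem_iInter]
        exact fun i hi => hi
    exact (hKcov.2 _ (hne y)).resolve_left this.ne_empty
  obtain ⟨G, hG, hGe, hGs⟩ := ext_sel hmn e (fun i => K.subSpace κ (KF i)) J hcl hAE hfin.toFinset
    A hA (fun y => g (r y)) (hg.comp hr.continuousOn fun a ha => hCB a (hAC a ha))
    (fun a ha i hi => by rw [hJn a (hAC a ha)] at hi; exact hi) (fun y _ => by simp)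
  refine ⟨G, J, hG, hfin, hcl, hGe, hne, hGs, fun y i hi => ?_⟩
  by_cases hy : y ∈ C
  · rw [hJC y hy] at hi; exact hi
  · rw [hJn y hy] at hi; exact hsub y (hCB y hy) hi

end main

end NerveProof

/-- **Nerve theorem.** If `p : K → L` is a surjective simplicial map between
polyhedra carrying each member of a cover `𝒦` of `K` by subcomplexes into the
corresponding member of a cover `ℒ` of `L` by subcomplexes, and `𝒦`, `ℒ` are isomorphic
`AE(n)`-covers, then `p` is a weak `n`-homotopy equivalence. -/
theorem statement8 {V W ι : Type*} (n : ℕ) (K : SComplex V) (L : SComplex W)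
    (κ lam : ℝ) (hκ : 0 < κ) (hlam : 0 < lam)
    (KF : ι → Set (Finset V)) (LF : ι → Set (Finset W))
    (hKsub : ∀ i, K.IsSubcomplex (KF i)) (hLsub : ∀ i, L.IsSubcomplex (LF i))
    (p : C((K.space κ), (L.space lam)))
    (hsimp : SComplex.IsSimplicialMap K L κ lam p)
    (hsurj : Function.Surjective p)
    (hmaps : ∀ i, p '' (K.subSpace κ (KF i)) ⊆ L.subSpace lam (LF i))
    (hKcov : IsAECover.{u} n (fun i => K.subSpace κ (KF i)))
    (hLcov : IsAECover.{u} n (fun i => L.subSpace lam (LF i)))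
    (hiso : CoversIsomorphic (fun i => K.subSpace κ (KF i))
      (fun i => L.subSpace lam (LF i))) :
    IsWeakNHomotopyEquiv n p := by
  intro k hk x
  have hr1 : Continuous fun y : Fin k → I => NerveProof.rQ 1 y :=
    NerveProof.rQ_cont.comp (continuous_const.prodMk continuous_id)
  constructor
  · intro α β hαβ
    obtain ⟨a0, rfl⟩ := Quotient.exists_rep α
    obtain ⟨a1, rfl⟩ := Quotient.exists_rep β
    have hp : GenLoop.Homotopic (NerveProof.push p a0) (NerveProof.push p a1) :=
      Quotient.exact hαβ
    obtain ⟨F0, b0, h0, hF0⟩ := NerveProof.finGen K hκ a0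
    obtain ⟨F1, b1, h1, hF1⟩ := NerveProof.finGen K hκ a1
    have hpb : GenLoop.Homotopic (NerveProof.push p b0) (NerveProof.push p b1) :=
      (NerveProof.push_hom p h0).symm.trans (hp.trans (NerveProof.push_hom p h1))
    obtain ⟨H⟩ := hpb
    obtain ⟨F', hF'⟩ := NerveProof.supp_map hsimp (F0 ∪ F1)
    obtain ⟨F, Hf, -, -, hHf1, hHfc⟩ := NerveProof.finitize L hlam H.toContinuousMap F'
    have hbb : ∀ y ∈ Cube.boundary (Fin k), b0.1 y = b1.1 y := fun y hy =>
      (b0.2 y hy).trans (b1.2 y hy).symm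
    have hglF : ∀ q v, ((NerveProof.gl b0.1 b1.1 q : K.space κ) : lp (fun _ : V => ℝ) 1) v ≠ 0 →
        v ∈ F0 ∪ F1 := by
      intro q v hv
      rcases NerveProof.gl_or b0.1 b1.1 q with h | h
      · rw [h] at hv; exact Finset.mem_union_left _ (hF0 _ _ hv)
      · rw [h] at hv; exact Finset.mem_union_right _ (hF1 _ _ hv)
    have hHgl : ∀ q ∈ NerveProof.Bd k, H q = p (NerveProof.gl b0.1 b1.1 q) := by
      rintro ⟨t, y⟩ ((h | h) | h)
      · simp only at h; subst h
        rw [NerveProof.gl_zero]; exact H.apply_zero y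
      · simp only at h; subst h
        rw [NerveProof.gl_one]; exact H.apply_one y
      · simp only at h
        rw [NerveProof.gl_eq (hbb y h), ← hbb y h]; exact H.eq_fst t h
    obtain ⟨G, J, hG, -, -, hGe, -⟩ := NerveProof.collar hmaps hKcov hLcov hiso
      (Nat.succ_le_of_lt hk) (NerveProof.prismHomeo k) (f := fun q => Hf (1, q)) (by fun_prop)
      (NerveProof.idx_finite L lam LF _ F hHf1) (NerveProof.Bd_closed k)
      (g := NerveProof.gl b0.1 b1.1)
      (NerveProof.gl_cont b0.1.continuous b1.1.continuous hbb)
      (NerveProof.idx_finite K κ KF _ (F0 ∪ F1) hglF)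
      (by
        intro q hq
        have h2 : H.toContinuousMap q = p (NerveProof.gl b0.1 b1.1 q) := hHgl q hq
        rw [hHfc q (by rw [h2]; exact hF' _ (hglF q)), h2])
      (r := fun q => (NerveProof.rI 1 q.1, NerveProof.rQ 1 q.2))
      ((NerveProof.rI_cont.comp (continuous_const.prodMk continuous_fst)).prodMk
        (hr1.comp continuous_snd))
      (C := ({q | 1 / 4 ≤ (q.1 : ℝ)} ∩ {q | (q.1 : ℝ) ≤ 3 / 4}) ∩ Prod.snd ⁻¹' NerveProof.cQ k)
      (((isClosed_le (by fun_prop) (by fun_prop)).inter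
        (isClosed_le (by fun_prop) (by fun_prop))).inter
        ((NerveProof.cQ_closed k).preimage continuous_snd))
      (by
        intro q hq
        by_cases h : 1 / 4 ≤ (q.1 : ℝ) ∧ (q.1 : ℝ) ≤ 3 / 4
        · exact Or.inr (NerveProof.cQ_out fun h' => hq ⟨h, h'⟩)
        · exact Or.inl (NerveProof.rI_out h))
      (NerveProof.Bd_closed k)
      (by
        rintro ⟨t, y⟩ hq ⟨⟨hc1, hc2⟩, hc⟩
        change 1 / 4 ≤ (t : ℝ) at hc1
        change (t : ℝ) ≤ 3 / 4 at hc2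
        rcases hq with (h | h) | h
        · simp only at h; rw [h] at hc1; norm_num at hc1
        · simp only at h; rw [h] at hc2; norm_num at hc2
        · exact NerveProof.bd_out h hc)
    have hfinal : GenLoop.Homotopic (NerveProof.shr b0) (NerveProof.shr b1) := by
      refine NerveProof.mkRel G hG (fun y => ?_) (fun y => ?_) (fun t y hy => ?_)
      · rw [hGe _ (Or.inl (Or.inl rfl))]
        simp only [NerveProof.rI_zero, NerveProof.gl_zero]; rfl
      · rw [hGe _ (Or.inl (Or.inr rfl))]
        simp only [NerveProof.rI_one, NerveProof.gl_one]; rfl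
      · rw [hGe _ (Or.inr hy)]
        have hy' := NerveProof.rQ_bd 1 hy
        simp only
        rw [NerveProof.gl_eq (hbb _ hy')]
        exact b1.2 _ hy'
    exact Quotient.sound (h0.trans ((NerveProof.shr_hom b0).trans (hfinal.trans
      ((NerveProof.shr_hom b1).symm.trans h1.symm))))
  · intro β
    obtain ⟨f, rfl⟩ := Quotient.exists_rep β
    obtain ⟨F, f', hff', hF⟩ := NerveProof.finGen L hlam f
    obtain ⟨G, J, hG, hJfin, hJcl, hGe, hJne, hGs, hfs⟩ :=
      NerveProof.collar hmaps hKcov hLcov hiso hk.le (Homeomorph.refl (Fin k → I))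
      f'.1.continuous (NerveProof.idx_finite L lam LF _ F hF) (NerveProof.bd_closed k)
      (g := fun _ => x) continuousOn_const
      ((Set.finite_singleton (NerveProof.idx K κ KF x)).subset (by rintro _ ⟨y, rfl⟩; rfl))
      (fun b hb => (f'.2 b hb).symm) hr1 (NerveProof.cQ_closed k)
      (fun y hy => NerveProof.cQ_out hy) (NerveProof.bd_closed k)
      (fun a ha => NerveProof.bd_out ha)
    let γ : GenLoop (Fin k) (K.space κ) x := ⟨⟨G, hG⟩, hGe⟩
    have hab : ∀ y ∈ Cube.boundary (Fin k),
        (NerveProof.push p γ).1 y = (NerveProof.shr f').1 y := fun y hy =>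
      ((NerveProof.push p γ).2 y hy).trans ((NerveProof.shr f').2 y hy).symm
    have hpG : ∀ y, ∀ i ∈ J y, (NerveProof.push p γ).1 y ∈ L.subSpace lam (LF i) :=
      fun y i hi => hmaps i ⟨_, hGs y i hi, rfl⟩
    have hfG : ∀ y, ∀ i ∈ J y, (NerveProof.shr f').1 y ∈ L.subSpace lam (LF i) := hfs
    obtain ⟨Q, hQ, hQe, -⟩ := NerveProof.ext_sel (Nat.succ_le_of_lt hk) (NerveProof.prismHomeo k)
      (fun i => L.subSpace lam (LF i)) (fun q => J q.2)
      (fun T => (hJcl T).preimage continuous_snd)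
      (fun q => NerveProof.ae_of_mem hLcov (hJne q.2) (hpG q.2)) hJfin.toFinset
      (NerveProof.Bd k) (NerveProof.Bd_closed k)
      (NerveProof.gl (NerveProof.push p γ).1 (NerveProof.shr f').1)
      (NerveProof.gl_cont (NerveProof.push p γ).1.continuous (NerveProof.shr f').1.continuous hab)
      (by
        intro q _ i hi
        rcases NerveProof.gl_or (NerveProof.push p γ).1 (NerveProof.shr f').1 q with h | h
        · rw [h]; exact hpG _ i hi
        · rw [h]; exact hfG _ i hi)
      (fun q _ => by simp)
    have hfinal : GenLoop.Homotopic (NerveProof.push p γ) (NerveProof.shr f') := by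
      refine NerveProof.mkRel Q hQ (fun y => ?_) (fun y => ?_) (fun t y hy => ?_)
      · rw [hQe (Or.inl (Or.inl rfl)), NerveProof.gl_zero]; rfl
      · rw [hQe (Or.inl (Or.inr rfl)), NerveProof.gl_one]; rfl
      · rw [hQe (Or.inr hy), NerveProof.gl_eq (hab y hy)]
        exact (NerveProof.shr f').2 y hy
    refine ⟨Quotient.mk _ γ, ?_⟩
    exact Quotient.sound (hfinal.trans ((NerveProof.shr_hom f').symm.trans hff'.symm))
end

section
/- Let K and L be polyhedra. If p: K → L is a simplicial, surjective map such that for each simplex δ of L the preimage p^{-1}(δ) is an AE(n), then p is a weak n-homotopy equivalence. -/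
open Set Metric unitInterval
open scoped ENNReal Classical

universe u

/-- Compact metric spaces mapping expandingly to `ℝ^m` have dimension at most `n ≥ m`. -/
theorem covDim_of_embed {Y : Type*} [MetricSpace Y] [CompactSpace Y] {m n : ℕ} (hmn : m ≤ n)
    (e : Y → Fin m → ℝ) (he : Continuous e) (hd : ∀ x y, dist x y ≤ dist (e x) (e y)) :
    CovDimLE Y n := by
  intro U hU hcov
  obtain ⟨δ, hδ, hL⟩ := lebesgue_number_lemma_of_metric_sUnion (s := (univ : Set Y))
    isCompact_univ hU hcov.ge
  set ε := δ / 2 with hε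
  have hε0 : 0 < ε := by positivity
  have hM : (0:ℝ) < m + 1 := by positivity
  let r : Fin (m+1) → (Fin m → ℤ) → Set Y := fun j z =>
    {y | ∀ i, (z i : ℝ) + (j:ℝ) / (m+1) < e y i / ε ∧ e y i / ε < z i + 1 + (j:ℝ)/(m+1)}
  have hopen : ∀ j z, IsOpen (r j z) := by
    intro j z
    simp only [r, ofPred_forall]
    refine isOpen_iInter_of_finite fun i => ?_
    have : Continuous fun y => e y i / ε := by fun_prop
    exact (isOpen_lt continuous_const this).inter (isOpen_lt this continuous_const)
  have huniq : ∀ j z y, y ∈ r j z → z = fun i => ⌊e y i / ε - (j:ℝ)/(m+1)⌋ := by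
    intro j z y hy
    funext i
    symm
    rw [Int.floor_eq_iff]
    have := hy i
    constructor <;> linarith
  have hcover : ∀ y, ∃ j, y ∈ r j (fun i => ⌊e y i / ε - (j:ℝ)/(m+1)⌋) := by
    intro y
    by_contra hcon
    push Not at hcon
    have h1 : ∀ j : Fin (m+1), ∃ i, (⌊e y i / ε - (j:ℝ)/(m+1)⌋ : ℝ) = e y i / ε - (j:ℝ)/(m+1) := by
      intro j
      by_contra hne
      push Not at hne
      apply hcon j
      intro i
      have a := Int.floor_le (e y i / ε - (j:ℝ)/(m+1))
      have b := Int.lt_floor_add_one (e y i / ε - (j:ℝ)/(m+1))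
      have c := lt_of_le_of_ne a (hne i)
      constructor <;> linarith
    choose q hq using h1
    obtain ⟨a, b, hab, hqab⟩ := Fintype.exists_ne_map_eq_of_card_lt q (by simp)
    have ha := hq a
    have hb := hq b
    rw [hqab] at ha
    apply hab
    have h2 : ((a:ℝ) - b) = (m+1) * ((⌊e y (q b) / ε - (b:ℝ)/(m+1)⌋ - ⌊e y (q b) / ε - (a:ℝ)/(m+1)⌋ : ℤ) : ℝ) := by
      push_cast
      rw [ha, hb]
      field_simp
      ring
    set w := (⌊e y (q b) / ε - (b:ℝ)/(m+1)⌋ - ⌊e y (q b) / ε - (a:ℝ)/(m+1)⌋ : ℤ)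
    have h3 : ((a:ℤ) - b) = (m+1) * w := by exact_mod_cast h2
    have ha' := a.2
    have hb' := b.2
    have hw : w = 0 := by
      by_contra hw
      rcases lt_or_gt_of_ne hw with h | h
      · have : (m+1:ℤ) * w ≤ (m+1) * (-1) := by
          apply mul_le_mul_of_nonneg_left <;> omega
        omega
      · have : (m+1:ℤ) * 1 ≤ (m+1) * w := by
          apply mul_le_mul_of_nonneg_left <;> omega
        omega
    rw [hw] at h3
    apply Fin.ext
    omega
  refine ⟨{s | s.Nonempty ∧ ∃ j z, s = r j z}, ?_, ?_, ?_, ?_⟩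
  · rintro s ⟨-, j, z, rfl⟩
    exact hopen j z
  · refine eq_univ_of_forall fun y => ?_
    obtain ⟨j, hj⟩ := hcover y
    exact ⟨_, ⟨⟨y, hj⟩, j, _, rfl⟩, hj⟩
  · rintro s ⟨⟨y, hy⟩, j, z, rfl⟩
    obtain ⟨u, hu, hball⟩ := hL y trivial
    refine ⟨u, hu, fun x hx => hball ?_⟩
    rw [Metric.mem_ball]
    refine lt_of_le_of_lt (hd x y) ?_
    have : dist (e x) (e y) ≤ ε := by
      rw [dist_pi_le_iff hε0.le]
      intro i
      have h1 := hx i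
      have h2 := hy i
      rw [Real.dist_eq]
      have : |e x i / ε - e y i / ε| ≤ 1 := by rw [abs_le]; constructor <;> linarith
      rw [← sub_div, abs_div, abs_of_pos hε0, div_le_one hε0] at this
      exact this
    linarith
  · intro y
    have hsub : {s ∈ {s | s.Nonempty ∧ ∃ j z, s = r j z} | y ∈ s} ⊆
        range (fun j : Fin (m+1) => r j (fun i => ⌊e y i / ε - (j:ℝ)/(m+1)⌋)) := by
      rintro s ⟨⟨-, j, z, rfl⟩, hy⟩
      exact ⟨j, by simp only []; rw [← huniq j z y hy]⟩
    refine ⟨(finite_range _).subset hsub, ?_⟩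
    refine (ncard_le_ncard hsub (finite_range _)).trans ?_
    rw [← image_univ]
    refine (ncard_image_le finite_univ).trans ?_
    simp [ncard_univ]
    omega

/-- Extension into `AE(n)` subsets, phrased with total functions. -/
theorem ae_extend {Y : Type} [MetricSpace Y] [CompactSpace Y] {m n : ℕ} (hmn : m ≤ n)
    (e : Y → Fin m → ℝ) (he : Continuous e) (hd : ∀ x y, dist x y ≤ dist (e x) (e y))
    {X : Type*} [TopologicalSpace X] (E : Set X) (hE : IsAE.{u} n E)
    (Z B : Set Y) (hZ : IsClosed Z) (hB : IsClosed B) (g : Y → X)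
    (hg : ContinuousOn g (Z ∩ B)) (hm : MapsTo g (Z ∩ B) E) :
    ∃ g' : Y → X, ContinuousOn g' Z ∧ MapsTo g' Z E ∧ EqOn g' g (Z ∩ B) := by
  have : CompactSpace Z := isCompact_iff_compactSpace.mp hZ.isCompact
  have : CompactSpace (ULift.{u} Z) := inferInstance
  have hdim : CovDimLE (ULift.{u} Z) n :=
    covDim_of_embed hmn (fun z => e z.down.1) (by fun_prop) (fun x y => hd _ _)
  let A : Set (ULift.{u} Z) := {z | z.down.1 ∈ B}
  have hA : IsClosed A := hB.preimage (by fun_prop)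
  let f : C(A, E) := ⟨fun a => ⟨g a.1.down.1, hm ⟨a.1.down.2, a.2⟩⟩, by
    refine Continuous.subtype_mk ?_ _
    have h1 : Continuous (fun a : A => (⟨a.1.down.1, a.1.down.2, a.2⟩ : (Z ∩ B : Set Y))) := by
      fun_prop
    exact (continuousOn_iff_continuous_domRestrict.mp hg).comp h1⟩
  obtain ⟨G, hG⟩ := hE (ULift.{u} Z) hdim A hA f
  refine ⟨fun y => if h : y ∈ Z then (G ⟨⟨y, h⟩⟩ : X) else g y, ?_, ?_, ?_⟩
  · rw [continuousOn_iff_continuous_domRestrict]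
    have : Z.domRestrict (fun y => if h : y ∈ Z then (G ⟨⟨y, h⟩⟩ : X) else g y) =
        fun z => (G ⟨z⟩ : X) := by
      funext z
      simp
    rw [this]
    fun_prop
  · intro y hy
    simp [hy]
  · rintro y ⟨hy, hb⟩
    have := hG ⟨⟨⟨y, hy⟩⟩, hb⟩
    simp [hy, this, f]

/-- Inductive extension over a finite family of closed sets. -/
theorem skeletal_extend {Y X W : Type*} [TopologicalSpace Y] [TopologicalSpace X]
    (C : Finset W → Set Y) (E : Finset W → Set X) (A : Set Y) (f : Y → X)
    (hA : IsClosed A) (hf : ContinuousOn f A) (hC : ∀ s, IsClosed (C s))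
    (hE : ∀ s t, s ⊆ t → E s ⊆ E t)
    (F : Finset (Finset W))
    (hint : ∀ s ∈ F, ∀ t ∈ F, ∀ y ∈ C s, y ∈ C t → s ∩ t ∈ F ∧ y ∈ C (s ∩ t))
    (hfE : ∀ s ∈ F, MapsTo f (C s ∩ A) (E s))
    (hext : ∀ s ∈ F, ∀ B : Set Y, IsClosed B → ∀ g : Y → X, ContinuousOn g (C s ∩ B) →
      MapsTo g (C s ∩ B) (E s) →
      ∃ g' : Y → X, ContinuousOn g' (C s) ∧ MapsTo g' (C s) (E s) ∧ EqOn g' g (C s ∩ B)) :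
    ∃ g : Y → X, ContinuousOn g (A ∪ ⋃ s ∈ F, C s) ∧ EqOn g f A ∧
      ∀ s ∈ F, MapsTo g (C s) (E s) := by
  induction hn : F.card generalizing F with
  | zero =>
    rw [Finset.card_eq_zero] at hn
    subst hn
    exact ⟨f, by simpa using hf, fun _ _ => rfl, by simp⟩
  | succ k ih =>
    have hne : F.Nonempty := by rw [← Finset.card_pos]; omega
    obtain ⟨s, hs⟩ := F.exists_maximal hne
    have hsF : s ∈ F := hs.1
    have hmax : ∀ t ∈ F, s ⊆ t → t = s := fun t ht hst => (hs.eq_of_le ht hst).symm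
    obtain ⟨g, hg1, hg2, hg3⟩ := ih (F.erase s)
      (by
        intro a ha b hb y hya hyb
        have ha' := Finset.mem_of_mem_erase ha
        have hb' := Finset.mem_of_mem_erase hb
        obtain ⟨h1, h2⟩ := hint a ha' b hb' y hya hyb
        refine ⟨Finset.mem_erase.mpr ⟨?_, h1⟩, h2⟩
        intro h
        exact (Finset.mem_erase.mp ha).1 (hmax a ha' (h ▸ Finset.inter_subset_left)))
      (fun t ht => hfE t (Finset.mem_of_mem_erase ht))
      (fun t ht => hext t (Finset.mem_of_mem_erase ht))
      (by rw [Finset.card_erase_of_mem hsF]; omega)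
    set B := A ∪ ⋃ t ∈ F.erase s, C t with hB
    have hBc : IsClosed B := hA.union (isClosed_biUnion_finset fun t _ => hC t)
    have hmaps : MapsTo g (C s ∩ B) (E s) := by
      rintro y ⟨hys, hyA | hy⟩
      · rw [hg2 hyA]; exact hfE s hsF ⟨hys, hyA⟩
      · simp only [mem_iUnion] at hy
        obtain ⟨t, ht, hyt⟩ := hy
        have htF := Finset.mem_of_mem_erase ht
        obtain ⟨h1, h2⟩ := hint s hsF t htF y hys hyt
        have h3 : s ∩ t ∈ F.erase s := by
          refine Finset.mem_erase.mpr ⟨?_, h1⟩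
          intro h
          exact (Finset.mem_erase.mp ht).1 (hmax t htF (Finset.inter_eq_left.mp h))
        exact hE _ _ Finset.inter_subset_left (hg3 _ h3 h2)
    obtain ⟨g', h1, h2, h3⟩ := hext s hsF B hBc g (hg1.mono inter_subset_right) hmaps
    let G : Y → X := fun y => if y ∈ C s then g' y else g y
    have hGs : EqOn G g' (C s) := fun y hy => by simp [G, hy]
    have hGB : EqOn G g B := fun y hy => by
      by_cases hys : y ∈ C s
      · rw [hGs hys, h3 ⟨hys, hy⟩]
      · simp [G, hys]
    refine ⟨G, ?_, ?_, ?_⟩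
    · have h4 : A ∪ ⋃ t ∈ F, C t = B ∪ C s := by
        conv_lhs => rw [← Finset.insert_erase hsF]
        rw [Finset.set_biUnion_insert, hB, union_assoc, union_comm (C s)]
      rw [h4]
      exact (hg1.congr hGB).union_of_isClosed (h1.congr hGs) hBc (hC s)
    · intro a ha
      rw [hGB (Or.inl ha), hg2 ha]
    · intro t ht
      by_cases hts : t = s
      · subst hts
        exact fun y hy => by rw [hGs hy]; exact h2 hy
      · have ht' : t ∈ F.erase s := Finset.mem_erase.mpr ⟨hts, ht⟩
        intro y hy
        rw [hGB (Or.inr (mem_biUnion ht' hy))]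
        exact hg3 t ht' hy

namespace SComplex

theorem lp_one_norm {V : Type*} (x : lp (fun _ : V => ℝ) 1) : ‖x‖ = ∑' v, |x v| := by
  rw [lp.norm_eq_tsum_rpow (by simp)]
  simp

theorem lp_one_summable {V : Type*} (x : lp (fun _ : V => ℝ) 1) : Summable fun v => x v :=
  Memℓp.summable_of_one x.2

/-- Restriction of the coordinates to a subset, as a continuous linear map. -/
noncomputable def cut {V : Type*} (S : Set V) : lp (fun _ : V => ℝ) 1 →L[ℝ] lp (fun _ : V => ℝ) 1 :=
  LinearMap.mkContinuous
    { toFun := fun x => ⟨fun v => if v ∈ S then x v else 0, by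
        refine (memℓp_gen_iff (by simp)).2 ?_
        have h := (memℓp_gen_iff (p := 1) (by simp)).1 x.2
        refine Summable.of_nonneg_of_le (fun v => by positivity) (fun v => ?_) h
        by_cases hv : v ∈ S <;> simp [hv]⟩
      map_add' := fun x y => by
        ext v
        change (if v ∈ S then x v + y v else 0) =
          (if v ∈ S then x v else 0) + (if v ∈ S then y v else 0)
        split_ifs <;> simp
      map_smul' := fun c x => by
        ext v
        by_cases hv : v ∈ S <;> simp [hv] } 1 (by
    intro x
    rw [lp_one_norm, one_mul, lp_one_norm]
    refine Summable.tsum_le_tsum (fun v => ?_) (lp_one_summable _).abs (lp_one_summable _).abs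
    by_cases hv : v ∈ S <;> simp [hv])

theorem cut_apply {V : Type*} (S : Set V) (x : lp (fun _ : V => ℝ) 1) (v : V) :
    cut S x v = if v ∈ S then x v else 0 := rfl

variable {V W : Type*}

theorem norm_space {K : SComplex V} {κ : ℝ} (x : K.space κ) :
    ‖(x : lp (fun _ : V => ℝ) 1)‖ = κ := by
  rw [lp_one_norm]
  refine Eq.trans ?_ x.2.2.2.tsum_eq
  exact tsum_congr fun v => abs_of_nonneg (x.2.1 v)

theorem mem_space_of {K : SComplex V} {κ : ℝ} (x : lp (fun _ : V => ℝ) 1) (h0 : ∀ v, 0 ≤ x v)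
    (hs : ∃ s ∈ K.faces, ∀ v, x v ≠ 0 → v ∈ s) (hn : ‖x‖ = κ) : x ∈ K.space κ := by
  refine ⟨h0, hs, ?_⟩
  have h := (lp_one_summable x).hasSum
  rw [lp_one_norm] at hn
  rw [← hn, tsum_congr fun v => abs_of_nonneg (h0 v)]
  exact h

theorem seg_mem {K : SComplex V} {κ : ℝ} {x y : lp (fun _ : V => ℝ) 1} (hx : x ∈ K.space κ)
    (hy : y ∈ K.space κ) {s : Finset V} (hs : s ∈ K.faces) (hxs : ∀ v, x v ≠ 0 → v ∈ s)
    (hys : ∀ v, y v ≠ 0 → v ∈ s) (t : unitInterval) :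
    (1 - (t : ℝ)) • x + (t : ℝ) • y ∈ K.space κ := by
  have ht0 := t.2.1
  have ht1 := t.2.2
  refine ⟨fun v => ?_, ⟨s, hs, fun v hv => ?_⟩, ?_⟩
  · have h1 := hx.1 v
    have h2 := hy.1 v
    have h3 : 0 ≤ 1 - (t:ℝ) := by linarith
    simp only [lp.coeFn_add, lp.coeFn_smul, Pi.add_apply, Pi.smul_apply, smul_eq_mul]
    positivity
  · by_contra hvs
    apply hv
    have h1 : x v = 0 := by by_contra h; exact hvs (hxs v h)
    have h2 : y v = 0 := by by_contra h; exact hvs (hys v h)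
    change (1 - (t:ℝ)) * x v + (t:ℝ) * y v = 0
    rw [h1, h2]
    ring
  · have := (hx.2.2.mul_left (1 - (t:ℝ))).add (hy.2.2.mul_left (t:ℝ))
    convert! this using 1
    ring

theorem cut_norm_mem {K : SComplex V} {κ : ℝ} (hκ : 0 < κ) (S : Set V) (x : K.space κ)
    (hx : cut S x.1 ≠ 0) : (κ / ‖cut S x.1‖) • cut S x.1 ∈ K.space κ := by
  have hn : 0 < ‖cut S x.1‖ := norm_pos_iff.mpr hx
  refine mem_space_of _ (fun v => ?_) ?_ ?_
  · have h1 := x.2.1 v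
    simp only [lp.coeFn_smul, Pi.smul_apply, smul_eq_mul, cut_apply]
    split_ifs <;> positivity
  · obtain ⟨s, hs, hxs⟩ := x.2.2.1
    refine ⟨s, hs, fun v hv => hxs v fun h => hv ?_⟩
    simp [cut_apply, h]
  · rw [norm_smul, Real.norm_of_nonneg (by positivity)]
    field_simp

/-- Deformation pushing the mass of a point to the coordinates in `S`. -/
noncomputable def push (K : SComplex V) {κ : ℝ} (hκ : 0 < κ) (S : Set V) (t : unitInterval)
    (x : K.space κ) : K.space κ :=
  if hx : cut S x.1 ≠ 0 then
    ⟨(1 - (t : ℝ)) • x.1 + (t : ℝ) • ((κ / ‖cut S x.1‖) • cut S x.1), by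
      obtain ⟨s, hs, hxs⟩ := x.2.2.1
      refine seg_mem x.2 (cut_norm_mem hκ S x hx) hs hxs (fun v hv => hxs v fun h => hv ?_) t
      simp [cut_apply, h]⟩
  else x

theorem push_coe (K : SComplex V) {κ : ℝ} (hκ : 0 < κ) (S : Set V) (t : unitInterval)
    (x : K.space κ) (hx : cut S x.1 ≠ 0) : (push K hκ S t x).1 =
      (1 - (t : ℝ)) • x.1 + (t : ℝ) • ((κ / ‖cut S x.1‖) • cut S x.1) := by
  rw [push, dif_pos hx]

theorem push_one (K : SComplex V) {κ : ℝ} (hκ : 0 < κ) (S : Set V)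
    (x : K.space κ) (hx : cut S x.1 ≠ 0) : (push K hκ S 1 x).1 =
      (κ / ‖cut S x.1‖) • cut S x.1 := by
  rw [push_coe _ _ _ _ _ hx]
  simp

theorem push_zero (K : SComplex V) {κ : ℝ} (hκ : 0 < κ) (S : Set V)
    (x : K.space κ) : push K hκ S 0 x = x := by
  by_cases hx : cut S x.1 ≠ 0
  · apply Subtype.ext
    rw [push_coe _ _ _ _ _ hx]
    simp
  · rw [push, dif_neg hx]

theorem push_continuousOn (K : SComplex V) {κ : ℝ} (hκ : 0 < κ) (S : Set V) :
    ContinuousOn (fun q : unitInterval × K.space κ => push K hκ S q.1 q.2)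
      {q | cut S q.2.1 ≠ 0} := by
  rw [Topology.IsInducing.subtypeVal.continuousOn_iff]
  have : ContinuousOn (fun q : unitInterval × K.space κ =>
      (1 - (q.1 : ℝ)) • q.2.1 + (q.1 : ℝ) • ((κ / ‖cut S q.2.1‖) • cut S q.2.1))
      {q | cut S q.2.1 ≠ 0} := by
    have h2 : ContinuousOn (fun q : unitInterval × K.space κ => κ / ‖cut S q.2.1‖)
        {q | cut S q.2.1 ≠ 0} :=
      ContinuousOn.div continuousOn_const (by fun_prop) (fun q hq => norm_ne_zero_iff.mpr hq)
    fun_prop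
  exact this.congr fun q hq => push_coe _ _ _ _ _ hq

theorem push_supp (K : SComplex V) {κ : ℝ} (hκ : 0 < κ) (S : Set V) (x : K.space κ)
    (hx : cut S x.1 ≠ 0) (v : V) (hv : (push K hκ S 1 x).1 v ≠ 0) : v ∈ S ∧ x.1 v ≠ 0 := by
  rw [push_one _ _ _ _ hx] at hv
  simp only [lp.coeFn_smul, Pi.smul_apply, smul_eq_mul, cut_apply] at hv
  by_cases hvS : v ∈ S
  · refine ⟨hvS, fun h => hv ?_⟩
    simp [h]
  · simp [hvS] at hv

theorem push_of_supp (K : SComplex V) {κ : ℝ} (hκ : 0 < κ) (S : Set V) (x : K.space κ)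
    (hS : ∀ v, x.1 v ≠ 0 → v ∈ S) : cut S x.1 ≠ 0 ∧ push K hκ S 1 x = x := by
  have h : cut S x.1 = x.1 := by
    ext v
    rw [cut_apply]
    split_ifs with hv
    · rfl
    · by_contra h
      exact hv (hS v (Ne.symm h))
  have hn := norm_space x
  have h0 : cut S x.1 ≠ 0 := by
    rw [h]
    intro h0
    rw [h0, norm_zero] at hn
    exact hκ.ne hn
  refine ⟨h0, Subtype.ext ?_⟩
  rw [push_one _ _ _ _ h0, h, hn, div_self hκ.ne', one_smul]

theorem map_push {K : SComplex V} {L : SComplex W} {κ lam : ℝ} (hκ : 0 < κ) (hlam : 0 < lam)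
    (p : K.space κ → L.space lam) (φ : V → W)
    (hp : ∀ (x : K.space κ) (w : W), (p x : lp (fun _ : W => ℝ) 1) w =
        (lam / κ) * ∑' v : V, (if φ v = w then (x : lp (fun _ : V => ℝ) 1) v else 0))
    (T : Set W) (x : K.space κ) (hx : cut T (p x).1 ≠ 0) :
    cut (φ ⁻¹' T) x.1 ≠ 0 ∧ p (push K hκ (φ ⁻¹' T) 1 x) = push L hlam T 1 (p x) := by
  have h1 : cut (φ ⁻¹' T) x.1 ≠ 0 := by
    intro h
    apply hx
    ext w
    rw [cut_apply]
    split_ifs with hw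
    · rw [hp]
      have : ∀ v, (if φ v = w then x.1 v else 0) = 0 := by
        intro v
        split_ifs with hv
        · have h2 : cut (φ ⁻¹' T) x.1 v = 0 := by rw [h]; rfl
          rw [cut_apply, if_pos (by simpa [hv] using hw)] at h2
          exact h2
        · rfl
      simp [this]
    · rfl
  refine ⟨h1, ?_⟩
  set c := κ / ‖cut (φ ⁻¹' T) x.1‖ with hc
  have hn1 : 0 < ‖cut (φ ⁻¹' T) x.1‖ := norm_pos_iff.mpr h1
  have hn2 : 0 < ‖cut T (p x).1‖ := norm_pos_iff.mpr hx
  have hc0 : 0 < c := by positivity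
  have h2 : (p (push K hκ (φ ⁻¹' T) 1 x)).1 = c • cut T (p x).1 := by
    ext w
    rw [hp, push_one _ _ _ _ h1, ← hc]
    simp only [lp.coeFn_smul, Pi.smul_apply, smul_eq_mul, cut_apply]
    have : ∀ v, (if φ v = w then c * (if v ∈ φ ⁻¹' T then x.1 v else 0) else 0) =
        (if w ∈ T then c else 0) * (if φ v = w then x.1 v else 0) := by
      intro v
      by_cases hv : φ v = w
      · by_cases hw : w ∈ T <;> simp [hv, hw]
      · simp [hv]
    simp_rw [this]
    rw [tsum_mul_left]
    split_ifs
    · rw [hp]; ring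
    · simp
  apply Subtype.ext
  rw [h2, push_one _ _ _ _ hx]
  have h3 := norm_space (p (push K hκ (φ ⁻¹' T) 1 x))
  rw [h2, norm_smul, Real.norm_of_nonneg hc0.le] at h3
  congr 1
  rw [eq_div_iff hn2.ne', h3]

/-- The coordinates of a compact family all have mass on a finite set of vertices. -/
theorem exists_finite_mass {Y : Type*} [TopologicalSpace Y] [CompactSpace Y] (L : SComplex W)
    {lam : ℝ} (hlam : 0 < lam) (h : C(Y, L.space lam)) :
    ∃ T : Finset W, ∀ T' : Finset W, T ⊆ T' → ∀ y, cut (T' : Set W) (h y).1 ≠ 0 := by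
  have hco : ∀ w, Continuous fun y => (h y).1 w := by
    intro w
    have h1 : Continuous fun x : lp (fun _ : W => ℝ) 1 => x w :=
      (continuous_apply w).comp (lp.uniformContinuous_coe.continuous)
    exact h1.comp (by fun_prop)
  obtain ⟨T, hT⟩ := isCompact_univ.elim_finite_subcover (fun w => {y | (h y).1 w ≠ 0})
    (fun w => isOpen_ne_fun (hco w) continuous_const) (by
      intro y _
      by_contra hcon
      simp only [mem_iUnion, mem_setOf_eq, not_exists, not_not] at hcon
      have := norm_space (h y)
      have h0 : (h y).1 = 0 := by ext w; exact hcon w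
      rw [h0, norm_zero] at this
      exact hlam.ne this)
  refine ⟨T, fun T' hTT y h0 => ?_⟩
  have := hT (mem_univ y)
  simp only [mem_iUnion] at this
  obtain ⟨w, hw, hyw⟩ := this
  apply hyw
  have h1 : cut (T' : Set W) (h y).1 w = 0 := by rw [h0]; rfl
  rwa [cut_apply, if_pos (by exact_mod_cast hTT hw)] at h1

theorem lift_finite {Y : Type} [MetricSpace Y] [CompactSpace Y] {m n : ℕ} (hmn : m ≤ n)
    (e : Y → Fin m → ℝ) (he : Continuous e) (hd : ∀ x y, dist x y ≤ dist (e x) (e y))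
    {X : Type*} [TopologicalSpace X] (L : SComplex W) {lam : ℝ} (hlam : 0 < lam)
    (p : X → L.space lam) (hAE : ∀ s ∈ L.faces, IsAE.{u} n (p ⁻¹' (L.cell lam s)))
    (A : Set Y) (hA : IsClosed A) (f : Y → X) (hf : ContinuousOn f A) (h : C(Y, L.space lam))
    (hpf : ∀ a ∈ A, p (f a) = h a) (T : Finset W) (hT : ∀ y w, (h y).1 w ≠ 0 → w ∈ T) :
    ∃ g : C(Y, X), EqOn g f A ∧ ∀ y, ∀ s ∈ L.faces, h y ∈ L.cell lam s →
      p (g y) ∈ L.cell lam s := by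
  have hco : ∀ w, Continuous fun y => (h y).1 w := by
    intro w
    have h1 : Continuous fun x : lp (fun _ : W => ℝ) 1 => x w :=
      (continuous_apply w).comp (lp.uniformContinuous_coe.continuous)
    exact h1.comp (by fun_prop)
  have hface : ∀ y, ∀ s ∈ L.faces, ∀ t : Finset W, h y ∈ L.cell lam s → h y ∈ L.cell lam t →
      s ∩ t ∈ L.faces ∧ h y ∈ L.cell lam (s ∩ t) := by
    intro y s hs t hys hyt
    have h1 : h y ∈ L.cell lam (s ∩ t) := fun w hw => Finset.mem_inter.mpr ⟨hys w hw, hyt w hw⟩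
    refine ⟨L.down_closed s hs _ Finset.inter_subset_left ?_, h1⟩
    by_contra hcon
    rw [Finset.not_nonempty_iff_eq_empty] at hcon
    have := norm_space (h y)
    have h0 : (h y).1 = 0 := by
      ext w
      by_contra hw
      have := h1 w hw
      rw [hcon] at this
      simp at this
    rw [h0, norm_zero] at this
    exact hlam.ne this
  let F : Finset (Finset W) := T.powerset.filter (fun s => s ∈ L.faces)
  have hF : ∀ s, s ∈ F ↔ s ⊆ T ∧ s ∈ L.faces := by intro s; simp [F]
  have hmono : ∀ s t : Finset W, s ⊆ t → L.cell lam s ⊆ L.cell lam t :=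
    fun s t hst x hx w hw => hst (hx w hw)
  have hcl : ∀ s : Finset W, IsClosed {y | h y ∈ L.cell lam s} := by
    intro s
    have : {y | h y ∈ L.cell lam s} = ⋂ w ∈ {w | w ∉ s}, {y | (h y).1 w = 0} := by
      ext y
      simp only [cell, mem_setOf_eq, mem_iInter]
      exact forall_congr' fun w => not_imp_comm
    rw [this]
    exact isClosed_biInter fun w _ => isClosed_eq (hco w) continuous_const
  obtain ⟨g, hg1, hg2, hg3⟩ := skeletal_extend (fun s => {y | h y ∈ L.cell lam s})
    (fun s => p ⁻¹' (L.cell lam s)) A f hA hf hcl (fun s t hst => preimage_mono (hmono s t hst)) F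
    (by
      intro s hs t ht y hys hyt
      obtain ⟨h1, h2⟩ := hface y s ((hF s).1 hs).2 t hys hyt
      exact ⟨(hF _).2 ⟨Finset.inter_subset_left.trans ((hF s).1 hs).1, h1⟩, h2⟩)
    (by
      rintro s hs y ⟨hy, hyA⟩
      change p (f y) ∈ L.cell lam s
      rw [hpf y hyA]
      exact hy)
    (by
      intro s hs B hB g hg hm
      exact ae_extend hmn e he hd _ (hAE s ((hF s).1 hs).2) _ B (hcl s) hB g hg hm)
  have huniv : (A ∪ ⋃ s ∈ F, {y | h y ∈ L.cell lam s}) = univ := by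
    refine eq_univ_of_forall fun y => Or.inr ?_
    obtain ⟨s, hs, hys⟩ := (h y).2.2.1
    obtain ⟨h1, h2⟩ := hface y s hs T hys (hT y)
    exact mem_biUnion (show s ∩ T ∈ F from (hF _).2 ⟨Finset.inter_subset_right, h1⟩) h2
  rw [huniv, continuousOn_univ] at hg1
  refine ⟨⟨g, hg1⟩, hg2, fun y s hs hys => ?_⟩
  obtain ⟨h1, h2⟩ := hface y s hs T hys (hT y)
  exact hmono _ _ Finset.inter_subset_left
    (hg3 (s ∩ T) ((hF _).2 ⟨Finset.inter_subset_right, h1⟩) h2)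

end SComplex

/-- Radial size on the cube. -/
noncomputable def cubeN {k : ℕ} (q : unitInterval × (Fin k → unitInterval)) : ℝ :=
  max |2 * (q.1 : ℝ) - 1| ‖fun i => 2 * (q.2 i : ℝ) - 1‖

theorem cubeN_continuous {k : ℕ} : Continuous (cubeN (k := k)) := by
  unfold cubeN
  fun_prop

/-- Radial expansion of one coordinate. -/
noncomputable def expand (N : ℝ) (t : unitInterval) : unitInterval :=
  projIcc 0 1 zero_le_one (1 / 2 + ((t : ℝ) - 1 / 2) / max N (1 / 2))

theorem expand_one (t : unitInterval) : expand 1 t = t := by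
  unfold expand
  have : (1 / 2 + ((t : ℝ) - 1 / 2) / max 1 (1 / 2)) = t := by
    rw [max_eq_left (by norm_num)]; ring
  rw [this]
  exact projIcc_val zero_le_one t

theorem expand_bd (N : ℝ) (t : unitInterval) (hN : 1 / 2 ≤ N) (ht : |2 * (t : ℝ) - 1| = N) :
    expand N t = 0 ∨ expand N t = 1 := by
  unfold expand
  rw [max_eq_left hN]
  have hN0 : 0 < N := by linarith
  rcases abs_cases (2 * (t : ℝ) - 1) with h | h
  · right
    have : (1 / 2 + ((t : ℝ) - 1 / 2) / N) = 1 := by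
      field_simp
      linarith
    rw [this]
    exact projIcc_right zero_le_one
  · left
    have : (1 / 2 + ((t : ℝ) - 1 / 2) / N) = 0 := by
      field_simp
      linarith
    rw [this]
    exact projIcc_left zero_le_one

/-- The boundary of `I × I^k`. -/
def prismBd (k : ℕ) : Set (unitInterval × (Fin k → unitInterval)) :=
  {q | q.1 = 0} ∪ ({q | q.1 = 1} ∪ {q | q.2 ∈ Cube.boundary (Fin k)})

theorem cubeBd_closed (k : ℕ) : IsClosed (Cube.boundary (Fin k)) := by
  have : Cube.boundary (Fin k) = ⋃ i, ({y | y i = 0} ∪ {y | y i = 1}) := by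
    ext y
    simp [Cube.boundary]
  rw [this]
  exact isClosed_iUnion_of_finite fun i =>
    (isClosed_eq (by fun_prop) continuous_const).union
      (isClosed_eq (by fun_prop) continuous_const)

theorem prismBd_closed (k : ℕ) : IsClosed (prismBd k) :=
  (isClosed_eq (by fun_prop) continuous_const).union
    ((isClosed_eq (by fun_prop) continuous_const).union
      ((cubeBd_closed k).preimage continuous_snd))

theorem abs_le_one_I (t : unitInterval) : |2 * (t : ℝ) - 1| ≤ 1 := by
  have h0 := t.2.1
  have h1 := t.2.2
  rw [abs_le]
  constructor <;> linarith

theorem cubeN_bd {k : ℕ} (q : unitInterval × (Fin k → unitInterval)) (hq : q ∈ prismBd k) :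
    cubeN q = 1 := by
  have hle : ‖fun i => 2 * (q.2 i : ℝ) - 1‖ ≤ 1 := by
    rw [pi_norm_le_iff_of_nonneg zero_le_one]
    intro i
    exact abs_le_one_I _
  apply le_antisymm
  · exact max_le (abs_le_one_I _) hle
  · rcases hq with h | h | ⟨i, h⟩
    · refine le_trans ?_ (le_max_left _ _)
      simp only [mem_setOf_eq] at h
      rw [h]; norm_num
    · refine le_trans ?_ (le_max_left _ _)
      simp only [mem_setOf_eq] at h
      rw [h]; norm_num
    · refine le_trans ?_ (le_max_right _ _)
      refine le_trans ?_ (norm_le_pi_norm (fun i => 2 * (q.2 i : ℝ) - 1) i)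
      rcases h with h | h <;> simp only [h] <;> norm_num

/-- Radial expansion of the cube. -/
noncomputable def cubeC {k : ℕ} (q : unitInterval × (Fin k → unitInterval)) :
    unitInterval × (Fin k → unitInterval) :=
  (expand (cubeN q) q.1, fun i => expand (cubeN q) (q.2 i))

theorem cubeC_continuous {k : ℕ} : Continuous (cubeC (k := k)) := by
  have h1 := cubeN_continuous (k := k)
  have h2 : ∀ q : unitInterval × (Fin k → unitInterval), max (cubeN q) (1 / 2) ≠ 0 := by
    intro q
    have := le_max_right (cubeN q) (1 / 2)
    intro h
    rw [h] at this
    norm_num at this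
  unfold cubeC expand
  refine Continuous.prodMk ?_ (continuous_pi fun i => ?_)
  · exact continuous_projIcc.comp (continuous_const.add
      (Continuous.div (by fun_prop) (by fun_prop) h2))
  · exact continuous_projIcc.comp (continuous_const.add
      (Continuous.div (by fun_prop) (by fun_prop) h2))

theorem cubeC_bd {k : ℕ} (q : unitInterval × (Fin k → unitInterval)) (hq : q ∈ prismBd k) :
    cubeC q = q := by
  unfold cubeC
  rw [cubeN_bd q hq]
  simp [expand_one]

theorem cubeC_mem {k : ℕ} (q : unitInterval × (Fin k → unitInterval)) (hq : 1 / 2 ≤ cubeN q) :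
    cubeC q ∈ prismBd k := by
  rcases le_total ‖fun i => 2 * (q.2 i : ℝ) - 1‖ |2 * (q.1 : ℝ) - 1| with h | h
  · have h1 : |2 * (q.1 : ℝ) - 1| = cubeN q := (max_eq_left h).symm
    rcases expand_bd _ _ hq h1 with h2 | h2
    · exact Or.inl h2
    · exact Or.inr (Or.inl h2)
  · have h1 : ‖fun i => 2 * (q.2 i : ℝ) - 1‖ = cubeN q := (max_eq_right h).symm
    right; right
    by_contra hcon
    have hlt : ∀ i, |2 * (q.2 i : ℝ) - 1| < cubeN q := by
      intro i
      refine lt_of_le_of_ne ?_ ?_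
      · rw [← h1]; exact norm_le_pi_norm (fun i => 2 * (q.2 i : ℝ) - 1) i
      · intro h2
        exact hcon ⟨i, expand_bd _ _ hq h2⟩
    have := (pi_norm_lt_iff (x := fun i => 2 * (q.2 i : ℝ) - 1) (r := cubeN q) (by linarith)).2 hlt
    linarith

/-- Homotopy extension for the boundary of the cube. -/
theorem collar {k : ℕ} {X : Type*} [TopologicalSpace X]
    (g' : unitInterval × (Fin k → unitInterval) → X) (hg' : Continuous g')
    (G : unitInterval → unitInterval × (Fin k → unitInterval) → X)
    (hG : ContinuousOn (fun z : unitInterval × (unitInterval × (Fin k → unitInterval)) => G z.1 z.2)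
      {z | z.2 ∈ prismBd k})
    (h1 : ∀ q ∈ prismBd k, G 1 q = g' q) :
    ∃ g : C(unitInterval × (Fin k → unitInterval), X), ∀ q ∈ prismBd k, g q = G 0 q := by
  have hN := cubeN_continuous (k := k)
  have hC := cubeC_continuous (k := k)
  let τ : unitInterval × (Fin k → unitInterval) → unitInterval :=
    fun q => projIcc 0 1 zero_le_one (2 - 2 * cubeN q)
  have hτ : Continuous τ := continuous_projIcc.comp (by fun_prop)
  refine ⟨⟨fun q => if cubeN q ≤ 1 / 2 then g' (cubeC q) else G (τ q) (cubeC q), ?_⟩, ?_⟩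
  · rw [← continuousOn_univ]
    have hu : (univ : Set (unitInterval × (Fin k → unitInterval))) =
        {q | cubeN q ≤ 1 / 2} ∪ {q | 1 / 2 ≤ cubeN q} := by
      ext q
      simpa using le_total _ _
    rw [hu]
    refine ContinuousOn.union_of_isClosed ?_ ?_ (isClosed_le hN continuous_const)
      (isClosed_le continuous_const hN)
    · exact (hg'.comp hC).continuousOn.congr fun q hq => if_pos hq
    · have h2 : ContinuousOn (fun q => G (τ q) (cubeC q)) {q | 1 / 2 ≤ cubeN q} :=
        hG.comp (hτ.prodMk hC).continuousOn (fun q hq => cubeC_mem q hq)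
      refine h2.congr fun q hq => ?_
      simp only
      split_ifs with h3
      · have h4 : cubeN q = 1 / 2 := le_antisymm h3 hq
        have h5 : τ q = 1 := by
          simp only [τ]
          rw [h4, show (2 - 2 * (1 / 2) : ℝ) = 1 by norm_num]
          exact projIcc_right zero_le_one
        rw [h5, h1 _ (cubeC_mem q hq)]
      · rfl
  · intro q hq
    have h2 : τ q = 0 := by
      simp only [τ]
      rw [cubeN_bd q hq, show (2 - 2 * 1 : ℝ) = 0 by norm_num]
      exact projIcc_left zero_le_one
    simp only [ContinuousMap.coe_mk]
    rw [h2, cubeC_bd q hq, if_neg]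
    rw [cubeN_bd q hq]
    norm_num

set_option maxHeartbeats 1000000 in
/-- If `p : K → L` is a simplicial surjective map of polyhedra such that
the preimage of each (closed) simplex of `L` is an `AE(n)`, then `p` is a weak
`n`-homotopy equivalence. -/
theorem statement9 {V W : Type*} (n : ℕ) (K : SComplex V) (L : SComplex W)
    (κ lam : ℝ) (hκ : 0 < κ) (hlam : 0 < lam)
    (p : C((K.space κ), (L.space lam)))
    (hsimp : SComplex.IsSimplicialMap K L κ lam p)
    (hsurj : Function.Surjective p)
    (hAE : ∀ s ∈ L.faces, IsAE.{u} n (p ⁻¹' (L.cell lam s))) :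
    IsWeakNHomotopyEquiv n p := by
  obtain ⟨φ, hφ, hp⟩ := hsimp
  intro k hk x
  constructor
  · rintro a b hab
    induction a using Quotient.inductionOn with | _ f0 => ?_
    induction b using Quotient.inductionOn with | _ f1 => ?_
    obtain ⟨H⟩ := Quotient.exact hab
    let f : unitInterval × (Fin k → unitInterval) → K.space κ := fun q =>
      if q.1 = 0 then f0 q.2 else if q.1 = 1 then f1 q.2 else x
    have hf0 : ∀ q ∈ {q : unitInterval × (Fin k → unitInterval) | q.1 = 0}, f q = f0 q.2 :=
      fun q hq => if_pos hq
    have hf1 : ∀ q ∈ {q : unitInterval × (Fin k → unitInterval) | q.1 = 1}, f q = f1 q.2 := by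
      intro q hq
      have hq' : q.1 = 1 := hq
      simp [f, hq']
    have hfb : ∀ q ∈ {q : unitInterval × (Fin k → unitInterval) | q.2 ∈ Cube.boundary (Fin k)},
        f q = x := by
      intro q hq
      have e0 : f0 q.2 = x := f0.2 _ hq
      have e1 : f1 q.2 = x := f1.2 _ hq
      simp only [f, e0, e1]
      split_ifs <;> rfl
    have hfc : ContinuousOn f (prismBd k) := by
      refine ContinuousOn.union_of_isClosed ?_ (ContinuousOn.union_of_isClosed ?_ ?_ ?_ ?_) ?_ ?_
      · exact (Continuous.continuousOn (f0.1.continuous.comp continuous_snd)).congr hf0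
      · exact (Continuous.continuousOn (f1.1.continuous.comp continuous_snd)).congr hf1
      · exact (continuousOn_const (c := x)).congr hfb
      · exact isClosed_eq (by fun_prop) continuous_const
      · exact (cubeBd_closed k).preimage continuous_snd
      · exact isClosed_eq (by fun_prop) continuous_const
      · exact (isClosed_eq (by fun_prop) continuous_const).union
          ((cubeBd_closed k).preimage continuous_snd)
    have hpf : ∀ q ∈ prismBd k, p (f q) = H q := by
      rintro ⟨t, y⟩ (h | h | h)
      · rw [hf0 _ h]
        change t = 0 at h
        subst h
        exact (H.apply_zero y).symm
      · rw [hf1 _ h]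
        change t = 1 at h
        subst h
        exact (H.apply_one y).symm
      · rw [hfb _ h]
        rw [H.eq_fst t h]
        exact (congrArg p (f0.2 y h)).symm
    obtain ⟨T, hT⟩ := SComplex.exists_finite_mass L hlam H.toContinuousMap
    replace hT : ∀ q, SComplex.cut (T : Set W) (H q).1 ≠ 0 := hT T subset_rfl
    let h' : C(unitInterval × (Fin k → unitInterval), L.space lam) :=
      ⟨fun q => L.push hlam (T : Set W) 1 (H q), by
        rw [← continuousOn_univ]
        exact (L.push_continuousOn hlam (T : Set W)).comp
          (f := fun q => ((1 : unitInterval), H q)) (by fun_prop) (fun q _ => hT q)⟩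
    have hcut : ∀ q ∈ prismBd k, SComplex.cut (T : Set W) (p (f q)).1 ≠ 0 := fun q hq => by
      rw [hpf q hq]; exact hT q
    have hGc : ContinuousOn (fun z : unitInterval × (unitInterval × (Fin k → unitInterval)) =>
        K.push hκ (φ ⁻¹' (T : Set W)) z.1 (f z.2)) {z | z.2 ∈ prismBd k} := by
      refine (K.push_continuousOn hκ (φ ⁻¹' (T : Set W))).comp
        (f := fun z : unitInterval × (unitInterval × (Fin k → unitInterval)) => (z.1, f z.2))
        (s := {z | z.2 ∈ prismBd k}) (continuousOn_fst.prodMk (hfc.comp continuousOn_snd ?_)) ?_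
      · exact fun z hz => hz
      · exact fun z hz => (SComplex.map_push hκ hlam p φ hp T (f z.2) (hcut _ hz)).1
    obtain ⟨g', hg'1, -⟩ := SComplex.lift_finite (m := k + 1) hk
      (fun q : unitInterval × (Fin k → unitInterval) =>
        Fin.cons (α := fun _ => ℝ) (q.1 : ℝ) (fun i => (q.2 i : ℝ)))
      (by
        refine continuous_pi fun i => ?_
        refine Fin.cases ?_ (fun j => ?_) i
        · simp only [Fin.cons_zero]; fun_prop
        · simp only [Fin.cons_succ]; fun_prop)
      (by
        intro a b
        rw [Prod.dist_eq]
        refine max_le ?_ ?_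
        · exact dist_le_pi_dist (Fin.cons (α := fun _ => ℝ) (a.1 : ℝ) (fun i => (a.2 i : ℝ)))
            (Fin.cons (α := fun _ => ℝ) (b.1 : ℝ) (fun i => (b.2 i : ℝ))) 0
        · rw [dist_pi_le_iff dist_nonneg]
          intro i
          exact dist_le_pi_dist (Fin.cons (α := fun _ => ℝ) (a.1 : ℝ) (fun i => (a.2 i : ℝ)))
            (Fin.cons (α := fun _ => ℝ) (b.1 : ℝ) (fun i => (b.2 i : ℝ))) i.succ)
      L hlam p hAE (prismBd k) (prismBd_closed k)
      (fun q => K.push hκ (φ ⁻¹' (T : Set W)) 1 (f q))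
      (hGc.comp (f := fun q => ((1 : unitInterval), q)) (by fun_prop) (fun q hq => hq))
      h'
      (by
        intro q hq
        rw [(SComplex.map_push hκ hlam p φ hp T (f q) (hcut q hq)).2, hpf q hq]
        rfl)
      T
      (fun q w hw => by exact_mod_cast (L.push_supp hlam (T : Set W) (H q) (hT q) w hw).1)
    obtain ⟨g, hg⟩ := collar g' g'.continuous
      (fun t q => K.push hκ (φ ⁻¹' (T : Set W)) t (f q)) hGc (fun q hq => (hg'1 hq).symm)
    have hgf : ∀ q ∈ prismBd k, g q = f q := fun q hq => by
      rw [hg q hq]; exact K.push_zero hκ _ _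
    refine Quotient.sound ⟨⟨⟨g, fun y => ?_, fun y => ?_⟩, ?_⟩⟩
    · have hm : ((0 : unitInterval), y) ∈ prismBd k := Or.inl rfl
      exact (hgf _ hm).trans (hf0 _ rfl)
    · have hm : ((1 : unitInterval), y) ∈ prismBd k := Or.inr (Or.inl rfl)
      exact (hgf _ hm).trans (hf1 _ rfl)
    · intro t y hy
      have hm : (t, y) ∈ prismBd k := Or.inr (Or.inr hy)
      exact ((hgf _ hm).trans (hfb _ hy)).trans (f0.2 y hy).symm
  · intro b
    induction b using Quotient.inductionOn with | _ γ => ?_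
    obtain ⟨T0, hT0⟩ := SComplex.exists_finite_mass L hlam γ.1
    obtain ⟨s, hs, hxs⟩ := x.2.2.1
    let T := T0 ∪ s.image φ
    have hT : ∀ q, SComplex.cut (T : Set W) (γ.1 q).1 ≠ 0 := hT0 T Finset.subset_union_left
    have hxT : ∀ v, x.1 v ≠ 0 → v ∈ φ ⁻¹' (T : Set W) := by
      intro v hv
      have : φ v ∈ T := Finset.mem_union_right _ (Finset.mem_image_of_mem φ (hxs v hv))
      exact_mod_cast this
    have hpx := (K.push_of_supp hκ _ x hxT).2
    let h' : C(Fin k → unitInterval, L.space lam) :=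
      ⟨fun q => L.push hlam (T : Set W) 1 (γ.1 q), by
        rw [← continuousOn_univ]
        exact (L.push_continuousOn hlam (T : Set W)).comp
          (f := fun q => ((1 : unitInterval), γ.1 q)) (by fun_prop) (fun q _ => hT q)⟩
    have hsupp : ∀ y w, (h' y).1 w ≠ 0 → w ∈ (T : Set W) ∧ (γ.1 y).1 w ≠ 0 :=
      fun y w hw => L.push_supp hlam (T : Set W) (γ.1 y) (hT y) w hw
    obtain ⟨g, hg1, hg2⟩ := SComplex.lift_finite (m := k) hk.le
      (fun (q : Fin k → unitInterval) i => (q i : ℝ)) (by fun_prop)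
      (by
        intro a b
        rw [dist_pi_le_iff dist_nonneg]
        intro i
        exact dist_le_pi_dist (fun i => (a i : ℝ)) (fun i => (b i : ℝ)) i)
      L hlam p hAE (Cube.boundary (Fin k)) (cubeBd_closed k) (fun _ => x) continuousOn_const h'
      (by
        intro y hy
        have e1 : γ.1 y = p x := γ.2 y hy
        have e2 := SComplex.map_push hκ hlam p φ hp T x (by rw [← e1]; exact hT y)
        have e3 := e2.2
        rw [hpx] at e3
        change p x = L.push hlam (T : Set W) 1 (γ.1 y)
        rw [e1]
        exact e3)
      T (fun y w hw => by exact_mod_cast (hsupp y w hw).1)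
    have hcell : ∀ y, ∃ s ∈ L.faces, (∀ w, (p (g y)).1 w ≠ 0 → w ∈ s) ∧
        (∀ w, (γ.1 y).1 w ≠ 0 → w ∈ s) := by
      intro y
      obtain ⟨s, hs, hys⟩ := (γ.1 y).2.2.1
      exact ⟨s, hs, hg2 y s hs (fun w hw => hys w (hsupp y w hw).2), hys⟩
    refine ⟨Quotient.mk _ ⟨g, fun y hy => hg1 hy⟩, Quotient.sound ⟨⟨⟨⟨fun q =>
      ⟨(1 - (q.1 : ℝ)) • (p (g q.2)).1 + (q.1 : ℝ) • (γ.1 q.2).1, ?_⟩, ?_⟩, fun y => ?_,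
        fun y => ?_⟩, ?_⟩⟩⟩
    · obtain ⟨s, hs, h1, h2⟩ := hcell q.2
      exact SComplex.seg_mem (p (g q.2)).2 (γ.1 q.2).2 hs h1 h2 q.1
    · refine Continuous.subtype_mk ?_ _
      fun_prop
    · apply Subtype.ext
      simp
    · apply Subtype.ext
      simp
    · intro t y hy
      have e1 : γ.1 y = p x := γ.2 y hy
      have e2 : g y = x := hg1 hy
      apply Subtype.ext
      change (1 - (t : ℝ)) • (p (g y)).1 + (t : ℝ) • (γ.1 y).1 = (p (g y)).1
      rw [e1, e2, ← add_smul]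
      simp
end

section
/- Let p: Y → Z be a surjective continuous map of metric spaces and let ℱ be a cover of Z that is either an open cover or a closed, locally finite, locally finite-dimensional cover, and assume that the pull-back p^{-1}(ℱ) is an AE(n)-cover of Y. Let X be an at most n-dimensional metric space, f: X → Z a continuous map, A a closed subset of X, and g₀: A → Y a continuous map with p ∘ g₀ = f|_A. Then there exists a continuous map g: X → Y such that g|_A = g₀ and p ∘ g is ℱ-close to f. -/
open Set Metric unitInterval
open scoped ENNReal Classical

universe u

lemma covDim_cube {T : Type*} [MetricSpace T] [CompactSpace T] (n : ℕ) (j : T → (Fin n → ℝ))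
    (hj : Isometry j) : CovDimLE T n := by
  intro U hU hcov
  obtain ⟨δ, hδ, hL⟩ := lebesgue_number_lemma_of_metric_sUnion (s := (univ : Set T))
    isCompact_univ hU (by rw [hcov])
  set ε := δ / 2 with hε
  have hε0 : 0 < ε := by positivity
  let Box : Fin (n + 1) → (Fin n → ℤ) → Set T := fun k m =>
    {t | ∀ i, (m i : ℝ) < j t i / ε - (k : ℝ) / (n + 1) ∧ j t i / ε - (k : ℝ) / (n + 1) < m i + 1}
  have hji : ∀ i, Continuous fun t => j t i := fun i => (continuous_apply i).comp hj.continuous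
  refine ⟨{r | r.Nonempty ∧ ∃ k m, r = Box k m}, ?_, ?_, ?_, ?_⟩
  · rintro r ⟨-, k, m, rfl⟩
    have : Box k m = ⋂ i, {t | (m i : ℝ) < j t i / ε - (k : ℝ) / (n + 1) ∧
        j t i / ε - (k : ℝ) / (n + 1) < m i + 1} := by
      ext t; simp [Box]
    rw [this]
    refine isOpen_iInter_of_finite fun i => ?_
    have hc : Continuous fun t => j t i / ε - (k : ℝ) / (n + 1) :=
      ((hji i).div_const _).sub continuous_const
    exact (isOpen_lt continuous_const hc).inter (isOpen_lt hc continuous_const)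
  · rw [eq_univ_iff_forall]
    intro t
    by_contra hcon
    have key : ∀ k : Fin (n + 1), ∃ i, ∃ z : ℤ, j t i / ε - (k : ℝ) / (n + 1) = z := by
      intro k
      by_contra hk
      push Not at hk
      apply hcon
      have hm : t ∈ Box k (fun i => ⌊j t i / ε - (k : ℝ) / (n + 1)⌋) := by
        intro i
        exact ⟨lt_of_le_of_ne (Int.floor_le _) (hk i _).symm, Int.lt_floor_add_one _⟩
      exact mem_sUnion.2 ⟨_, ⟨⟨t, hm⟩, k, _, rfl⟩, hm⟩
    choose ii zz hz using key
    obtain ⟨k, k', hkk, heq⟩ := Fintype.exists_ne_map_eq_of_card_lt ii (by simp)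
    apply hkk
    have h1 := hz k
    have h2 := hz k'
    rw [← heq] at h2
    have h3 : ((k' : ℝ) - k) = (zz k - zz k') * (n + 1) := by
      have hn : (n : ℝ) + 1 ≠ 0 := by positivity
      have : ((k' : ℝ) - k) / (n + 1) = zz k - zz k' := by rw [← h1, ← h2]; ring
      field_simp at this
      linarith
    have h4 : ((k' : ℕ) : ℤ) - ((k : ℕ) : ℤ) = (zz k - zz k') * ((n : ℤ) + 1) := by
      exact_mod_cast h3
    have hk1 := k.2
    have hk2 := k'.2
    have h5 : zz k - zz k' = 0 := by
      by_contra h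
      rcases lt_or_gt_of_ne h with h | h
      · nlinarith
      · nlinarith
    rw [h5] at h4
    ext
    omega
  · rintro r ⟨⟨t, ht⟩, k, m, rfl⟩
    obtain ⟨u, hu, hsub⟩ := hL t (mem_univ _)
    refine ⟨u, hu, fun t' ht' => hsub ?_⟩
    rw [mem_ball, ← hj.dist_eq]
    refine lt_of_le_of_lt ((dist_pi_le_iff hε0.le).2 fun i => ?_) (half_lt_self hδ)
    have a := ht i
    have b := ht' i
    rw [Real.dist_eq]
    have : |j t' i / ε - j t i / ε| ≤ 1 := by
      rw [abs_le]; constructor <;> linarith [a.1, a.2, b.1, b.2]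
    rw [← sub_div, abs_div, abs_of_pos hε0, div_le_one hε0] at this
    exact this
  · intro t
    have hsub : {r | r ∈ {r | r.Nonempty ∧ ∃ k m, r = Box k m} ∧ t ∈ r} ⊆
        range (fun k : Fin (n + 1) => Box k (fun i => ⌊j t i / ε - (k : ℝ) / (n + 1)⌋)) := by
      rintro r ⟨⟨-, k, m, rfl⟩, ht⟩
      refine ⟨k, ?_⟩
      have : (fun i => ⌊j t i / ε - (k : ℝ) / (n + 1)⌋) = m := by
        funext i
        exact Int.floor_eq_iff.2 ⟨(ht i).1.le, (ht i).2⟩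
      simp only [this]
    refine ⟨(finite_range _).subset hsub, (ncard_le_ncard hsub (finite_range _)).trans ?_⟩
    rw [← image_univ]
    refine (ncard_image_le finite_univ).trans ?_
    simp [ncard_univ]

lemma ae_nonempty {W : Type*} [TopologicalSpace W] {n : ℕ} (h : IsAE.{u} n W) : Nonempty W := by
  have hd : CovDimLE (PUnit.{u+1}) n := by
    intro U hU hc
    refine ⟨{univ}, by simp, by simp, ?_, fun x => ?_⟩
    · rintro r rfl
      have : PUnit.unit ∈ ⋃₀ U := by rw [hc]; trivial
      obtain ⟨u, hu, hx⟩ := this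
      exact ⟨u, hu, fun y _ => hx⟩
    · have hs : {r : Set PUnit.{u+1} | r ∈ ({univ} : Set (Set PUnit.{u+1})) ∧ x ∈ r} ⊆ {univ} :=
        fun r hr => hr.1
      refine ⟨(finite_singleton _).subset hs, (ncard_le_ncard hs (finite_singleton _)).trans ?_⟩
      simp
  obtain ⟨g, -⟩ := h PUnit.{u+1} hd ∅ isClosed_empty ⟨fun a => a.2.elim, by
    rw [continuous_iff_continuousAt]; exact fun a => a.2.elim⟩
  exact ⟨g PUnit.unit⟩

lemma ae_cube {W : Type*} [TopologicalSpace W] {n : ℕ} (h : IsAE.{u} n W)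
    (E : Set (Fin n → ℝ)) (hE : IsClosed E) (hEQ : E ⊆ Icc 0 1) (ψ : (Fin n → ℝ) → W)
    (hψ : ContinuousOn ψ E) : ∃ Ψ : (Fin n → ℝ) → W, Continuous Ψ ∧ EqOn Ψ ψ E := by
  have hd : CovDimLE (ULift.{u} (Icc (0 : Fin n → ℝ) 1)) n :=
    covDim_cube n (fun t => t.down.1) (by intro a b; rfl)
  let d : ULift.{u} (Icc (0 : Fin n → ℝ) 1) → (Fin n → ℝ) := fun t => t.down.1
  have hdc : Continuous d := continuous_subtype_val.comp continuous_uliftDown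
  obtain ⟨g, hg⟩ := h _ hd (d ⁻¹' E) (hE.preimage hdc)
    ⟨fun a => ψ (d a), hψ.comp_continuous (hdc.comp continuous_subtype_val) fun a => a.2⟩
  let c : (Fin n → ℝ) → (Icc (0 : Fin n → ℝ) 1) := fun z =>
    ⟨fun i => max 0 (min 1 (z i)), fun i => le_max_left _ _, fun i => by simp⟩
  have hc : Continuous c := by
    refine Continuous.subtype_mk (continuous_pi fun i => ?_) _
    exact continuous_const.max (continuous_const.min (continuous_apply i))
  refine ⟨fun z => g (ULift.up (c z)), g.continuous.comp (continuous_uliftUp.comp hc), ?_⟩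
  intro z hz
  have hcz : (c z : Fin n → ℝ) = z := by
    funext i
    have := hEQ hz
    simp only [c]
    have h1 : z i ≤ 1 := this.2 i
    have h0 : 0 ≤ z i := this.1 i
    rw [min_eq_right h1, max_eq_right h0]
  have := hg ⟨ULift.up (c z), by show (c z : Fin n → ℝ) ∈ E; rwa [hcz]⟩
  simp only [ContinuousMap.coe_mk] at this
  refine this.trans ?_
  show ψ (c z) = ψ z
  rw [hcz]

lemma ae_cube_local {W : Type*} [MetricSpace W] {n : ℕ} (hn : 0 < n) (h : IsAE.{u} n W)
    (y : W) (ε : ℝ) (hε : 0 < ε) : ∃ δ > 0, ∀ (E : Set (Fin n → ℝ)), IsClosed E → E ⊆ Icc 0 1 →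
      ∀ ψ : (Fin n → ℝ) → W, ContinuousOn ψ E → (∀ z ∈ E, dist (ψ z) y < δ) →
      ∃ Ψ : (Fin n → ℝ) → W, Continuous Ψ ∧ EqOn Ψ ψ E ∧ ∀ z ∈ Icc 0 1, dist (Ψ z) y < ε := by
  by_contra hcon
  push Not at hcon
  have hcon' := fun m : ℕ => hcon (1 / ((m : ℝ) + 1)) (by positivity)
  choose E hEc hEQ ψ hψc hψy hno using hcon'
  let i0 : Fin n := ⟨0, hn⟩
  let r : ℕ → ℝ := fun m => (1 / 2) ^ (m + 2)
  have hr0 : ∀ m, 0 < r m := fun m => by positivity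
  have hr1 : ∀ m, r m ≤ 1 / 4 := fun m => by
    have : (1 / 2 : ℝ) ^ (m + 2) ≤ (1 / 2) ^ 2 :=
      pow_le_pow_of_le_one (by norm_num) (by norm_num) (by omega)
    simp only [r]; linarith
  have hrs : ∀ m m', m < m' → 2 * r m' ≤ r m := fun m m' hm => by
    have : (1 / 2 : ℝ) ^ (m' + 2) ≤ (1 / 2) ^ (m + 3) :=
      pow_le_pow_of_le_one (by norm_num) (by norm_num) (by omega)
    have e : (1 / 2 : ℝ) ^ (m + 3) = (1 / 2) ^ (m + 2) * (1 / 2) := pow_succ _ _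
    simp only [r]; linarith
  have hrt : ∀ η > 0, ∃ m, 3 * r m < η := fun η hη => by
    obtain ⟨m, hm⟩ := exists_pow_lt_of_lt_one (show 0 < η / 3 by positivity)
      (show (1 / 2 : ℝ) < 1 by norm_num)
    refine ⟨m, ?_⟩
    have : (1 / 2 : ℝ) ^ (m + 2) ≤ (1 / 2) ^ m :=
      pow_le_pow_of_le_one (by norm_num) (by norm_num) (by omega)
    simp only [r]; linarith
  let a : ℕ → (Fin n → ℝ) → (Fin n → ℝ) := fun m z i => 2 * r m + r m * z i
  let b : ℕ → (Fin n → ℝ) → (Fin n → ℝ) := fun m x i => x i / r m - 2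
  have hac : ∀ m, Continuous (a m) := fun m => continuous_pi fun i =>
    continuous_const.add (continuous_const.mul (continuous_apply i))
  have hbc : ∀ m, Continuous (b m) := fun m => continuous_pi fun i =>
    ((continuous_apply i).div_const _).sub continuous_const
  have hba : ∀ m z, b m (a m z) = z := fun m z => by
    funext i
    have := (hr0 m).ne'
    simp only [a, b]; field_simp; ring
  have hab : ∀ m, ∀ z ∈ Icc (0 : Fin n → ℝ) 1, ∀ i, 2 * r m ≤ a m z i ∧ a m z i ≤ 3 * r m := by
    intro m z hz i
    have h0 : 0 ≤ z i := hz.1 i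
    have h1 : z i ≤ 1 := hz.2 i
    have := hr0 m
    simp only [a]
    constructor <;> nlinarith
  let P : ℕ → Set (Fin n → ℝ) := fun m => a m '' E m
  have hP : ∀ m, ∀ x ∈ P m, ∀ i, 2 * r m ≤ x i ∧ x i ≤ 3 * r m := by
    rintro m _ ⟨z, hz, rfl⟩ i
    exact hab m z (hEQ m hz) i
  have hPc : ∀ m, IsClosed (P m) := fun m =>
    ((isCompact_Icc.of_isClosed_subset (hEc m) (hEQ m)).image (hac m)).isClosed
  have hPn : ∀ m, ∀ x ∈ P m, ‖x‖ ≤ 3 * r m := fun m x hx => by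
    rw [pi_norm_le_iff_of_nonneg (by linarith [hr0 m])]
    intro i
    rw [Real.norm_eq_abs, abs_of_nonneg (by linarith [hr0 m, (hP m x hx i).1])]
    exact (hP m x hx i).2
  have hloc : ∀ m m' x, x ∈ P m' → 7 / 4 * r m < x i0 → x i0 < 7 / 2 * r m → m' = m := by
    intro m m' x hx h1 h2
    have h3 := hP m' x hx i0
    have := hr0 m
    have := hr0 m'
    rcases lt_trichotomy m m' with hl | hl | hl
    · have := hrs _ _ hl; linarith
    · exact hl.symm
    · have := hrs _ _ hl; linarith
  have huniq : ∀ m m' x, x ∈ P m → x ∈ P m' → m' = m := fun m m' x hx hx' =>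
    hloc m m' x hx' (by linarith [hr0 m, (hP m x hx i0).1]) (by linarith [hr0 m, (hP m x hx i0).2])
  let S : Set (Fin n → ℝ) := {0} ∪ ⋃ m, P m
  have hSc : IsClosed S := by
    have : S = ⋂ M : ℕ, (closedBall 0 (3 * r M) ∪ ⋃ m ∈ Finset.range M, P m) := by
      ext x
      simp only [S, mem_union, mem_singleton_iff, mem_iUnion, mem_iInter, mem_closedBall,
        dist_zero_right, Finset.mem_range, exists_prop]
      constructor
      · rintro (rfl | ⟨m, hm⟩) M
        · left; simp [(hr0 M).le]
        · by_cases hmM : m < M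
          · exact Or.inr ⟨m, hmM, hm⟩
          · left
            refine (hPn m x hm).trans ?_
            rcases eq_or_lt_of_le (not_lt.1 hmM) with rfl | hl
            · exact le_rfl
            · have := hrs _ _ hl; linarith [hr0 m]
      · intro hx
        by_cases hx0 : x = 0
        · exact Or.inl hx0
        · right
          obtain ⟨M, hM⟩ := hrt ‖x‖ (norm_pos_iff.2 hx0)
          rcases hx M with h | ⟨m, -, hm⟩
          · linarith
          · exact ⟨m, hm⟩
    rw [this]
    refine isClosed_iInter fun M => isClosed_closedBall.union ?_
    exact Set.Finite.isClosed_biUnion (Finset.finite_toSet _) fun m _ => hPc m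
  have hSQ : S ⊆ Icc 0 1 := by
    rintro x (rfl | hx)
    · exact ⟨le_rfl, fun i => zero_le_one⟩
    · obtain ⟨m, hm⟩ := mem_iUnion.1 hx
      refine ⟨fun i => ?_, fun i => ?_⟩
      · show (0 : ℝ) ≤ x i
        linarith [hr0 m, (hP m x hm i).1]
      · show x i ≤ (1 : ℝ)
        linarith [hr1 m, (hP m x hm i).2]
  let Φ : (Fin n → ℝ) → W := fun x =>
    if hx : ∃ m, x ∈ P m then ψ hx.choose (b hx.choose x) else y
  have hΦ : ∀ m, ∀ x ∈ P m, Φ x = ψ m (b m x) := by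
    intro m x hx
    have hex : ∃ m, x ∈ P m := ⟨m, hx⟩
    simp only [Φ, dif_pos hex]
    rw [huniq m _ x hx hex.choose_spec]
  have hΦ0 : Φ 0 = y := by
    refine dif_neg ?_
    rintro ⟨m, hm⟩
    have h1 : 2 * r m ≤ (0 : Fin n → ℝ) i0 := (hP m 0 hm i0).1
    have h2 := hr0 m
    simp only [Pi.zero_apply] at h1
    linarith
  have hΦy : ∀ m, ∀ x ∈ P m, dist (Φ x) y < 1 / ((m : ℝ) + 1) := by
    rintro m x hx
    rw [hΦ m x hx]
    obtain ⟨z, hz, rfl⟩ := hx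
    rw [hba]
    exact hψy m z hz
  have hΦc : ContinuousOn Φ S := by
    rintro x (rfl | hx)
    · rw [Metric.continuousWithinAt_iff]
      intro η hη
      obtain ⟨M, hM⟩ := exists_nat_one_div_lt hη
      refine ⟨2 * r M, by linarith [hr0 M], ?_⟩
      rintro x (rfl | hx) hd
      · simpa using hη
      · obtain ⟨m, hm⟩ := mem_iUnion.1 hx
        rw [hΦ0]
        refine (hΦy m x hm).trans (lt_of_le_of_lt ?_ hM)
        have h1 : |x i0| ≤ ‖x‖ := norm_le_pi_norm x i0
        rw [dist_zero_right] at hd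
        have h2 := hP m x hm i0
        have h3 : r m < r M := by linarith [le_abs_self (x i0)]
        have h4 : M < m := by
          by_contra h4
          rcases eq_or_lt_of_le (not_lt.1 h4) with rfl | hl
          · exact lt_irrefl _ h3
          · have := hrs _ _ hl; linarith [hr0 M]
        apply one_div_le_one_div_of_le (by positivity)
        have : (M : ℝ) < m := by exact_mod_cast h4
        linarith
    · obtain ⟨m, hm⟩ := mem_iUnion.1 hx
      have hmem : P m ∈ nhdsWithin x S := by
        have hO : IsOpen {x : Fin n → ℝ | 7 / 4 * r m < x i0 ∧ x i0 < 7 / 2 * r m} :=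
          (isOpen_lt continuous_const (continuous_apply i0)).inter
            (isOpen_lt (continuous_apply i0) continuous_const)
        have hxO : x ∈ {x : Fin n → ℝ | 7 / 4 * r m < x i0 ∧ x i0 < 7 / 2 * r m} :=
          ⟨by linarith [hr0 m, (hP m x hm i0).1], by linarith [hr0 m, (hP m x hm i0).2]⟩
        rw [mem_nhdsWithin]
        refine ⟨_, hO, hxO, ?_⟩
        rintro x' ⟨⟨h1, h2⟩, (rfl | hx')⟩
        · simp only [Pi.zero_apply] at h1
          linarith [hr0 m]
        · obtain ⟨m', hm'⟩ := mem_iUnion.1 hx'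
          rwa [hloc m m' x' hm' h1 h2] at hm'
      have hc : ContinuousOn Φ (P m) := by
        have : ContinuousOn (fun x => ψ m (b m x)) (P m) := by
          refine (hψc m).comp (hbc m).continuousOn ?_
          rintro _ ⟨z, hz, rfl⟩
          rwa [hba]
        exact this.congr fun x hx => hΦ m x hx
      exact (hc x hm).mono_of_mem_nhdsWithin hmem
  obtain ⟨Ψ, hΨc, hΨ⟩ := ae_cube h S hSc hSQ Φ hΦc
  have hΨ0 : Ψ 0 = y := (hΨ (Or.inl rfl)).trans hΦ0
  obtain ⟨η, hη, hball⟩ := Metric.continuous_iff.1 hΨc 0 ε hε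
  obtain ⟨m, hm⟩ := hrt η hη
  obtain ⟨z, hz, hzε⟩ := hno m (fun z => Ψ (a m z)) (hΨc.comp (hac m)) (by
    intro z hz
    have hx : a m z ∈ P m := ⟨z, hz, rfl⟩
    show Ψ (a m z) = ψ m z
    rw [hΨ (Or.inr (mem_iUnion.2 ⟨m, hx⟩)), hΦ m _ hx, hba])
  have := hball (a m z) (by
    rw [dist_zero_right]
    refine lt_of_le_of_lt ?_ hm
    rw [pi_norm_le_iff_of_nonneg (by linarith [hr0 m])]
    intro i
    have := hab m z hz i
    rw [Real.norm_eq_abs, abs_of_nonneg (by linarith [hr0 m])]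
    exact this.2)
  rw [hΨ0] at this
  exact absurd this (not_lt.2 hzε)

def Dsx {κ : Type*} (s : Finset κ) : Set (κ → ℝ) :=
  {t | (∀ i, 0 ≤ t i) ∧ (∀ i, i ∉ s → t i = 0) ∧ ∑ i ∈ s, t i = 1}

lemma Dsx_le_one {κ : Type*} {s : Finset κ} {t : κ → ℝ} (ht : t ∈ Dsx s) (i : κ) : t i ≤ 1 := by
  by_cases hi : i ∈ s
  · rw [← ht.2.2]
    exact Finset.single_le_sum (f := t) (fun j _ => ht.1 j) hi
  · rw [ht.2.1 i hi]; exact zero_le_one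

lemma Dsx_isClosed {κ : Type*} (s : Finset κ) : IsClosed (Dsx s) := by
  have : Dsx s = (⋂ i, {t : κ → ℝ | 0 ≤ t i}) ∩ ((⋂ i, ⋂ (_ : i ∉ s), {t : κ → ℝ | t i = 0}) ∩
      {t : κ → ℝ | ∑ i ∈ s, t i = 1}) := by
    ext t; simp [Dsx]
  rw [this]
  refine (isClosed_iInter fun i => isClosed_le continuous_const (continuous_apply i)).inter
    ((isClosed_iInter fun i => isClosed_iInter fun _ =>
      isClosed_eq (continuous_apply i) continuous_const).inter
      (isClosed_eq (continuous_finsetSum _ fun i _ => continuous_apply i) continuous_const))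

lemma Dsx_isCompact {κ : Type*} (s : Finset κ) : IsCompact (Dsx s) := by
  refine (isCompact_univ_pi (fun _ : κ => isCompact_Icc (a := (0 : ℝ)) (b := 1))).of_isClosed_subset
    (Dsx_isClosed s) ?_
  intro t ht i _
  exact ⟨ht.1 i, Dsx_le_one ht i⟩

lemma Dsx_nonempty {κ : Type*} {s : Finset κ} (hs : s.Nonempty) : (Dsx s).Nonempty := by
  obtain ⟨i, hi⟩ := hs
  refine ⟨Pi.single i 1, fun j => ?_, fun j hj => ?_, ?_⟩
  · by_cases h : j = i
    · subst h; simp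
    · simp [h]
  · have : j ≠ i := fun h => hj (h ▸ hi)
    simp [this]
  · rw [Finset.sum_eq_single i] <;> simp_all

lemma Dsx_mono {κ : Type*} {s s' : Finset κ} (h : s ⊆ s') : Dsx s ⊆ Dsx s' := by
  intro t ht
  refine ⟨ht.1, fun i hi => ht.2.1 i fun hh => hi (h hh), ?_⟩
  rw [← ht.2.2]
  exact (Finset.sum_subset h fun i _ hi => ht.2.1 i hi).symm

lemma Dsx_erase {κ : Type*} {s : Finset κ} {t : κ → ℝ} (ht : t ∈ Dsx s) {i : κ} (hi : t i = 0) :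
    t ∈ Dsx (s.erase i) := by
  refine ⟨ht.1, fun j hj => ?_, ?_⟩
  · by_cases h : j = i
    · rw [h, hi]
    · exact ht.2.1 j fun hs => hj (Finset.mem_erase.2 ⟨h, hs⟩)
  · rw [← ht.2.2]
    refine Finset.sum_subset (Finset.erase_subset _ _) fun j hj hj' => ?_
    by_cases h : j = i
    · rw [h, hi]
    · exact absurd (Finset.mem_erase.2 ⟨h, hj⟩) hj'

lemma Dsx_embed {κ : Type*} {n : ℕ} (s : Finset κ) (hs : s.Nonempty) (hc : s.card ≤ n + 1) :
    ∃ sg : Fin n → κ, InjOn (fun t : κ → ℝ => t ∘ sg) (Dsx s) := by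
  obtain ⟨i0, hi0⟩ := hs
  have hc' : (s.erase i0).card ≤ n := by
    rw [Finset.card_erase_of_mem hi0]; omega
  let e := (s.erase i0).equivFin
  refine ⟨fun m => if hm : (m : ℕ) < (s.erase i0).card then (e.symm ⟨m, hm⟩ : κ) else i0, ?_⟩
  intro t ht t' ht' htt
  have h1 : ∀ i ∈ s.erase i0, t i = t' i := by
    intro i hi
    have := congrFun htt ⟨(e ⟨i, hi⟩ : ℕ), (e ⟨i, hi⟩).2.trans_le hc'⟩
    simpa using this
  funext i
  by_cases his : i ∈ s
  · by_cases hii : i = i0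
    · subst hii
      have a := ht.2.2
      have b := ht'.2.2
      rw [← Finset.add_sum_erase s _ his] at a b
      rw [Finset.sum_congr rfl h1] at a
      linarith
    · exact h1 i (Finset.mem_erase.2 ⟨hii, his⟩)
  · rw [ht.2.1 i his, ht'.2.1 i his]

lemma simplex_transport {κ W : Type*} [TopologicalSpace W] {n : ℕ} (s : Finset κ)
    (hs : s.Nonempty) (hc : s.card ≤ n + 1) (B : Set (κ → ℝ)) (hB : IsClosed B) (hBs : B ⊆ Dsx s)
    (β : (κ → ℝ) → W) (hβ : ContinuousOn β B) :
    ∃ j : (κ → ℝ) → (Fin n → ℝ), Continuous j ∧ MapsTo j (Dsx s) (Icc 0 1) ∧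
      ∃ (E : Set (Fin n → ℝ)) (ψ : (Fin n → ℝ) → W), IsClosed E ∧ E ⊆ Icc 0 1 ∧
        ContinuousOn ψ E ∧ (∀ z ∈ E, ∃ t ∈ B, ψ z = β t) ∧ ∀ t ∈ B, j t ∈ E ∧ ψ (j t) = β t := by
  obtain ⟨sg, hsg⟩ := Dsx_embed s hs hc
  set j : (κ → ℝ) → (Fin n → ℝ) := fun t => t ∘ sg with hj
  have hjc : Continuous j := continuous_pi fun m => continuous_apply (sg m)
  have hjm : MapsTo j (Dsx s) (Icc 0 1) := fun t ht =>
    ⟨fun m => ht.1 _, fun m => Dsx_le_one ht _⟩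
  have hBc : IsCompact B := (Dsx_isCompact s).of_isClosed_subset hB hBs
  let ψ : (Fin n → ℝ) → W := fun z => β (Function.invFunOn j B z)
  have hψ : ∀ t ∈ B, ψ (j t) = β t := by
    intro t ht
    have hex : ∃ t' ∈ B, j t' = j t := ⟨t, ht, rfl⟩
    have h1 := Function.invFunOn_mem hex
    have h2 := Function.invFunOn_eq hex
    simp only [ψ]
    rw [hsg (hBs h1) (hBs ht) h2]
  refine ⟨j, hjc, hjm, j '' B, ψ, (hBc.image hjc).isClosed, ?_, ?_, ?_, ?_⟩
  · rintro _ ⟨t, ht, rfl⟩; exact hjm (hBs ht)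
  · rw [continuousOn_iff_isClosed]
    intro T hT
    obtain ⟨u, hu, hue⟩ := continuousOn_iff_isClosed.1 hβ T hT
    refine ⟨j '' (B ∩ u), ((hBc.inter_right hu).image hjc).isClosed, ?_⟩
    ext z
    constructor
    · rintro ⟨hz, t, ht, rfl⟩
      refine ⟨⟨t, ⟨ht, ?_⟩, rfl⟩, t, ht, rfl⟩
      have : t ∈ β ⁻¹' T ∩ B := ⟨by rw [mem_preimage, ← hψ t ht]; exact hz, ht⟩
      rw [hue] at this
      exact this.1
    · rintro ⟨⟨t, ⟨ht, htu⟩, rfl⟩, h2⟩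
      refine ⟨?_, h2⟩
      have : t ∈ u ∩ B := ⟨htu, ht⟩
      rw [← hue] at this
      rw [mem_preimage, hψ t ht]
      exact this.1
  · rintro _ ⟨t, ht, rfl⟩; exact ⟨t, ht, hψ t ht⟩
  · intro t ht; exact ⟨⟨t, ht, rfl⟩, hψ t ht⟩

lemma ae_simplex {κ W : Type*} [TopologicalSpace W] {n : ℕ} (h : IsAE.{u} n W) (s : Finset κ)
    (hs : s.Nonempty) (hc : s.card ≤ n + 1) (B : Set (κ → ℝ)) (hB : IsClosed B) (hBs : B ⊆ Dsx s)
    (β : (κ → ℝ) → W) (hβ : ContinuousOn β B) :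
    ∃ γ : (κ → ℝ) → W, Continuous γ ∧ EqOn γ β B := by
  obtain ⟨j, hjc, hjm, E, ψ, hE, hEQ, hψ, h1, h2⟩ := simplex_transport s hs hc B hB hBs β hβ
  obtain ⟨Ψ, hΨ, he⟩ := ae_cube h E hE hEQ ψ hψ
  exact ⟨fun t => Ψ (j t), hΨ.comp hjc, fun t ht => (he (h2 t ht).1).trans (h2 t ht).2⟩

lemma ae_simplex_local (κ : Type*) {W : Type*} [MetricSpace W] {n : ℕ} (hn : 0 < n)
    (h : IsAE.{u} n W) (y : W) (ε : ℝ) (hε : 0 < ε) :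
    ∃ δ > 0, ∀ (s : Finset κ), s.Nonempty → s.card ≤ n + 1 → ∀ (B : Set (κ → ℝ)), IsClosed B →
      B ⊆ Dsx s → ∀ (β : (κ → ℝ) → W), ContinuousOn β B → (∀ t ∈ B, dist (β t) y < δ) →
    ∃ γ : (κ → ℝ) → W, Continuous γ ∧ EqOn γ β B ∧ ∀ t ∈ Dsx s, dist (γ t) y < ε := by
  obtain ⟨δ, hδ, hδ'⟩ := ae_cube_local hn h y ε hε
  refine ⟨δ, hδ, fun s hs hc B hB hBs β hβ hy => ?_⟩
  obtain ⟨j, hjc, hjm, E, ψ, hE, hEQ, hψ, h1, h2⟩ := simplex_transport s hs hc B hB hBs β hβ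
  obtain ⟨Ψ, hΨ, he, hs⟩ := hδ' E hE hEQ ψ hψ fun z hz => by
    obtain ⟨t, ht, e⟩ := h1 z hz
    rw [e]; exact hy t ht
  exact ⟨fun t => Ψ (j t), hΨ.comp hjc, fun t ht => (he (h2 t ht).1).trans (h2 t ht).2,
    fun t ht => hs _ (hjm ht)⟩

def BestExt {κ W : Type*} [MetricSpace W] (s : Finset κ) (B : Set (κ → ℝ))
    (β γ : (κ → ℝ) → W) : Prop :=
  ContinuousOn γ (Dsx s) ∧ EqOn γ β B ∧ ∀ γ' : (κ → ℝ) → W, ContinuousOn γ' (Dsx s) →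
    EqOn γ' β B → ∀ r : ℝ, (∀ t ∈ Dsx s, ∀ t' ∈ Dsx s, dist (γ' t) (γ' t') ≤ r) →
      ∀ t ∈ Dsx s, ∀ t' ∈ Dsx s, dist (γ t) (γ t') ≤ 2 * r

lemma exists_best {κ W : Type*} [MetricSpace W] {n : ℕ} (h : IsAE.{u} n W) (s : Finset κ)
    (hs : s.Nonempty) (hc : s.card ≤ n + 1) (B : Set (κ → ℝ)) (hB : IsClosed B) (hBs : B ⊆ Dsx s)
    (hBn : B.Nonempty) (β : (κ → ℝ) → W) (hβ : ContinuousOn β B) :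
    ∃ γ, BestExt s B β γ := by
  let R : Set ℝ := {r | ∃ γ' : (κ → ℝ) → W, ContinuousOn γ' (Dsx s) ∧
    EqOn γ' β B ∧ ∀ t ∈ Dsx s, ∀ t' ∈ Dsx s, dist (γ' t) (γ' t') ≤ r}
  obtain ⟨t0, ht0⟩ := hBn
  have hR0 : ∀ r ∈ R, 0 ≤ r := by
    rintro r ⟨γ', -, -, hr⟩
    exact dist_nonneg.trans (hr t0 (hBs ht0) t0 (hBs ht0))
  have hRne : R.Nonempty := by
    obtain ⟨γ, hγ, he⟩ := ae_simplex h s hs hc B hB hBs β hβ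
    have hb := ((Dsx_isCompact s).image hγ).isBounded
    obtain ⟨C, hC⟩ := Metric.isBounded_iff.1 hb
    exact ⟨C, γ, hγ.continuousOn, he, fun t ht t' ht' => hC ⟨t, ht, rfl⟩ ⟨t', ht', rfl⟩⟩
  have hRb : BddBelow R := ⟨0, hR0⟩
  rcases (le_csInf hRne hR0).eq_or_lt with h0 | h0
  · refine ⟨fun _ => β t0, continuousOn_const, ?_, ?_⟩
    · intro t ht
      show β t0 = β t
      by_contra hne
      have hpos : 0 < dist (β t0) (β t) := dist_pos.2 hne
      rw [h0] at hpos
      obtain ⟨r, ⟨γ', -, he, hr⟩, hlt⟩ := exists_lt_of_csInf_lt hRne hpos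
      have := hr t0 (hBs ht0) t (hBs ht)
      rw [he ht0, he ht] at this
      linarith
    · intro γ' h1 h2 r hr t _ t' _
      have := hR0 r ⟨γ', h1, h2, hr⟩
      simp; linarith
  · obtain ⟨r, ⟨γ, h1, h2, hr⟩, hlt⟩ := exists_lt_of_csInf_lt hRne
      (show sInf R < 2 * sInf R by linarith)
    refine ⟨γ, h1, h2, fun γ' h1' h2' r' hr' t ht t' ht' => ?_⟩
    have := csInf_le hRb (show r' ∈ R from ⟨γ', h1', h2', hr'⟩)
    linarith [hr t ht t' ht']

lemma best_local (κ : Type*) {W : Type*} [MetricSpace W] {n : ℕ} (hn : 0 < n)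
    (h : IsAE.{u} n W) (y : W) (ε : ℝ) (hε : 0 < ε) :
    ∃ δ > 0, ∀ (s : Finset κ), s.Nonempty → s.card ≤ n + 1 → ∀ (B : Set (κ → ℝ)), IsClosed B →
      B ⊆ Dsx s → B.Nonempty → ∀ (β γ : (κ → ℝ) → W), ContinuousOn β B →
      (∀ t ∈ B, dist (β t) y < δ) → BestExt s B β γ → ∀ t ∈ Dsx s, dist (γ t) y < ε := by
  obtain ⟨δ, hδ, hδ'⟩ := ae_simplex_local κ hn h y (ε / 5) (by positivity)
  refine ⟨min δ (ε / 5), lt_min hδ (by positivity), ?_⟩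
  intro s hs hc B hB hBs ⟨t0, ht0⟩ β γ hβ hy hbest t ht
  obtain ⟨γ', h1, h2, h3⟩ := hδ' s hs hc B hB hBs β hβ
    fun t ht => (hy t ht).trans_le (min_le_left _ _)
  have := hbest.2.2 γ' h1.continuousOn h2 (2 * ε / 5) (fun t ht t' ht' => by
    have a := h3 t ht
    have b := h3 t' ht'
    have := dist_triangle_right (γ' t) (γ' t') y
    linarith) t ht t0 (hBs ht0)
  have h4 := (hy t0 ht0).trans_le (min_le_right _ _)
  rw [← hbest.2.1 ht0] at h4
  have := dist_triangle (γ t) (γ t0) y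
  linarith

lemma skel {κ W : Type*} [MetricSpace W] {n : ℕ} (hAE : IsAE.{u} n W) (v : κ → W) :
    ∀ k ≤ n, ∃ h : (κ → ℝ) → W, (∀ s : Finset κ, s.card ≤ k + 1 → ContinuousOn h (Dsx s)) ∧
      ∀ y : W, ∀ ε > 0, ∃ δ > 0, ∀ s : Finset κ, s.card ≤ k + 1 → (∀ i ∈ s, dist (v i) y < δ) →
        ∀ t ∈ Dsx s, dist (h t) y < ε := by
  intro k
  induction k with
  | zero =>
    intro _
    obtain ⟨w0⟩ := ae_nonempty hAE
    have hmem : ∀ s : Finset κ, s.card ≤ 0 + 1 → ∀ t ∈ Dsx s, ∃ i ∈ s, t = Pi.single i 1 := by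
      intro s hs t ht
      have hne : s.Nonempty := by
        rw [Finset.nonempty_iff_ne_empty]
        rintro rfl
        simpa using ht.2.2
      obtain ⟨i, rfl⟩ := Finset.card_eq_one.1 (le_antisymm hs hne.card_pos)
      refine ⟨i, by simp, ?_⟩
      funext j
      by_cases hj : j = i
      · subst hj; simpa using ht.2.2
      · rw [ht.2.1 j (by simpa using hj)]; simp [hj]
    refine ⟨fun t => if hx : ∃ i, t i ≠ 0 then v hx.choose else w0, ?_, ?_⟩
    · intro s hs
      have : (Dsx s).Subsingleton := by
        intro t ht t' ht'
        obtain ⟨i, hi, rfl⟩ := hmem s hs t ht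
        obtain ⟨i', hi', rfl⟩ := hmem s hs t' ht'
        rw [Finset.card_le_one.1 hs i hi i' hi']
      exact this.continuousOn _
    · intro y ε hε
      refine ⟨ε, hε, fun s hs hv t ht => ?_⟩
      obtain ⟨i, hi, rfl⟩ := hmem s hs t ht
      have hx : ∃ j, (Pi.single i 1 : κ → ℝ) j ≠ 0 := ⟨i, by simp⟩
      have hch : hx.choose = i := by
        by_contra hne
        exact hx.choose_spec (by simp [hne])
      simp only [dif_pos hx, hch]
      exact hv i hi
  | succ k ih =>
    intro hk
    obtain ⟨h, hcont, hctl⟩ := ih (by omega)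
    let B : Finset κ → Set (κ → ℝ) := fun s => ⋃ i ∈ s, Dsx (s.erase i)
    have hBc : ∀ s, IsClosed (B s) := fun s =>
      Set.Finite.isClosed_biUnion (Finset.finite_toSet s) fun i _ => Dsx_isClosed _
    have hBs : ∀ s, B s ⊆ Dsx s := fun s =>
      iUnion₂_subset fun i _ => Dsx_mono (Finset.erase_subset _ _)
    have hB0 : ∀ s, ∀ t ∈ B s, ∃ i ∈ s, t ∈ Dsx (s.erase i) := by
      intro s t ht
      simpa [B] using ht
    have hBn : ∀ s : Finset κ, s.card = k + 2 → (B s).Nonempty := by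
      intro s hs
      obtain ⟨i, hi⟩ : s.Nonempty := Finset.card_pos.1 (by omega)
      obtain ⟨t, ht⟩ := Dsx_nonempty (s := s.erase i)
        (Finset.card_pos.1 (by rw [Finset.card_erase_of_mem hi]; omega))
      exact ⟨t, mem_biUnion hi ht⟩
    have hBcont : ∀ s : Finset κ, s.card = k + 2 → ContinuousOn h (B s) := by
      intro s hs
      have e : B s = ⋃ i : s, Dsx (s.erase i) := by
        ext t; simp [B]
      rw [e]
      refine (locallyFinite_of_finite _).continuousOn_iUnion (fun i => Dsx_isClosed _) fun i =>
        hcont _ ?_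
      rw [Finset.card_erase_of_mem i.2]; omega
    have hex : ∀ s : Finset κ, s.card = k + 2 → ∃ γ, BestExt s (B s) h γ := fun s hs =>
      exists_best hAE s (Finset.card_pos.1 (by omega)) (by omega) _ (hBc s) (hBs s) (hBn s hs) h
        (hBcont s hs)
    haveI : Nonempty W := ae_nonempty hAE
    choose! γ hγ using hex
    let full : Finset κ → (κ → ℝ) → Prop := fun s t => s.card = k + 2 ∧ t ∈ Dsx s ∧ ∀ i ∈ s, t i ≠ 0
    let h' : (κ → ℝ) → W := fun t => if hx : ∃ s, full s t then γ hx.choose t else h t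
    have hfs : ∀ s s' t, full s t → t ∈ Dsx s' → s ⊆ s' := by
      intro s s' t hs ht i hi
      by_contra hh
      exact hs.2.2 i hi (ht.2.1 i hh)
    have hlow : ∀ s : Finset κ, s.card ≤ k + 1 → ∀ t ∈ Dsx s, h' t = h t := by
      intro s hs t ht
      refine dif_neg ?_
      rintro ⟨s', hs'⟩
      have := Finset.card_le_card (hfs s' s t hs' ht)
      have := hs'.1
      omega
    have htop : ∀ s : Finset κ, s.card = k + 2 → ∀ t ∈ Dsx s, h' t = γ s t := by
      intro s hs t ht
      by_cases hf : ∀ i ∈ s, t i ≠ 0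
      · have hx : ∃ s, full s t := ⟨s, hs, ht, hf⟩
        have : hx.choose = s :=
          Finset.eq_of_subset_of_card_le (hfs _ s t hx.choose_spec ht)
            (by rw [hs, hx.choose_spec.1])
        simp only [h', dif_pos hx, this]
      · push Not at hf
        obtain ⟨i, hi, hti⟩ := hf
        have ht' := Dsx_erase ht hti
        rw [hlow _ (by rw [Finset.card_erase_of_mem hi]; omega) t ht']
        exact ((hγ s hs).2.1 (mem_biUnion hi ht')).symm
    refine ⟨h', fun s hs => ?_, fun y ε hε => ?_⟩
    · rcases Nat.lt_or_ge s.card (k + 2) with hl | hl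
      · exact (hcont s (by omega)).congr (hlow s (by omega))
      · have e : s.card = k + 2 := by omega
        exact (hγ s e).1.congr (htop s e)
    · obtain ⟨δ1, hδ1, h1⟩ := best_local κ (by omega) hAE y ε hε
      obtain ⟨δ2, hδ2, h2⟩ := hctl y δ1 hδ1
      obtain ⟨δ3, hδ3, h3⟩ := hctl y ε hε
      refine ⟨min δ2 δ3, lt_min hδ2 hδ3, fun s hs hv t ht => ?_⟩
      rcases Nat.lt_or_ge s.card (k + 2) with hl | hl
      · rw [hlow s (by omega) t ht]
        exact h3 s (by omega) (fun i hi => (hv i hi).trans_le (min_le_right _ _)) t ht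
      · have e : s.card = k + 2 := by omega
        rw [htop s e t ht]
        refine h1 s (Finset.card_pos.1 (by omega)) (by omega) (B s) (hBc s) (hBs s) (hBn s e) h _
          (hBcont s e) ?_ (hγ s e) t ht
        intro t' ht'
        obtain ⟨i, hi, hti⟩ := hB0 s t' ht'
        refine h2 _ ?_ (fun i' hi' => (hv i' (Finset.mem_of_mem_erase hi')).trans_le
          (min_le_left _ _)) t' hti
        rw [Finset.card_erase_of_mem hi]; omega

lemma dim_precise {X κ : Type*} [TopologicalSpace X] {n : ℕ} (hd : CovDimLE X n) (F : Set X)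
    (hF : IsClosed F) (U : κ → Set X) (hU : ∀ i, IsOpen (U i)) (hFU : F ⊆ ⋃ i, U i) :
    ∃ V : κ → Set X, (∀ i, IsOpen (V i)) ∧ (∀ i, V i ⊆ U i) ∧ (F ⊆ ⋃ i, V i) ∧
      ∀ x, ∀ T : Finset κ, (∀ i ∈ T, x ∈ V i) → T.card ≤ n + 1 := by
  obtain ⟨R, hRo, hRc, hRr, hRn⟩ := hd (range U ∪ {Fᶜ}) (by
    rintro u (⟨i, rfl⟩ | rfl)
    · exact hU i
    · exact hF.isOpen_compl) (by
    rw [eq_univ_iff_forall]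
    intro x
    by_cases hx : x ∈ F
    · obtain ⟨i, hi⟩ := mem_iUnion.1 (hFU hx)
      exact ⟨U i, Or.inl ⟨i, rfl⟩, hi⟩
    · exact ⟨Fᶜ, Or.inr rfl, hx⟩)
  let Q : κ → Set (Set X) := fun i => {r | r ∈ R ∧ ∃ hx : ∃ i, r ⊆ U i, hx.choose = i}
  refine ⟨fun i => ⋃₀ Q i, fun i => isOpen_sUnion fun r hr => hRo r hr.1, ?_, ?_, ?_⟩
  · intro i
    refine sUnion_subset ?_
    rintro r ⟨-, hx, rfl⟩
    exact hx.choose_spec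
  · intro x hx
    have : x ∈ ⋃₀ R := by rw [hRc]; trivial
    obtain ⟨r, hr, hxr⟩ := this
    obtain ⟨w, (⟨i, rfl⟩ | rfl), hw⟩ := hRr r hr
    · have hh : ∃ i, r ⊆ U i := ⟨i, hw⟩
      exact mem_iUnion.2 ⟨hh.choose, r, ⟨hr, hh, rfl⟩, hxr⟩
    · exact absurd hx (hw hxr)
  · intro x T hT
    obtain ⟨hfin, hcard⟩ := hRn x
    choose! c hc using hT
    rw [ncard_eq_toFinset_card _ hfin] at hcard
    refine le_trans (Finset.card_le_card_of_injOn c ?_ ?_) hcard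
    · intro i hi
      simp only [Finite.coe_toFinset]
      exact ⟨(hc i hi).1.1, (hc i hi).2⟩
    · intro i hi i' hi' he
      obtain ⟨h1, h2⟩ := (hc i hi).1.2
      obtain ⟨h1', h2'⟩ := (hc i' hi').1.2
      rw [← h2, ← h2']
      simp only [he]

lemma layer {X κ : Type*} [MetricSpace X] {n : ℕ} (hd : CovDimLE X n) (A : Set X)
    (hA : IsClosed A) (hAn : A.Nonempty) (c : ℝ) (U : κ → Set X) (hU : ∀ i, IsOpen (U i))
    (hAU : Aᶜ ⊆ ⋃ i, U i) :
    ∃ V : κ → Set X, (∀ i, IsOpen (V i)) ∧ (∀ i, V i ⊆ U i) ∧ (Aᶜ ⊆ ⋃ i, V i) ∧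
      ∀ x, ∀ m : ℤ, 1 ≤ (2 * m + c + 1) * infDist x A → (2 * m + c) * infDist x A ≤ 1 →
        ∀ T : Finset κ, (∀ i ∈ T, x ∈ V i) → T.card ≤ n + 1 := by
  let d : X → ℝ := fun x => infDist x A
  have hdc : Continuous d := continuous_infDist_pt A
  have hd0 : ∀ x, 0 ≤ d x := fun x => infDist_nonneg
  have hdp : ∀ x, x ∉ A → 0 < d x := fun x hx => (hA.notMem_iff_infDist_pos hAn).1 hx
  have hdA : ∀ x ∈ A, d x = 0 := fun x hx => infDist_zero_of_mem hx
  let F : ℤ → Set X := fun m => {x | 1 ≤ (2 * m + c + 1) * d x ∧ (2 * m + c) * d x ≤ 1}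
  let N : ℤ → Set X := fun m => {x | 1 < (2 * m + c + 3 / 2) * d x ∧ (2 * m + c - 1 / 2) * d x < 1}
  let G : ℤ → Set X := fun m => {x | 1 < (2 * m + c + 2) * d x ∧ (2 * m + c + 1) * d x < 1}
  have hFc : ∀ m, IsClosed (F m) := fun m =>
    (isClosed_le continuous_const (continuous_const.mul hdc)).inter
      (isClosed_le (continuous_const.mul hdc) continuous_const)
  have hNo : ∀ m, IsOpen (N m) := fun m =>
    (isOpen_lt continuous_const (continuous_const.mul hdc)).inter
      (isOpen_lt (continuous_const.mul hdc) continuous_const)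
  have hGo : ∀ m, IsOpen (G m) := fun m =>
    (isOpen_lt continuous_const (continuous_const.mul hdc)).inter
      (isOpen_lt (continuous_const.mul hdc) continuous_const)
  have hFA : ∀ m, F m ⊆ Aᶜ := by
    intro m x hx hxA
    have := hx.1
    rw [hdA x hxA] at this
    linarith
  have hFN : ∀ m, F m ⊆ N m := by
    intro m x hx
    have := hdp x (hFA m hx)
    exact ⟨by nlinarith [hx.1], by nlinarith [hx.2]⟩
  have hNN : ∀ m m' x, x ∈ N m → x ∈ N m' → ¬ m < m' := by
    intro m m' x hx hx' hl
    have h1 : (m : ℝ) + 1 ≤ m' := by exact_mod_cast hl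
    have := hd0 x
    nlinarith [hx.1, hx'.2]
  have hFG : ∀ m m' x, x ∈ F m → x ∉ G m' := by
    intro m m' x hx hx'
    have := hd0 x
    rcases le_or_gt m m' with hl | hl
    · have h1 : (m : ℝ) ≤ m' := by exact_mod_cast hl
      nlinarith [hx.1, hx'.2]
    · have h1 : (m' : ℝ) + 1 ≤ m := by exact_mod_cast hl
      nlinarith [hx.2, hx'.1]
  have hV := fun m => dim_precise hd (F m) (hFc m) U hU ((hFA m).trans hAU)
  choose V hVo hVU hVF hVn using hV
  refine ⟨fun i => (U i ∩ ⋃ m, G m) ∪ ⋃ m, (V m i ∩ N m), ?_, ?_, ?_, ?_⟩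
  · exact fun i => ((hU i).inter (isOpen_iUnion hGo)).union
      (isOpen_iUnion fun m => (hVo m i).inter (hNo m))
  · exact fun i => union_subset inter_subset_left
      (iUnion_subset fun m => inter_subset_left.trans (hVU m i))
  · intro x hx
    have hp := hdp x hx
    let m : ℤ := ⌊(1 / d x - c) / 2⌋
    have h1 : (m : ℝ) ≤ (1 / d x - c) / 2 := Int.floor_le _
    have h2 : (1 / d x - c) / 2 < m + 1 := Int.lt_floor_add_one _
    have h1' : (2 * m + c) ≤ 1 / d x := by linarith
    have h2' : 1 / d x < (2 * m + c + 2) := by linarith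
    rw [le_div_iff₀ hp] at h1'
    rw [div_lt_iff₀ hp] at h2'
    by_cases h3 : 1 ≤ (2 * m + c + 1) * d x
    · have hF : x ∈ F m := ⟨h3, h1'⟩
      obtain ⟨i, hi⟩ := mem_iUnion.1 (hVF m hF)
      exact mem_iUnion.2 ⟨i, Or.inr (mem_iUnion.2 ⟨m, hi, hFN m hF⟩)⟩
    · obtain ⟨i, hi⟩ := mem_iUnion.1 (hAU hx)
      exact mem_iUnion.2 ⟨i, Or.inl ⟨hi, mem_iUnion.2 ⟨m, h2', not_le.1 h3⟩⟩⟩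
  · intro x m h1 h2 T hT
    have hxF : x ∈ F m := ⟨h1, h2⟩
    refine hVn m x T fun i hi => ?_
    rcases hT i hi with h | h
    · obtain ⟨m', hm'⟩ := mem_iUnion.1 h.2
      exact absurd hm' (hFG m m' x hxF)
    · obtain ⟨m', hm', hN'⟩ := mem_iUnion.1 h
      have a := hNN m m' x (hFN m hxF) hN'
      have b := hNN m' m x hN' (hFN m hxF)
      have : m' = m := by omega
      rwa [this] at hm'

lemma open_refine {X κ : Type*} [MetricSpace X] {n : ℕ} (hd : CovDimLE X n) (A : Set X)
    (hA : IsClosed A) (hAn : A.Nonempty) (U : κ → Set X) (hU : ∀ i, IsOpen (U i))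
    (hAU : Aᶜ ⊆ ⋃ i, U i) :
    ∃ V : κ → Set X, (∀ i, IsOpen (V i)) ∧ (∀ i, V i ⊆ U i) ∧ (Aᶜ ⊆ ⋃ i, V i) ∧
      ∀ x, x ∉ A → ∀ T : Finset κ, (∀ i ∈ T, x ∈ V i) → T.card ≤ n + 1 := by
  obtain ⟨V, hVo, hVU, hVA, hVn⟩ := layer hd A hA hAn 0 U hU hAU
  obtain ⟨V', hVo', hVU', hVA', hVn'⟩ := layer hd A hA hAn 1 V hVo hVA
  refine ⟨V', hVo', fun i => (hVU' i).trans (hVU i), hVA', fun x hx T hT => ?_⟩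
  have hp : 0 < infDist x A := (hA.notMem_iff_infDist_pos hAn).1 hx
  let m : ℤ := ⌊(1 / infDist x A) / 2⌋
  have h1 : (m : ℝ) ≤ (1 / infDist x A) / 2 := Int.floor_le _
  have h2 : (1 / infDist x A) / 2 < m + 1 := Int.lt_floor_add_one _
  have h1' : (2 * m : ℝ) ≤ 1 / infDist x A := by linarith
  have h2' : 1 / infDist x A < (2 * m + 2 : ℝ) := by linarith
  rw [le_div_iff₀ hp] at h1'
  rw [div_lt_iff₀ hp] at h2'
  by_cases h3 : 1 ≤ (2 * m + 1 : ℝ) * infDist x A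
  · exact hVn x m (by linarith) (by linarith) T fun i hi => hVU' i (hT i hi)
  · exact hVn' x m (by linarith) (by linarith) T hT

lemma ae_univ.{v, w} {W : Type w} [MetricSpace W] {n : ℕ} (hAE : IsAE.{u} n W) :
    IsAE.{v} n W := by
  intro X _ hdim A hA φ
  rcases A.eq_empty_or_nonempty with rfl | hAn
  · obtain ⟨w0⟩ := ae_nonempty hAE
    exact ⟨ContinuousMap.const _ w0, fun a => a.2.elim⟩
  let d : X → ℝ := fun x => infDist x A
  have hdp : ∀ x, x ∉ A → 0 < d x := fun x hx => (hA.notMem_iff_infDist_pos hAn).1 hx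
  let O := (Aᶜ : Set X)
  have hnear : ∀ x : O, ∃ a : A, dist (x : X) a < 2 * d x := by
    intro x
    obtain ⟨a, ha, h⟩ := (infDist_lt_iff hAn).1 (show infDist (x : X) A < 2 * d x by
      have := hdp x x.2
      simp only [d] at *; linarith)
    exact ⟨⟨a, ha⟩, h⟩
  choose na hna using hnear
  obtain ⟨V, hVo, hVU, hVA, hVn⟩ := open_refine hdim A hA hAn
    (fun x : O => ball (x : X) (d x / 4)) (fun _ => isOpen_ball) (by
      intro x hx
      refine mem_iUnion.2 ⟨⟨x, hx⟩, mem_ball_self ?_⟩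
      have := hdp x hx
      simp only; positivity)
  obtain ⟨ρ, hρ⟩ := PartitionOfUnity.exists_isSubordinate (X := O) isClosed_univ
    (fun i => (Subtype.val ⁻¹' V i : Set O))
    (fun i => (hVo i).preimage continuous_subtype_val) (by
      intro x _
      obtain ⟨i, hi⟩ := mem_iUnion.1 (hVA x.2)
      exact mem_iUnion.2 ⟨i, hi⟩)
  obtain ⟨h, hcont, hctl⟩ := skel hAE (fun i : O => φ (na i)) n le_rfl
  have hpf : ∀ x : O, {i | ρ i x ≠ 0}.Finite := fun x => ρ.locallyFinite.point_finite x
  let S : O → Finset O := fun x => (hpf x).toFinset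
  have hS : ∀ x i, i ∈ S x ↔ ρ i x ≠ 0 := fun x i => by simp [S]
  have hSV : ∀ x : O, ∀ i ∈ S x, (x : X) ∈ V i := fun x i hi =>
    hρ i (subset_tsupport _ ((hS x i).1 hi))
  have hScard : ∀ x, (S x).card ≤ n + 1 := fun x => hVn x x.2 _ (hSV x)
  let R : O → (O → ℝ) := fun x i => ρ i x
  have hRc : Continuous R := continuous_pi fun i => (ρ i).continuous
  have hRD : ∀ x, R x ∈ Dsx (S x) := by
    intro x
    refine ⟨fun i => ρ.nonneg i x, fun i hi => ?_, ?_⟩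
    · by_contra hh
      exact hi ((hS x i).2 hh)
    · rw [← ρ.sum_eq_one (mem_univ x)]
      symm
      apply finsum_eq_sum_of_support_subset
      intro i hi
      exact (hS x i).2 hi
  have hhc : Continuous fun x => h (R x) := by
    let E : Finset O → Set O := fun s => {x | S x = s}
    have hE : LocallyFinite E := by
      intro x
      obtain ⟨N, hN, hfin⟩ := ρ.locallyFinite x
      refine ⟨N, hN, (hfin.toFinset.powerset.finite_toSet).subset ?_⟩
      rintro s ⟨y, rfl, hy⟩
      simp only [Finset.mem_coe, Finset.mem_powerset]
      intro i hi
      rw [Finite.mem_toFinset]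
      exact ⟨y, (hS y i).1 hi, hy⟩
    refine hE.closure.continuous ?_ (fun _ => isClosed_closure) fun s => ?_
    · rw [eq_univ_iff_forall]
      exact fun x => mem_iUnion.2 ⟨S x, subset_closure rfl⟩
    · rcases (E s).eq_empty_or_nonempty with he | ⟨x, hx⟩
      · rw [he]; simp
      · have hsc : s.card ≤ n + 1 := hx ▸ hScard x
        refine (hcont s hsc).comp hRc.continuousOn ?_
        have : closure (E s) ⊆ R ⁻¹' (Dsx s) :=
          closure_minimal (fun y hy => by
            have := hRD y
            rwa [show S y = s from hy] at this) ((Dsx_isClosed s).preimage hRc)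
        exact this
  let g : X → W := fun x => if hx : x ∈ A then φ ⟨x, hx⟩ else h (R ⟨x, hx⟩)
  have hgA : ∀ a : A, g a = φ a := fun a => dif_pos a.2
  have hgO : ∀ x : O, g x = h (R x) := fun x => dif_neg x.2
  have hg : Continuous g := by
    rw [continuous_iff_continuousAt]
    intro x
    by_cases hx : x ∈ A
    · rw [Metric.continuousAt_iff]
      intro ε hε
      obtain ⟨δ, hδ, hδ'⟩ := hctl (φ ⟨x, hx⟩) ε hε
      obtain ⟨η, hη, hη'⟩ := Metric.continuous_iff.1 φ.continuous ⟨x, hx⟩ (min δ ε) (lt_min hδ hε)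
      refine ⟨η / 6, by positivity, fun {x'} hx' => ?_⟩
      rw [show g x = φ ⟨x, hx⟩ from dif_pos hx]
      by_cases hxA : x' ∈ A
      · rw [show g x' = φ ⟨x', hxA⟩ from dif_pos hxA]
        refine (hη' ⟨x', hxA⟩ ?_).trans_le (min_le_right _ _)
        rw [Subtype.dist_eq]
        show dist x' x < η
        linarith
      · rw [show g x' = h (R ⟨x', hxA⟩) from dif_neg hxA]
        refine hδ' (S ⟨x', hxA⟩) (hScard _) (fun i hi => ?_) _ (hRD _)
        refine (hη' (na i) ?_).trans_le (min_le_left _ _)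
        rw [Subtype.dist_eq]
        have h1 : dist x' (i : X) < d i / 4 := hVU i (hSV _ i hi)
        have h2 : d i ≤ d x' + dist (i : X) x' := infDist_le_infDist_add_dist
        have h3 : d x' ≤ dist x' x := infDist_le_dist_of_mem hx
        have h4 := hna i
        have h5 := dist_triangle4 (na i : X) i x' x
        rw [dist_comm (na i : X) i] at h5
        rw [dist_comm (i : X) x'] at h2 h5
        show dist (na i : X) x < η
        linarith
    · have hOo : IsOpen (Aᶜ : Set X) := hA.isOpen_compl
      have := (hOo.isOpenEmbedding_subtypeVal.continuousAt_iff (g := g) (x := ⟨x, hx⟩)).1 (by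
        have e : g ∘ (Subtype.val : O → X) = fun x => h (R x) := funext hgO
        show ContinuousAt (g ∘ (Subtype.val : O → X)) _
        rw [e]
        exact hhc.continuousAt)
      exact this
  exact ⟨⟨g, hg⟩, hgA⟩


theorem glue_step.{v, w, z} {X : Type v} [MetricSpace X] {Y : Type w} [TopologicalSpace Y]
    {κ : Type z} {n : ℕ}
    (hd : CovDimLE X n) (E : Finset κ → Set X) (hEc : ∀ J, IsClosed (E J))
    (hEf : LocallyFinite E) (hEu : ∀ J J', E J ∩ E J' ⊆ E (J ∪ J'))
    (G : κ → Set Y)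
    (hAE : ∀ J : Finset κ, J.Nonempty → (E J).Nonempty →
      IsAE.{v} n (⋂ r ∈ J, G r : Set Y))
    (B : Set X) (hB : IsClosed B) (Q : Set (Finset κ))
    (hQn : ∀ J ∈ Q, J.Nonempty)
    (hQ : ∀ J ∈ Q, ∀ J', J ⊆ J' → J ≠ J' → E J' ⊆ B)
    (g : X → Y) (hg : ContinuousOn g B)
    (hgG : ∀ x ∈ B, ∀ r, x ∈ E {r} → g x ∈ G r) (hEs : ∀ J, ∀ r ∈ J, E J ⊆ E {r}) :
    ∃ g' : X → Y, ContinuousOn g' (B ∪ ⋃ J : Q, E J) ∧ EqOn g' g B ∧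
      ∀ x ∈ B ∪ ⋃ J : Q, E J, ∀ r, x ∈ E {r} → g' x ∈ G r := by
  have h1 : ∀ J : Q, ∃ e : X → Y, ContinuousOn e (E J) ∧ (∀ x ∈ E J, x ∈ B → e x = g x) ∧
      ∀ x ∈ E J, ∀ r ∈ J.1, e x ∈ G r := by
    rintro ⟨J, hJ⟩
    rcases (E J).eq_empty_or_nonempty with h0 | h0
    · exact ⟨g, by simp [h0], by simp [h0], by simp [h0]⟩
    · have hm : ∀ x : ↥(B ∩ E J), g x.1 ∈ ⋂ r ∈ J, G r := by
        intro x
        simp only [mem_iInter]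
        intro r hr
        exact hgG x.1 x.2.1 r (hEs J r hr x.2.2)
      have hcm : Continuous (fun x : ↥(B ∩ E J) => g x.1) :=
        continuousOn_iff_continuous_restrict.1 (hg.mono inter_subset_left)
      have ha := hAE J (hQn J hJ) h0 X hd (B ∩ E J) (hB.inter (hEc J))
        ⟨fun x => ⟨g x.1, hm x⟩, hcm.subtype_mk hm⟩
      obtain ⟨e, he⟩ := ha
      refine ⟨fun x => (e x).1, (continuous_subtype_val.comp e.continuous).continuousOn, ?_, ?_⟩
      · intro x hx hxB
        have := he ⟨x, hxB, hx⟩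
        exact congrArg Subtype.val this
      · intro x _ r hr
        have := (e x).2
        simp only [mem_iInter] at this
        exact this r hr
  choose e hec heB heG using h1
  have h2 : ∃ g' : X → Y, EqOn g' g B ∧ ∀ J : Q, EqOn g' (e J) (E J) := by
    refine ⟨fun x => if h : x ∉ B ∧ ∃ J : Q, x ∈ E J then e h.2.choose x else g x, ?_, ?_⟩
    · intro x hx
      simp [hx]
    · intro J x hx
      by_cases hxB : x ∈ B
      · simp [hxB, heB J x hx hxB]
      · have h : x ∉ B ∧ ∃ J : Q, x ∈ E J := ⟨hxB, J, hx⟩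
        simp only [dif_pos h]
        have hc := h.2.choose_spec
        generalize h.2.choose = J0 at hc
        by_cases hJ : J0 = J
        · rw [hJ]
        · exfalso
          apply hxB
          have hu := hEu J.1 J0.1 ⟨hx, hc⟩
          by_cases h3 : J.1 = J.1 ∪ J0.1
          · by_cases h4 : J0.1 = J.1 ∪ J0.1
            · exact absurd (Subtype.ext (h4.trans h3.symm)) hJ
            · exact hQ J0.1 J0.2 _ Finset.subset_union_right h4 hu
          · exact hQ J.1 J.2 _ Finset.subset_union_left h3 hu
  obtain ⟨g', h3, h4⟩ := h2
  have hQf : LocallyFinite (fun J : Q => E J) := hEf.comp_injective Subtype.val_injective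
  refine ⟨g', ?_, h3, ?_⟩
  · apply ContinuousOn.union_of_isClosed _ _ hB (hQf.isClosed_iUnion fun J => hEc J)
    · exact hg.congr h3
    · exact hQf.continuousOn_iUnion (fun J => hEc J) fun J => (hec J).congr (h4 J)
  · intro x hx r hr
    by_cases hxB : x ∈ B
    · rw [h3 hxB]; exact hgG x hxB r hr
    · rcases hx with hx | hx
      · exact absurd hx hxB
      · obtain ⟨J, hJ⟩ := mem_iUnion.1 hx
        rw [h4 J hJ]
        by_cases hrJ : r ∈ J.1
        · exact heG J x hJ r hrJ
        · exfalso
          apply hxB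
          refine hQ J.1 J.2 (J.1 ∪ {r}) Finset.subset_union_left ?_ (hEu _ _ ⟨hJ, hr⟩)
          intro h
          apply hrJ
          rw [h]; simp

theorem glue.{v, w, z} {X : Type v} [MetricSpace X] {Y : Type w} [TopologicalSpace Y]
    {κ : Type z} {n : ℕ}
    (hd : CovDimLE X n) (C : κ → Set X) (hC : ∀ i, IsClosed (C i)) (hCf : LocallyFinite C)
    (hCc : ⋃ i, C i = univ)
    (hN : ∀ r, ∃ N : ℕ, ∀ J : Finset κ, r ∈ J → (⋂ j ∈ J, C j).Nonempty → J.card ≤ N)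
    (G : κ → Set Y)
    (hAE : ∀ J : Finset κ, J.Nonempty → (⋂ j ∈ J, C j).Nonempty →
      IsAE.{v} n (⋂ r ∈ J, G r : Set Y))
    (A : Set X) (hA : IsClosed A) (g₀ : X → Y) (hg₀ : ContinuousOn g₀ A)
    (hgG : ∀ x ∈ A, ∀ r, x ∈ C r → g₀ x ∈ G r) :
    ∃ g : X → Y, Continuous g ∧ EqOn g g₀ A ∧ ∀ r, ∀ x ∈ C r, g x ∈ G r := by
  set E : Finset κ → Set X := fun J => ⋂ j ∈ J, C j with hE
  have hmE : ∀ J x, x ∈ E J ↔ ∀ j ∈ J, x ∈ C j := by intro J x; simp [hE]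
  have hE1 : ∀ r, E {r} = C r := by intro r; simp [hE]
  have hEc : ∀ J, IsClosed (E J) := fun J => isClosed_biInter fun j _ => hC j
  have hEf : LocallyFinite E := by
    intro x
    obtain ⟨t, ht, hf⟩ := hCf x
    refine ⟨t, ht, (hf.toFinset.powerset.finite_toSet).subset ?_⟩
    rintro J ⟨y, hy, hyt⟩
    simp only [Finset.coe_powerset, mem_preimage, mem_powerset_iff]
    intro j hj
    simp only [Finite.coe_toFinset, mem_setOf_eq]
    exact ⟨y, (hmE J y).1 hy j hj, hyt⟩
  have hEu : ∀ J J', E J ∩ E J' ⊆ E (J ∪ J') := by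
    rintro J J' x ⟨h1, h2⟩
    rw [hmE] at *
    intro j hj
    rcases Finset.mem_union.1 hj with h | h
    exacts [h1 j h, h2 j h]
  have hEs : ∀ J, ∀ r ∈ J, E J ⊆ E {r} := by
    intro J r hr x hx
    rw [hE1]; exact (hmE J x).1 hx r hr
  set Q : ℕ → Set (Finset κ) := fun k =>
    {J | J.Nonempty ∧ ∀ J', J ⊆ J' → (E J').Nonempty → J'.card < J.card + k} with hQdef
  set B : ℕ → Set X := fun k => A ∪ ⋃ J : Q k, E J with hBdef
  have hBc : ∀ k, IsClosed (B k) := fun k => hA.union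
    ((hEf.comp_injective Subtype.val_injective).isClosed_iUnion fun J => hEc J)
  have hQm : ∀ k, Q k ⊆ Q (k+1) := by
    rintro k J ⟨h1, h2⟩
    exact ⟨h1, fun J' h h' => by have := h2 J' h h'; omega⟩
  have hBm : Monotone B := by
    apply monotone_nat_of_le_succ
    intro k x hx
    rcases hx with hx | hx
    · exact Or.inl hx
    · obtain ⟨J, hJ⟩ := mem_iUnion.1 hx
      exact Or.inr (mem_iUnion.2 ⟨⟨J.1, hQm k J.2⟩, hJ⟩)
  have hBQ : ∀ k, B k ∪ ⋃ J : Q (k+1), E J = B (k+1) := by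
    intro k
    apply Subset.antisymm
    · exact union_subset (hBm (Nat.le_succ k)) subset_union_right
    · exact union_subset (fun x hx => Or.inl (Or.inl hx)) subset_union_right
  have hB0 : B 0 = A := by
    apply Subset.antisymm _ subset_union_left
    rintro x (hx | hx)
    · exact hx
    · obtain ⟨J, hJ⟩ := mem_iUnion.1 hx
      have := J.2.2 J.1 (Finset.Subset.refl _) ⟨x, hJ⟩
      omega
  have hQ' : ∀ k, ∀ J ∈ Q (k+1), ∀ J', J ⊆ J' → J ≠ J' → E J' ⊆ B k := by
    intro k J hJ J' hJJ hne x hx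
    refine Or.inr (mem_iUnion.2 ⟨⟨J', hJ.1.mono hJJ, ?_⟩, hx⟩)
    intro K hK hKn
    have h1 := hJ.2 K (hJJ.trans hK) hKn
    have h2 := Finset.card_lt_card (hJJ.ssubset_of_ne hne)
    omega
  let S : ℕ → (X → Y) → Prop := fun k g => ContinuousOn g (B k) ∧
    ∀ x ∈ B k, ∀ r, x ∈ E {r} → g x ∈ G r
  have hS0 : S 0 g₀ := by
    refine ⟨by rw [hB0]; exact hg₀, ?_⟩
    rw [hB0]
    intro x hx r hr
    rw [hE1] at hr
    exact hgG x hx r hr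
  have hstep : ∀ k g, S k g → ∃ g', S (k+1) g' ∧ EqOn g' g (B k) := by
    intro k g hg
    obtain ⟨g', h1, h2, h3⟩ := glue_step hd E hEc hEf hEu G hAE (B k) (hBc k) (Q (k+1))
      (fun J hJ => hJ.1) (hQ' k) g hg.1 hg.2 hEs
    rw [hBQ] at h1 h3
    exact ⟨g', ⟨h1, h3⟩, h2⟩
  choose! nx hnx1 hnx2 using hstep
  let s : ℕ → X → Y := fun k => Nat.rec g₀ (fun k g => nx k g) k
  have hs : ∀ k, S k (s k) := by
    intro k
    induction k with
    | zero => exact hS0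
    | succ k ih => exact hnx1 k _ ih
  have hse : ∀ k m, k ≤ m → EqOn (s m) (s k) (B k) := by
    intro k m hkm
    induction m, hkm using Nat.le_induction with
    | base => exact fun x _ => rfl
    | succ m hm ih =>
      intro x hx
      exact (hnx2 m _ (hs m) (hBm hm hx)).trans (ih hx)
  choose N hN using hN
  have hCB : ∀ r, C r ⊆ B (N r) := by
    intro r x hx
    refine Or.inr (mem_iUnion.2 ⟨⟨{r}, ⟨r, by simp⟩, ?_⟩, by rw [hE1]; exact hx⟩)
    intro J' h h'
    have := hN r J' (by simpa using h) h'
    simp; omega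
  have hex : ∀ x, ∃ k, x ∈ B k := by
    intro x
    have : x ∈ ⋃ i, C i := by rw [hCc]; trivial
    obtain ⟨r, hr⟩ := mem_iUnion.1 this
    exact ⟨_, hCB r hr⟩
  choose K hK using hex
  have hfin : ∀ k, EqOn (fun x => s (K x) x) (s k) (B k) := by
    intro k x hx
    have h1 := hse k (max k (K x)) (le_max_left _ _) hx
    have h2 := hse (K x) (max k (K x)) (le_max_right _ _) (hK x)
    exact h2.symm.trans h1
  refine ⟨fun x => s (K x) x, ?_, ?_, ?_⟩
  · exact hCf.continuous hCc hC fun r =>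
      (((hs (N r)).1.congr (hfin _)).mono (hCB r))
  · intro x hx
    have : x ∈ B 0 := by rw [hB0]; exact hx
    exact hfin 0 this
  · intro r x hx
    have := hfin _ (hCB r hx)
    simp only at this
    show s (K x) x ∈ G r
    rw [this]
    exact (hs (N r)).2 x (hCB r hx) r (by rw [hE1]; exact hx)

/-- **single lift.** Let `p : Y → Z` be a surjective map of metric spaces
and `ℱ` a cover of `Z` that is open, or closed, locally finite and locally
finite-dimensional, whose pull-back `p⁻¹(ℱ)` is an `AE(n)`-cover.  Then every partial
lift `g₀` (defined on a closed subset `A` of an at most `n`-dimensional metric space `X`)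
of a map `f : X → Z` extends to a global map `g : X → Y` such that `p ∘ g` is
`ℱ`-close to `f`. -/
theorem statement10 {Y Z ι : Type*} [MetricSpace Y] [MetricSpace Z] (n : ℕ)
    (p : C(Y, Z)) (hsurj : Function.Surjective p)
    (F : ι → Set Z) (hcov : IsCover F)
    (halt : (∀ i, IsOpen (F i)) ∨
      ((∀ i, IsClosed (F i)) ∧ LocallyFinite F ∧ LocallyFinDimCover F))
    (hAE : IsAECover.{u} n (fun i => p ⁻¹' F i))
    {X : Type*} [MetricSpace X] (hdim : CovDimLE X n)
    (f : C(X, Z)) (A : Set X) (hA : IsClosed A)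
    (g₀ : C(A, Y)) (hlift : ∀ a : A, p (g₀ a) = f ↑a) :
    ∃ g : C(X, Y), (∀ a : A, g ↑a = g₀ a) ∧
      CoverClose F (fun x => p (g x)) f := by
  have key : ∃ C : ι → Set X, (∀ i, IsClosed (C i)) ∧ LocallyFinite C ∧ (⋃ i, C i = univ) ∧
      (∀ r, ∃ N : ℕ, ∀ J : Finset ι, r ∈ J → (⋂ j ∈ J, C j).Nonempty → J.card ≤ N) ∧
      ∀ i, C i ⊆ f ⁻¹' F i := by
    have hcv : ⋃ i, f ⁻¹' F i = univ := by
      rw [← preimage_iUnion]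
      have hcov' : ⋃ i, F i = univ := hcov
      rw [hcov', preimage_univ]
    rcases halt with ho | ⟨hc, hlf, hfd⟩
    · obtain ⟨V, hVo, hVs, hVc, hVn⟩ := dim_precise hdim univ isClosed_univ
        (fun i => f ⁻¹' F i) (fun i => (ho i).preimage f.continuous) hcv.ge
      obtain ⟨v, hvo, hvc, hvf, hvs⟩ := precise_refinement V hVo (univ_subset_iff.1 hVc)
      obtain ⟨C, hCc, hCcl, hCs⟩ := exists_iUnion_eq_closed_subset hvo
        (fun x => hvf.point_finite x) hvc
      refine ⟨C, hCcl, hvf.subset hCs, hCc, fun r => ⟨n + 1, ?_⟩,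
        fun i => (hCs i).trans ((hvs i).trans (hVs i))⟩
      rintro J - ⟨x, hx⟩
      simp only [mem_iInter] at hx
      exact hVn x J fun i hi => hvs i (hCs i (hx i hi))
    · refine ⟨fun i => f ⁻¹' F i, fun i => (hc i).preimage f.continuous,
        hlf.preimage_continuous f.continuous, hcv, ?_, fun i => Subset.rfl⟩
      intro r
      obtain ⟨N, hN⟩ := hfd r
      refine ⟨N, fun J hr hJ => hN J hr ?_⟩
      obtain ⟨x, hx⟩ := hJ
      refine ⟨f x, ?_⟩
      simpa using hx
  obtain ⟨C, hCcl, hCf, hCc, hCN, hCs⟩ := key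
  rcases isEmpty_or_nonempty X with hX | ⟨⟨x0⟩⟩
  · exact ⟨⟨fun x => hX.elim x, continuous_of_const fun x => hX.elim x⟩,
      fun a => hX.elim a.1, fun x => hX.elim x⟩
  obtain ⟨y0, -⟩ := hsurj (f x0)
  let h₀ : X → Y := fun x => if h : x ∈ A then g₀ ⟨x, h⟩ else y0
  have hh : ∀ a : A, h₀ a = g₀ a := fun a => by simp [h₀]
  obtain ⟨g, hg1, hg2, hg3⟩ := glue hdim C hCcl hCf hCc hCN (fun i => p ⁻¹' F i)
    (by
      intro J hJ hne
      obtain ⟨x, hx⟩ := hne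
      obtain ⟨y, hy⟩ := hsurj (f x)
      simp only [mem_iInter] at hx
      rcases hAE.2 (↑J) hJ with h | h
      · exfalso
        have : y ∈ ⋂ i ∈ (↑J : Set ι), p ⁻¹' F i := by
          simp only [mem_iInter, mem_preimage, hy]
          intro i hi
          exact hCs i (hx i hi)
        rw [h] at this
        exact this
      · exact ae_univ h)
    A hA h₀
    (by
      rw [continuousOn_iff_continuous_restrict]
      exact g₀.continuous.congr fun a => (hh a).symm)
    (by
      intro x hx r hr
      have h1 := hh ⟨x, hx⟩
      have h2 := hlift ⟨x, hx⟩
      simp only at h1 h2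
      rw [mem_preimage, h1, h2]
      exact hCs r hr)
  refine ⟨⟨g, hg1⟩, fun a => (hg2 a.2).trans (hh a), fun x => ?_⟩
  have : x ∈ ⋃ i, C i := by rw [hCc]; trivial
  obtain ⟨i, hi⟩ := mem_iUnion.1 this
  exact ⟨i, hg3 i x hi, hCs i hi⟩
end
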